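/- Let r ≥ 8 be an integer and let G be a finite simple graph with maximum degree at most r that satisfies the planar edge bounds. Then G admits an equitable r-coloring. (This is Theorem 1.4 of the paper, stated for planar graphs; every planar graph satisfies the planar edge bounds by Euler's formula, and the paper's proof uses planarity only through these bounds.) -/

import Mathlib

open scoped Classical

namespace Equitable

variable {V : Type*}

/-- An equitable `r`-coloring of `G`: a proper coloring with `r` colors whose
color classes pairwise differ in size by at most `1`. -/
def IsEquitableColoring [Fintype V] (G : SimpleGraph V) (r : ℕ) (c : V → Fin r) : Prop :=
  (∀ u v : V, G.Adj u v → c u ≠ c v) ∧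
  ∀ i j : Fin r,
    (Finset.univ.filter fun v => c v = i).card ≤
      (Finset.univ.filter fun v => c v = j).card + 1

/-- The number of edges of `G` with both endpoints in `S`. -/
noncomputable def edgesWithin [Fintype V] (G : SimpleGraph V) (S : Finset V) : ℕ :=
  (G.edgeFinset.filter fun e => ∀ v ∈ e, v ∈ S).card

/-- The number of edges of `G` with one endpoint in `X` and the other in `Y`. -/
noncomputable def edgesBetween [Fintype V] (G : SimpleGraph V) (X Y : Finset V) : ℕ :=
  (G.edgeFinset.filter fun e => ∃ u ∈ X, ∃ w ∈ Y, e = s(u, w)).card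

/-- The semi-planar edge bounds. -/
def SemiPlanarBounds [Fintype V] (G : SimpleGraph V) : Prop :=
  (∀ S : Finset V, edgesWithin G S ≤ 3 * S.card) ∧
  ∀ X Y : Finset V, Disjoint X Y → edgesBetween G X Y ≤ 2 * (X.card + Y.card)

/-- The planar edge bounds. -/
def PlanarBounds [Fintype V] (G : SimpleGraph V) : Prop :=
  (∀ S : Finset V, 3 ≤ S.card → edgesWithin G S ≤ 3 * S.card - 6) ∧
  ∀ X Y : Finset V, Disjoint X Y → 3 ≤ X.card + Y.card →
    edgesBetween G X Y ≤ 2 * (X.card + Y.card) - 4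

/-- The semi-planar bipartite edge bound. -/
def SemiPlanarBipBound [Fintype V] (G : SimpleGraph V) : Prop :=
  ∀ X Y : Finset V, Disjoint X Y → edgesBetween G X Y ≤ 2 * (X.card + Y.card)

/-- The planar bipartite edge bound. -/
def PlanarBipBound [Fintype V] (G : SimpleGraph V) : Prop :=
  ∀ X Y : Finset V, Disjoint X Y → 3 ≤ X.card + Y.card →
    edgesBetween G X Y ≤ 2 * (X.card + Y.card) - 4

/-- `P` is an almost equitable coloring of `G − x`: a partition of `V(G) \ {x}` into `r`
independent sets, the small class `P 0` of size `s − 1` and the other classes of size `s`. -/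
def AEColoring [Fintype V] (G : SimpleGraph V) (x : V) {r : ℕ} [NeZero r] (s : ℕ)
    (P : Fin r → Finset V) : Prop :=
  (∀ i j : Fin r, i ≠ j → Disjoint (P i) (P j)) ∧
  (∀ v : V, (∃ i, v ∈ P i) ↔ v ≠ x) ∧
  (∀ i : Fin r, ∀ u ∈ P i, ∀ w ∈ P i, ¬ G.Adj u w) ∧
  (P 0).card = s - 1 ∧
  ∀ i : Fin r, i ≠ 0 → (P i).card = s

/-- The arc relation of the auxiliary digraph `H`: an arc from class `i` to class `j`
iff `i ≠ j` and some vertex of `P i` has no `G`-neighbor in `P j` (such a vertex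
is a witness of the arc and is called movable to `P j`). -/
def Arc (G : SimpleGraph V) {r : ℕ} (P : Fin r → Finset V) (i j : Fin r) : Prop :=
  i ≠ j ∧ ∃ v ∈ P i, ∀ u ∈ P j, ¬ G.Adj v u

/-- A class is accessible if the auxiliary digraph has a directed path (possibly of
length `0`) from it to the small class `P 0`. -/
def Accessible (G : SimpleGraph V) {r : ℕ} [NeZero r] (P : Fin r → Finset V)
    (i : Fin r) : Prop :=
  Relation.ReflTransGen (Arc G P) i 0

/-- The number of accessible classes. -/
noncomputable def accCount (G : SimpleGraph V) {r : ℕ} [NeZero r]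
    (P : Fin r → Finset V) : ℕ :=
  (Finset.univ.filter fun i => Accessible G P i).card

/-- No almost equitable coloring of `G − x` has more accessible classes than `P`. -/
def MaxAccessible [Fintype V] (G : SimpleGraph V) (x : V) {r : ℕ} [NeZero r] (s : ℕ)
    (P : Fin r → Finset V) : Prop :=
  ∀ P' : Fin r → Finset V, AEColoring G x s P' → accCount G P' ≤ accCount G P

/-- Class `i` blocks class `j` if `i ≠ j` and the auxiliary digraph minus the
class `i` has no directed path from `j` to the small class `P 0`. -/
def Blocks (G : SimpleGraph V) {r : ℕ} [NeZero r] (P : Fin r → Finset V)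
    (i j : Fin r) : Prop :=
  i ≠ j ∧ ¬ Relation.ReflTransGen (fun p q => Arc G P p q ∧ p ≠ i ∧ q ≠ i) j 0

/-- An accessible class is terminal if it blocks no accessible class. -/
def Terminal (G : SimpleGraph V) {r : ℕ} [NeZero r] (P : Fin r → Finset V)
    (i : Fin r) : Prop :=
  Accessible G P i ∧ ∀ j : Fin r, Accessible G P j → ¬ Blocks G P i j

/-- `u` is a solo neighbor of `v` (where `v` lies in the accessible class `P i`):
`u` lies in a non-accessible class, is adjacent to `v`, and `v` is the unique
neighbor of `u` in `P i`.  `Q(v)` is the set of such `u`. -/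
def SoloNbr (G : SimpleGraph V) {r : ℕ} [NeZero r] (P : Fin r → Finset V)
    (i : Fin r) (v u : V) : Prop :=
  (∃ k : Fin r, ¬ Accessible G P k ∧ u ∈ P k) ∧ G.Adj v u ∧
    ∀ w ∈ P i, G.Adj u w → w = v

/-- `u ∈ Q'(v)`: `u` is a solo neighbor of `v` that is non-adjacent to some other
solo neighbor of `v`. -/
def InQ' (G : SimpleGraph V) {r : ℕ} [NeZero r] (P : Fin r → Finset V)
    (i : Fin r) (v u : V) : Prop :=
  SoloNbr G P i v u ∧ ∃ u' : V, SoloNbr G P i v u' ∧ u' ≠ u ∧ ¬ G.Adj u u'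

/-- A vertex `v` of a terminal accessible class `P i` is ordinary if some other vertex of
`P i` is movable to another accessible class, or there are at most two accessible classes. -/
def Ordinary (G : SimpleGraph V) {r : ℕ} [NeZero r] (P : Fin r → Finset V)
    (i : Fin r) (v : V) : Prop :=
  (∃ v' ∈ P i, v' ≠ v ∧
    ∃ j : Fin r, j ≠ i ∧ Accessible G P j ∧ ∀ w ∈ P j, ¬ G.Adj v' w) ∨
  accCount G P ≤ 2

/-- The strong component of the auxiliary digraph containing class `i`. -/
noncomputable def strongComp (G : SimpleGraph V) {r : ℕ} (P : Fin r → Finset V)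
    (i : Fin r) : Finset (Fin r) :=
  Finset.univ.filter fun j =>
    Relation.ReflTransGen (Arc G P) i j ∧ Relation.ReflTransGen (Arc G P) j i

set_option linter.unusedSectionVars false

/-- The restriction of a relation to a finite set. -/
def RelOn {α : Type*} (R : α → α → Prop) (K : Finset α) (i j : α) : Prop :=
  R i j ∧ i ∈ K ∧ j ∈ K

section Relations
open Relation
variable {α : Type*} {R R' : α → α → Prop} {K K' : Finset α} {a b i j : α}

theorem RelOn.reach_mono (hK : K ⊆ K') (h : ReflTransGen (RelOn R K) i j) :
    ReflTransGen (RelOn R K') i j :=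
  ReflTransGen.mono (fun _ _ h => ⟨h.1, hK h.2.1, hK h.2.2⟩) _ _ h

theorem RelOn.reach_imp (hR : ∀ i ∈ K, ∀ j ∈ K, R i j → R' i j)
    (h : ReflTransGen (RelOn R K) i j) : ReflTransGen (RelOn R' K) i j :=
  ReflTransGen.mono (fun _ _ h => ⟨hR _ h.2.1 _ h.2.2 h.1, h.2⟩) _ _ h

theorem RelOn.reach_mem (h : ReflTransGen (RelOn R K) i j) (hj : j ∈ K) : i ∈ K := by
  rcases h.cases_head with rfl | ⟨k, hk, -⟩
  · exact hj
  · exact hk.2.1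

theorem RelOn.reach_forget (h : ReflTransGen (RelOn R K) i j) : ReflTransGen R i j :=
  ReflTransGen.mono (fun _ _ h => h.1) _ _ h

/-- A path either avoids `a` or can be restarted from `a` without returning to `a`. -/
theorem RelOn.avoid_or [DecidableEq α] (hirr : ∀ i, ¬ R i i) (haj : a ≠ j)
    (h : ReflTransGen (RelOn R K) b j) :
    ReflTransGen (RelOn R (K.erase a)) b j ∨
      ∃ z, RelOn R K a z ∧ z ≠ a ∧ ReflTransGen (RelOn R (K.erase a)) z j := by
  induction h using ReflTransGen.head_induction_on with
  | refl => exact Or.inl .refl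
  | @head b b' hb _ ih =>
    rcases ih with ih | ih
    · by_cases hba : b = a
      · subst hba
        exact Or.inr ⟨b', hb, fun h => hirr b (by simpa [h] using hb.1), ih⟩
      · have hb' : b' ≠ a := by
          rintro rfl
          rcases ih.cases_head with h | ⟨k, hk, -⟩
          · exact haj h
          · simpa using hk.2.1
        exact Or.inl (.head ⟨hb.1, Finset.mem_erase.2 ⟨hba, hb.2.1⟩,
          Finset.mem_erase.2 ⟨hb', hb.2.2⟩⟩ ih)
    · exact Or.inr ih

theorem RelOn.first_step [DecidableEq α] (hirr : ∀ i, ¬ R i i) (hij : i ≠ j)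
    (h : ReflTransGen (RelOn R K) i j) :
    ∃ z, RelOn R K i z ∧ z ≠ i ∧ ReflTransGen (RelOn R (K.erase i)) z j := by
  rcases RelOn.avoid_or hirr hij h with h | h
  · rcases h.cases_head with h | ⟨k, hk, -⟩
    · exact absurd h hij
    · simpa using hk.2.1
  · exact h

/-- A path whose vertices are closed under the relation stays inside. -/
theorem RelOn.of_closed (hc : ∀ i ∈ K, ∀ j, R i j → j ∈ K) (hi : i ∈ K)
    (h : ReflTransGen R i j) : ReflTransGen (RelOn R K) i j ∧ j ∈ K := by
  induction h with
  | refl => exact ⟨.refl, hi⟩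
  | tail _ h ih => exact ⟨.tail ih.1 ⟨h, ih.2, hc _ ih.2 _ h⟩, hc _ ih.2 _ h⟩

end Relations

section Colorings
open Relation
variable (G : SimpleGraph V) {r : ℕ}

/-- The number of neighbors of `v` in `X`. -/
noncomputable def dg (v : V) (X : Finset V) : ℕ := (X.filter (G.Adj v)).card

/-- A partial coloring is proper if no two adjacent vertices get the same color. -/
def Proper (c : V → Option (Fin r)) : Prop :=
  ∀ u v j, G.Adj u v → c u = some j → c v ≠ some j

/-- `v` has no neighbor of color `j`. -/
def Free (c : V → Option (Fin r)) (v : V) (j : Fin r) : Prop :=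
  ∀ u, c u = some j → ¬ G.Adj v u

/-- Some vertex of color `i` can be moved to color `j`. -/
def arc (c : V → Option (Fin r)) (i j : Fin r) : Prop :=
  i ≠ j ∧ ∃ v, c v = some i ∧ Free G c v j

variable {G} {c d : V → Option (Fin r)} {x v w y : V} {i j k l : Fin r} {K : Finset (Fin r)}

theorem arc_irrefl (i : Fin r) : ¬ arc G c i i := fun h => h.1 rfl

theorem Free.mono (hcd : ∀ u, d u = some j → c u = some j) (h : Free G c v j) : Free G d v j :=
  fun u hu => h u (hcd u hu)

theorem arc_mono (hi : ∀ u, c u = some i → d u = some i) (hj : ∀ u, d u = some j → c u = some j)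
    (h : arc G c i j) : arc G d i j := by
  obtain ⟨hij, v, hv, hf⟩ := h
  exact ⟨hij, v, hi v hv, hf.mono hj⟩

theorem Proper.update (hc : Proper G c) (hv : Free G c v j) :
    Proper G (Function.update c v (some j)) := by
  intro a b k hab ha hb
  by_cases hav : a = v
  · subst hav
    have hba : b ≠ a := hab.ne'
    simp only [Function.update_self, Option.some.injEq] at ha
    subst ha
    rw [Function.update_of_ne hba] at hb
    exact hv b hb hab
  · rw [Function.update_of_ne hav] at ha
    by_cases hbv : b = v
    · subst hbv
      simp only [Function.update_self, Option.some.injEq] at hb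
      subst hb
      exact hv a ha hab.symm
    · rw [Function.update_of_ne hbv] at hb
      exact hc a b k hab ha hb

theorem Proper.update_none (hc : Proper G c) : Proper G (Function.update c v none) := by
  intro a b k hab ha hb
  by_cases hav : a = v
  · subst hav; simp at ha
  · rw [Function.update_of_ne hav] at ha
    by_cases hbv : b = v
    · subst hbv; simp at hb
    · rw [Function.update_of_ne hbv] at hb
      exact hc a b k hab ha hb

theorem update_eq_some_of_ne {t : Option (Fin r)} {u : V} (h1 : c v ≠ some l) (h2 : t ≠ some l) :
    Function.update c v t u = some l ↔ c u = some l := by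
  by_cases huv : u = v
  · subst huv; simp [h1, h2]
  · rw [Function.update_of_ne huv]

variable [Fintype V]

/-- The class of color `j`. -/
noncomputable def cls (c : V → Option (Fin r)) (j : Fin r) : Finset V :=
  Finset.univ.filter fun v => c v = some j

/-- The union of the classes with colors in `C`. -/
noncomputable def un (c : V → Option (Fin r)) (C : Finset (Fin r)) : Finset V :=
  Finset.univ.filter fun v => ∃ j ∈ C, c v = some j

@[simp] theorem mem_cls : v ∈ cls c j ↔ c v = some j := by simp [cls]

@[simp] theorem mem_un {C : Finset (Fin r)} : v ∈ un c C ↔ ∃ j ∈ C, c v = some j := by simp [un]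

theorem dg_cls_eq_zero : dg G v (cls c j) = 0 ↔ Free G c v j := by
  simp [dg, Free, Finset.filter_eq_empty_iff]

theorem dg_cls_pos : 0 < dg G v (cls c j) ↔ ¬ Free G c v j := by
  rw [← dg_cls_eq_zero, Nat.pos_iff_ne_zero]

theorem card_cls_update (t : Option (Fin r)) :
    (cls (Function.update c v t) l).card + (if c v = some l then 1 else 0) =
      (cls c l).card + (if t = some l then 1 else 0) := by
  have h1 : ∀ d : V → Option (Fin r), (cls d l).card =
      ((cls d l).erase v).card + (if d v = some l then 1 else 0) := by
    intro d
    by_cases h : d v = some l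
    · rw [if_pos h, Finset.card_erase_add_one (by simpa using h)]
    · rw [if_neg h, Finset.erase_eq_of_notMem (by simpa using h)]; simp
  have h2 : (cls (Function.update c v t) l).erase v = (cls c l).erase v := by
    ext u
    simp only [Finset.mem_erase, mem_cls]
    refine and_congr_right fun hu => ?_
    rw [Function.update_of_ne hu]
  rw [h1 (Function.update c v t), h1 c, h2, Function.update_self]
  omega

/-- Shifting witnesses along a path of movable vertices from class `i` to class `j`. -/
theorem exists_shift (hc : Proper G c) (hi : i ∈ K)
    (h : ReflTransGen (RelOn (arc G c) K) i j) :
    ∃ d : V → Option (Fin r), Proper G d ∧ (∀ v, d v = none ↔ c v = none) ∧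
      (∀ l ∉ K, ∀ v, d v = some l ↔ c v = some l) ∧
      (∀ v, d v = some i → c v = some i) ∧ (∀ v, c v = some j → d v = some j) ∧
      ∀ l, (cls d l).card + (if l = i then 1 else 0) =
        (cls c l).card + (if l = j then 1 else 0) := by
  induction hn : K.card generalizing K i with
  | zero => simp_all
  | succ n ih =>
    by_cases hij : i = j
    · subst hij
      exact ⟨c, hc, fun _ => Iff.rfl, fun _ _ _ => Iff.rfl, fun _ h => h, fun _ h => h,
        fun _ => rfl⟩
    obtain ⟨z, hiz, hzi, hz⟩ := RelOn.first_step arc_irrefl hij h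
    obtain ⟨d, hd, hnone, hout, hin, hj, hcard⟩ := ih (K := K.erase i) (i := z)
      (Finset.mem_erase.2 ⟨hzi, hiz.2.2⟩) hz (by rw [Finset.card_erase_of_mem hi, hn]; rfl)
    obtain ⟨w, hw, hwz⟩ := hiz.1.2
    have hdw : d w = some i := (hout i (by simp) w).2 hw
    have hfree : Free G d w z := hwz.mono hin
    refine ⟨Function.update d w (some z), hd.update hfree, ?_, ?_, ?_, ?_, ?_⟩
    · intro v
      by_cases hv : v = w
      · subst hv; simp [hw]
      · rw [Function.update_of_ne hv, hnone]
    · intro l hl v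
      rw [update_eq_some_of_ne, hout l (fun h => hl (Finset.mem_of_mem_erase h))]
      · rw [hdw]; rintro ⟨⟩; exact hl hi
      · rintro ⟨⟩; exact hl hiz.2.2
    · intro v hv
      by_cases hvw : v = w
      · subst hvw; exact hw
      · rw [Function.update_of_ne hvw] at hv
        exact (hout i (by simp) v).1 hv
    · intro v hv
      have hvw : v ≠ w := by rintro rfl; rw [hw] at hv; exact hij (Option.some.inj hv)
      rw [Function.update_of_ne hvw]; exact hj v hv
    · intro l
      have h1 := card_cls_update (c := d) (v := w) (l := l) (some z)
      have h2 := hcard l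
      rw [hdw] at h1
      simp only [Option.some.injEq, eq_comm (a := z), eq_comm (a := i)] at h1
      omega

/-- `c` colors everything but `x`, with all classes of size `s` except that the class `o` has
size `s - 1`. -/
structure AE (G : SimpleGraph V) (x : V) (s : ℕ) (c : V → Option (Fin r)) (o : Fin r) : Prop where
  proper : Proper G c
  none_iff : ∀ v, c v = none ↔ v = x
  card : ∀ j, (cls c j).card + (if j = o then 1 else 0) = s

/-- There is a proper coloring with all `r` classes of size `s`. -/
def Done (G : SimpleGraph V) (r s : ℕ) : Prop :=
  ∃ d : V → Option (Fin r), Proper G d ∧ (∀ v, d v ≠ none) ∧ ∀ j, (cls d j).card = s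

theorem AE.done {s : ℕ} {o : Fin r} (h : AE G x s c o) (hx : Free G c x o) : Done G r s := by
  refine ⟨Function.update c x (some o), h.proper.update hx, fun v => ?_, fun l => ?_⟩
  · by_cases hv : v = x
    · subst hv; simp
    · rw [Function.update_of_ne hv]; exact fun h' => hv ((h.none_iff v).1 h')
  · have h1 := card_cls_update (c := c) (v := x) (l := l) (some o)
    rw [(h.none_iff x).2 rfl] at h1
    have h2 := h.card l
    simp only [Option.some.injEq, eq_comm (a := o), reduceCtorEq, if_false] at h1
    omega

theorem AE.shift {s : ℕ} {o : Fin r} (h : AE G x s c o) (hi : i ∈ K)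
    (hp : ReflTransGen (RelOn (arc G c) K) i o) :
    ∃ d, AE G x s d i ∧ (∀ l ∉ K, ∀ v, d v = some l ↔ c v = some l) ∧
      (∀ v, d v = some i → c v = some i) ∧ (∀ v, c v = some o → d v = some o) := by
  obtain ⟨d, hd, hnone, hout, hin, hj, hcard⟩ := exists_shift h.proper hi hp
  refine ⟨d, ⟨hd, fun v => (hnone v).trans (h.none_iff v), fun j => ?_⟩, hout, hin, hj⟩
  have := h.card j
  have := hcard j
  omega

theorem AE.not_free {s : ℕ} {o : Fin r} (h : AE G x s c o) (hD : ¬ Done G r s)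
    (hp : ReflTransGen (arc G c) j o) : ¬ Free G c x j := by
  intro hx
  obtain ⟨d, hd, -, hin, -⟩ := h.shift (K := Finset.univ) (Finset.mem_univ j)
    (ReflTransGen.mono (fun _ _ h => ⟨h, Finset.mem_univ _, Finset.mem_univ _⟩) _ _ hp)
  exact hD (hd.done (hx.mono hin))

end Colorings

section Degrees
variable {G : SimpleGraph V} {X Y Z : Finset V} {v u w : V}

theorem dg_mono (h : X ⊆ Y) : dg G v X ≤ dg G v Y :=
  Finset.card_le_card (Finset.filter_subset_filter _ h)

theorem dg_le_card : dg G v X ≤ X.card := Finset.card_filter_le _ _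

theorem dg_union (h : Disjoint X Y) : dg G v (X ∪ Y) = dg G v X + dg G v Y := by
  rw [dg, Finset.filter_union, Finset.card_union_of_disjoint (Finset.disjoint_filter_filter h)]
  rfl

theorem dg_pos (hu : u ∈ X) (h : G.Adj v u) : 0 < dg G v X :=
  Finset.card_pos.2 ⟨u, Finset.mem_filter.2 ⟨hu, h⟩⟩

theorem exists_of_dg_pos (h : 0 < dg G v X) : ∃ u ∈ X, G.Adj v u := by
  obtain ⟨u, hu⟩ := Finset.card_pos.1 h
  exact ⟨u, Finset.mem_filter.1 hu⟩

theorem dg_eq_card (h : ∀ u ∈ X, G.Adj v u) : dg G v X = X.card := by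
  rw [dg, Finset.filter_true_of_mem h]

theorem dg_erase_of_not_adj (h : ¬ G.Adj v u) : dg G v (X.erase u) = dg G v X := by
  rw [dg, dg]
  congr 1
  ext w
  simp only [Finset.mem_filter, Finset.mem_erase]
  constructor
  · exact fun hw => ⟨hw.1.2, hw.2⟩
  · exact fun hw => ⟨⟨fun h' => h (h' ▸ hw.2), hw.1⟩, hw.2⟩

theorem dg_erase_of_adj (hu : u ∈ X) (h : G.Adj v u) : dg G v (X.erase u) + 1 = dg G v X := by
  rw [dg, dg, Finset.filter_erase]
  exact Finset.card_erase_add_one (Finset.mem_filter.2 ⟨hu, h⟩)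

theorem dg_eq_one_iff (hu : u ∈ X) (h : G.Adj v u) :
    dg G v X = 1 ↔ ∀ w ∈ X, G.Adj v w → w = u := by
  rw [dg, Finset.card_eq_one]
  constructor
  · rintro ⟨a, ha⟩ w hw hvw
    have h1 : w ∈ X.filter (G.Adj v) := Finset.mem_filter.2 ⟨hw, hvw⟩
    have h2 : u ∈ X.filter (G.Adj v) := Finset.mem_filter.2 ⟨hu, h⟩
    rw [ha, Finset.mem_singleton] at h1 h2
    rw [h1, h2]
  · intro hall
    refine ⟨u, Finset.eq_singleton_iff_unique_mem.2 ⟨Finset.mem_filter.2 ⟨hu, h⟩, ?_⟩⟩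
    intro w hw
    exact hall w (Finset.mem_filter.1 hw).1 (Finset.mem_filter.1 hw).2

theorem sum_dg_comm (X Y : Finset V) : ∑ u ∈ X, dg G u Y = ∑ w ∈ Y, dg G w X := by
  have h := Finset.sum_card_bipartiteAbove_eq_sum_card_bipartiteBelow (s := X) (t := Y) G.Adj
  refine h.trans (Finset.sum_congr rfl fun w _ => ?_)
  simp [Finset.bipartiteBelow, dg, G.adj_comm]

/-- The planar edge bounds, phrased with sums of degrees. -/
structure EdgeBounds (G : SimpleGraph V) : Prop where
  inner : ∀ S : Finset V, 3 ≤ S.card → ∑ u ∈ S, dg G u S + 12 ≤ 6 * S.card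
  cross : ∀ X Y : Finset V, Disjoint X Y → 3 ≤ X.card + Y.card →
    ∑ u ∈ X, dg G u Y + 4 ≤ 2 * (X.card + Y.card)

theorem EdgeBounds.not_complete_bipartite (hG : EdgeBounds G) (hX : 3 ≤ X.card) (hY : 3 ≤ Y.card)
    (h : ∀ u ∈ X, ∀ w ∈ Y, G.Adj u w) : False := by
  have hd : Disjoint X Y := Finset.disjoint_left.2 fun a ha hb => (h a ha a hb).ne rfl
  have h1 := hG.cross X Y hd (by omega)
  rw [Finset.sum_congr rfl fun u hu => dg_eq_card (h u hu), Finset.sum_const, smul_eq_mul] at h1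
  nlinarith

theorem EdgeBounds.clique_card_le (hG : EdgeBounds G)
    (h : ∀ u ∈ X, ∀ w ∈ X, u ≠ w → G.Adj u w) : X.card ≤ 4 := by
  by_contra! hX
  have h1 := hG.inner X (by omega)
  have h2 : ∀ u ∈ X, dg G u X = X.card - 1 := by
    intro u hu
    rw [← dg_erase_of_not_adj (G.irrefl (v := u)), dg_eq_card, Finset.card_erase_of_mem hu]
    intro w hw
    exact h u hu w (Finset.mem_erase.1 hw).2 (Finset.mem_erase.1 hw).1.symm
  rw [Finset.sum_congr rfl h2, Finset.sum_const, smul_eq_mul] at h1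
  obtain ⟨m, hm⟩ : ∃ m, X.card = m + 5 := ⟨X.card - 5, by omega⟩
  rw [hm] at h1
  simp only [Nat.add_succ_sub_one] at h1
  nlinarith

variable [Fintype V] {r : ℕ} {c : V → Option (Fin r)} {C D : Finset (Fin r)} {j : Fin r}

theorem un_eq_biUnion : un c C = C.biUnion (cls c) := by
  ext; simp

theorem cls_disjoint {i j : Fin r} (h : i ≠ j) : Disjoint (cls c i) (cls c j) := by
  refine Finset.disjoint_left.2 fun u hu hu' => h ?_
  rw [mem_cls] at hu hu'
  rw [hu] at hu'
  exact Option.some.inj hu'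

theorem un_disjoint (h : Disjoint C D) : Disjoint (un c C) (un c D) := by
  refine Finset.disjoint_left.2 fun u hu hu' => ?_
  simp only [mem_un] at hu hu'
  obtain ⟨i, hi, hui⟩ := hu
  obtain ⟨j, hj, huj⟩ := hu'
  rw [hui] at huj
  cases huj
  exact Finset.disjoint_left.1 h hi hj

theorem un_mono (h : C ⊆ D) : un c C ⊆ un c D := fun u hu => by
  simp only [mem_un] at hu ⊢
  obtain ⟨i, hi, h'⟩ := hu
  exact ⟨i, h hi, h'⟩

theorem un_union : un c (C ∪ D) = un c C ∪ un c D := by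
  ext u
  simp only [mem_un, Finset.mem_union]
  constructor
  · rintro ⟨j, hj | hj, h⟩
    exacts [Or.inl ⟨j, hj, h⟩, Or.inr ⟨j, hj, h⟩]
  · rintro (⟨j, hj, h⟩ | ⟨j, hj, h⟩)
    exacts [⟨j, Or.inl hj, h⟩, ⟨j, Or.inr hj, h⟩]

theorem un_singleton : un c {j} = cls c j := by ext; simp

theorem sum_un {M : Type*} [AddCommMonoid M] (f : V → M) :
    ∑ v ∈ un c C, f v = ∑ j ∈ C, ∑ v ∈ cls c j, f v := by
  rw [un_eq_biUnion, Finset.sum_biUnion]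
  exact fun i _ j _ hij => cls_disjoint hij

theorem card_un : (un c C).card = ∑ j ∈ C, (cls c j).card := by
  simpa only [Finset.card_eq_sum_ones] using sum_un (c := c) (C := C) fun _ => 1

theorem dg_un : dg G v (un c C) = ∑ j ∈ C, dg G v (cls c j) := by
  rw [dg, un_eq_biUnion, Finset.filter_biUnion, Finset.card_biUnion]
  · rfl
  · exact fun i _ j _ hij => Finset.disjoint_filter_filter (cls_disjoint hij)

theorem dg_un_union (h : Disjoint C D) :
    dg G v (un c (C ∪ D)) = dg G v (un c C) + dg G v (un c D) := by
  rw [un_union, dg_union (un_disjoint h)]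

theorem card_le_dg_un (h : ∀ j ∈ C, 1 ≤ dg G v (cls c j)) : C.card ≤ dg G v (un c C) := by
  rw [dg_un, Finset.card_eq_sum_ones]
  exact Finset.sum_le_sum h

end Degrees

section Extremal
open Relation

theorem reach_source_ne {α : Type*} {R : α → α → Prop} {i j : α} (h : ReflTransGen R i j) :
    ReflTransGen (fun a b => R a b ∧ a ≠ j) i j := by
  induction h using ReflTransGen.head_induction_on with
  | refl => exact .refl
  | @head b b' hb _ ih =>
    by_cases hbj : b = j
    · subst hbj; exact .refl
    · exact .head ⟨hb, hbj⟩ ih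

variable [Fintype V] {G : SimpleGraph V} {r s : ℕ} {x : V} {c : V → Option (Fin r)} {o : Fin r}

/-- The colors whose classes can reach the small class. -/
noncomputable def acc (G : SimpleGraph V) (c : V → Option (Fin r)) (o : Fin r) :
    Finset (Fin r) :=
  Finset.univ.filter fun j => ReflTransGen (arc G c) j o

/-- The colors whose classes cannot reach the small class. -/
noncomputable def bcc (G : SimpleGraph V) (c : V → Option (Fin r)) (o : Fin r) :
    Finset (Fin r) := (acc G c o)ᶜ

@[simp] theorem mem_acc {j : Fin r} : j ∈ acc G c o ↔ ReflTransGen (arc G c) j o := by simp [acc]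

@[simp] theorem mem_bcc {j : Fin r} : j ∈ bcc G c o ↔ j ∉ acc G c o := by simp [bcc]

theorem self_mem_acc : o ∈ acc G c o := mem_acc.2 .refl

theorem card_acc_add_card_bcc : (acc G c o).card + (bcc G c o).card = r := by
  rw [bcc, Finset.card_add_card_compl, Fintype.card_fin]

theorem acc_disjoint_bcc : Disjoint (acc G c o) (bcc G c o) := disjoint_compl_right

/-- An almost equitable coloring with the largest number of accessible classes, in a graph
without equitable coloring. -/
structure Ctx (G : SimpleGraph V) (r s : ℕ) (x : V) (c : V → Option (Fin r)) (o : Fin r) :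
    Prop where
  bounds : EdgeBounds G
  deg : ∀ v, dg G v Finset.univ ≤ r
  hr : 8 ≤ r
  degx : dg G x Finset.univ ≤ 5
  ae : AE G x s c o
  nd : ¬ Done G r s
  max : ∀ (c' : V → Option (Fin r)) (o' : Fin r), AE G x s c' o' →
    (acc G c' o').card ≤ (acc G c o).card

/-- The solo neighbors of `v` with respect to the class `W`. -/
noncomputable def Q (G : SimpleGraph V) (c : V → Option (Fin r)) (o W : Fin r) (v : V) :
    Finset V :=
  (un c (bcc G c o)).filter fun y => G.Adj v y ∧ dg G y (cls c W) = 1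

/-- The solo neighbors of `v` that are not adjacent to all other solo neighbors. -/
noncomputable def Q' (G : SimpleGraph V) (c : V → Option (Fin r)) (o W : Fin r) (v : V) :
    Finset V :=
  (Q G c o W v).filter fun y => ∃ y' ∈ Q G c o W v, y' ≠ y ∧ ¬ G.Adj y y'

theorem mem_Q {W : Fin r} {v y : V} : y ∈ Q G c o W v ↔
    (∃ Y ∈ bcc G c o, c y = some Y) ∧ G.Adj v y ∧ dg G y (cls c W) = 1 := by
  rw [Q, Finset.mem_filter, mem_un]

theorem mem_Q' {W : Fin r} {v y : V} : y ∈ Q' G c o W v ↔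
    y ∈ Q G c o W v ∧ ∃ y' ∈ Q G c o W v, y' ≠ y ∧ ¬ G.Adj y y' := by
  rw [Q', Finset.mem_filter]

theorem Q'_subset {W : Fin r} {v : V} : Q' G c o W v ⊆ Q G c o W v := Finset.filter_subset _ _

theorem solo_unique {W : Fin r} {v y u : V} (hv : c v = some W) (h : G.Adj v y)
    (h1 : dg G y (cls c W) = 1) (hu : c u = some W) (hyu : G.Adj y u) : u = v :=
  (dg_eq_one_iff (mem_cls.2 hv) h.symm).1 h1 u (mem_cls.2 hu) hyu

theorem mem_acc_of_arc {i j : Fin r} (h : arc G c i j) (hj : j ∈ acc G c o) : i ∈ acc G c o :=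
  mem_acc.2 (.head h (mem_acc.1 hj))

theorem mem_bcc_of_arc {i j : Fin r} (hi : i ∈ bcc G c o) (h : arc G c i j) : j ∈ bcc G c o :=
  mem_bcc.2 fun hj => mem_bcc.1 hi (mem_acc_of_arc h hj)

theorem reach_bcc {i j : Fin r} (hi : i ∈ bcc G c o) (h : ReflTransGen (arc G c) i j) :
    ReflTransGen (RelOn (arc G c) (bcc G c o)) i j ∧ j ∈ bcc G c o :=
  RelOn.of_closed (fun _ hi _ h => mem_bcc_of_arc hi h) hi h

theorem reach_acc {i : Fin r} (hi : i ∈ acc G c o) :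
    ReflTransGen (RelOn (arc G c) (acc G c o)) i o := by
  have h := mem_acc.1 hi
  clear hi
  induction h using ReflTransGen.head_induction_on with
  | refl => exact .refl
  | head h1 h2 ih =>
    exact .head ⟨h1, mem_acc.2 (.head h1 h2), mem_acc.2 h2⟩ ih

theorem ne_of_bcc {i j : Fin r} (hi : i ∈ bcc G c o) (hj : j ∈ acc G c o) : i ≠ j := by
  rintro rfl; exact mem_bcc.1 hi hj

/-- A vertex of an inaccessible class has a neighbor in every accessible class. -/
theorem dg_acc_pos {u : V} {i j : Fin r} (hu : c u = some i) (hi : i ∈ bcc G c o)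
    (hj : j ∈ acc G c o) : 1 ≤ dg G u (cls c j) :=
  dg_cls_pos.2 fun h => mem_bcc.1 hi (mem_acc_of_arc ⟨ne_of_bcc hi hj, u, hu, h⟩ hj)

theorem dg_pos_of_not_arc {u : V} {i j : Fin r} (hu : c u = some i) (hij : i ≠ j)
    (h : ¬ arc G c i j) : 1 ≤ dg G u (cls c j) :=
  dg_cls_pos.2 fun h' => h ⟨hij, u, hu, h'⟩

theorem Ctx.card_acc_le (h : Ctx G r s x c o) : (acc G c o).card ≤ 5 :=
  (card_le_dg_un fun _ hj => dg_cls_pos.2 (h.ae.not_free h.nd (mem_acc.1 hj))).trans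
    ((dg_mono (Finset.subset_univ _)).trans h.degx)

theorem Ctx.color_ne {v : V} {i : Fin r} (h : Ctx G r s x c o) (hv : c v = some i) : v ≠ x := by
  rintro rfl
  rw [(h.ae.none_iff v).2 rfl] at hv
  cases hv

/-- Distances to the small class. -/
theorem exists_rank (G : SimpleGraph V) (c : V → Option (Fin r)) (o : Fin r) :
    ∃ (ρ : Fin r → ℕ) (p : Fin r → Fin r), ∀ j ∈ acc G c o, j ≠ o →
      p j ∈ acc G c o ∧ arc G c j (p j) ∧ ρ (p j) < ρ j := by
  let N : ℕ → Fin r → Prop := fun n => Nat.rec (fun j => j = o)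
    (fun _ P j => ∃ k, arc G c j k ∧ P k) n
  have hN : ∀ j, ReflTransGen (arc G c) j o → ∃ n, N n j := by
    intro j h
    induction h using ReflTransGen.head_induction_on with
    | refl => exact ⟨0, rfl⟩
    | head h1 _ ih => exact ih.elim fun n hn => ⟨n + 1, _, h1, hn⟩
  have hN' : ∀ n j, N n j → ReflTransGen (arc G c) j o := by
    intro n
    induction n with
    | zero => rintro j (rfl : j = o); exact .refl
    | succ n ih => rintro j ⟨k, hk, hn⟩; exact .head hk (ih k hn)
  have hlt : ∀ j, ∃ k, j ∈ acc G c o → j ≠ o → k ∈ acc G c o ∧ arc G c j k ∧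
      sInf {n | N n k} < sInf {n | N n j} := by
    intro j
    by_cases hj : j ∈ acc G c o
    · have hmem := Nat.sInf_mem (s := {n | N n j}) (hN j (mem_acc.1 hj))
      cases hn : sInf {n | N n j} with
      | zero =>
        rw [hn] at hmem
        exact ⟨j, fun _ h => absurd hmem h⟩
      | succ n =>
        rw [hn] at hmem
        obtain ⟨k, hk, hkn⟩ := hmem
        exact ⟨k, fun _ _ => ⟨mem_acc.2 (hN' n k hkn), hk,
          Nat.lt_succ_of_le (Nat.sInf_le hkn)⟩⟩
    · exact ⟨j, fun h => absurd h hj⟩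
  choose p hp using hlt
  exact ⟨fun j => sInf {n | N n j}, p, fun j hj hjo => hp j hj hjo⟩

theorem rank_path {ρ : Fin r → ℕ} {p : Fin r → Fin r}
    (hρ : ∀ j ∈ acc G c o, j ≠ o → p j ∈ acc G c o ∧ arc G c j (p j) ∧ ρ (p j) < ρ j)
    {j : Fin r} (hj : j ∈ acc G c o) {K : Finset (Fin r)} (hjK : j ∈ K)
    (hK : ∀ k ∈ acc G c o, ρ k < ρ j → k ∈ K) :
    ReflTransGen (RelOn (arc G c) K) j o := by
  induction hn : ρ j using Nat.strong_induction_on generalizing j with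
  | _ n ih =>
    by_cases hjo : j = o
    · rw [hjo]
    · obtain ⟨h1, h2, h3⟩ := hρ j hj hjo
      have hpK := hK _ h1 h3
      exact .head ⟨h2, hjK, hpK⟩ (ih _ (hn ▸ h3) h1 hpK
        (fun k hk hlt => hK k hk (hlt.trans h3)) rfl)

/-- Every other accessible class reaches the small class without using `W`. -/
def Term (G : SimpleGraph V) (c : V → Option (Fin r)) (o W : Fin r) : Prop :=
  W ∈ acc G c o ∧ ∀ j ∈ acc G c o, j ≠ W →
    ReflTransGen (RelOn (arc G c) ((acc G c o).erase W)) j o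

/-- The vertex `w` of the accessible class `W` can be moved to another accessible class, and
from there on to the small class avoiding `W`. -/
def Movable (G : SimpleGraph V) (c : V → Option (Fin r)) (o W : Fin r) (w : V) : Prop :=
  c w = some W ∧ ∃ U ∈ acc G c o, U ≠ W ∧ Free G c w U ∧
    ReflTransGen (RelOn (arc G c) ((acc G c o).erase W)) U o

/-- A movable vertex with a solo neighbor makes many classes accessible. -/
theorem Ctx.card_of_movable (h : Ctx G r s x c o) {W : Fin r} {w y : V}
    (hw : Movable G c o W w) (hW : W ∈ acc G c o) (hwy : G.Adj w y)
    (hy1 : dg G y (cls c W) = 1) {Y : Fin r} (hy : c y = some Y) (hY : Y ∈ bcc G c o)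
    {S : Finset (Fin r)} (hS : ∀ Z ∈ S, Z ∈ bcc G c o ∧ ReflTransGen (arc G c) Z Y) :
    S.card + 2 ≤ (acc G c o).card := by
  obtain ⟨hcw, U, hU, hUW, hfree, hp⟩ := hw
  obtain ⟨d, hd, hout, hin, -⟩ := h.ae.shift (Finset.mem_erase.2 ⟨hUW, hU⟩) hp
  have hdW : ∀ v, d v = some W ↔ c v = some W := hout W (by simp)
  have hdB : ∀ Z ∈ bcc G c o, ∀ v, d v = some Z ↔ c v = some Z := fun Z hZ =>
    hout Z fun hh => mem_bcc.1 hZ (Finset.mem_of_mem_erase hh)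
  have hdw : d w = some W := (hdW w).2 hcw
  set e := Function.update d w (some U) with he
  have heB : ∀ Z ∈ bcc G c o, ∀ v, e v = some Z ↔ c v = some Z := by
    intro Z hZ v
    rw [he, update_eq_some_of_ne, hdB Z hZ]
    · rw [hdw]; rintro ⟨⟩; exact mem_bcc.1 hZ hW
    · rintro ⟨⟩; exact mem_bcc.1 hZ hU
  have heW : ∀ v, e v = some W → c v = some W ∧ v ≠ w := by
    intro v hv
    have hvw : v ≠ w := by
      rintro rfl
      rw [he, Function.update_self] at hv
      exact hUW (Option.some.inj hv)
    rw [he, Function.update_of_ne hvw] at hv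
    exact ⟨(hdW v).1 hv, hvw⟩
  have hae : AE G x s e W := by
    refine ⟨hd.proper.update (hfree.mono hin), fun v => ?_, fun l => ?_⟩
    · by_cases hv : v = w
      · subst hv
        simp [he, h.color_ne hcw]
      · rw [he, Function.update_of_ne hv, hd.none_iff]
    · have h1 := card_cls_update (c := d) (v := w) (l := l) (some U)
      have h2 := hd.card l
      rw [hdw] at h1
      simp only [Option.some.injEq, eq_comm (a := U), eq_comm (a := W)] at h1
      rw [he]
      omega
  have hYW : arc G e Y W := by
    refine ⟨ne_of_bcc hY hW, y, (heB Y hY y).2 hy, fun u hu hyu => ?_⟩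
    exact (heW u hu).2 (solo_unique hcw hwy hy1 (heW u hu).1 hyu)
  have hUWarc : arc G e U W := by
    refine ⟨hUW, w, by simp [he], fun u hu hwu => ?_⟩
    exact h.ae.proper w u W hwu hcw (heW u hu).1
  have hsub : S ∪ {W, U} ⊆ acc G e W := by
    intro Z hZ
    simp only [Finset.mem_union, Finset.mem_insert, Finset.mem_singleton] at hZ
    rcases hZ with hZ | rfl | rfl
    · obtain ⟨hZB, hZY⟩ := hS Z hZ
      have := RelOn.reach_forget (RelOn.reach_imp (R' := arc G e) (fun i hi j hj hij =>
        arc_mono (fun u hu => (heB i hi u).2 hu) (fun u hu => (heB j hj u).1 hu) hij)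
        (reach_bcc hZB hZY).1)
      exact mem_acc.2 (this.tail hYW)
    · exact self_mem_acc
    · exact mem_acc.2 (.single hUWarc)
  have hdisj : Disjoint S {W, U} := by
    rw [Finset.disjoint_left]
    intro Z hZ hZ'
    simp only [Finset.mem_insert, Finset.mem_singleton] at hZ'
    rcases hZ' with rfl | rfl
    exacts [mem_bcc.1 (hS _ hZ).1 hW, mem_bcc.1 (hS _ hZ).1 hU]
  have h1 := Finset.card_le_card hsub
  rw [Finset.card_union_of_disjoint hdisj, Finset.card_pair hUW.symm] at h1
  exact h1.trans (h.max e W hae)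

/-- The coloring in which `y` takes the place of `v`. -/
noncomputable def replace (c : V → Option (Fin r)) (v y : V) (W : Fin r) : V → Option (Fin r) :=
  Function.update (Function.update c v none) y (some W)

theorem replace_class {v y : V} {W Y Z : Fin r} (hv : c v = some W) (hy : c y = some Y)
    (hZ : Z ≠ W) (u : V) : replace c v y W u = some Z ↔ c u = some Z ∧ u ≠ y := by
  rw [replace]
  by_cases huy : u = y
  · subst huy
    simp [hZ.symm]
  · rw [Function.update_of_ne huy]
    by_cases huv : u = v
    · subst huv; simp [hv, hZ.symm]
    · rw [Function.update_of_ne huv]; simp [huy]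

theorem replace_class_self {v y : V} {W : Fin r} (hyv : y ≠ v) (u : V) :
    replace c v y W u = some W ↔ u = y ∨ (u ≠ v ∧ c u = some W) := by
  rw [replace]
  by_cases huy : u = y
  · subst huy; simp
  · rw [Function.update_of_ne huy]
    by_cases huv : u = v
    · subst huv; simp [huy]
    · rw [Function.update_of_ne huv]; simp [huv, huy]

/-- Replacing `v` by its solo neighbor `y`, and making room for `v` by shifting. -/
theorem AE.exists_swap (h : AE G x s c o) {W Y Z : Fin r} {B : Finset (Fin r)} {v y : V}
    (hv : c v = some W) (hWB : W ∉ B) (hy : c y = some Y) (hYB : Y ∈ B) (hvy : G.Adj v y)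
    (hy1 : dg G y (cls c W) = 1) (hZB : Z ∈ B) (hvZ : Free G (replace c v y W) v Z)
    (hp : ReflTransGen (RelOn (arc G (replace c v y W)) B) Z Y) :
    ∃ d, AE G x s d o ∧ (∀ l ∉ B, l ≠ W → ∀ u, d u = some l ↔ c u = some l) ∧
      (∀ u, d u = some W ↔ u = y ∨ (u ≠ v ∧ c u = some W)) ∧ d v = some Z := by
  have hyv : y ≠ v := hvy.ne'
  have hYW : Y ≠ W := fun hh => hWB (hh ▸ hYB)
  have hZW : Z ≠ W := fun hh => hWB (hh ▸ hZB)
  have hvx : v ≠ x := by rintro rfl; rw [(h.none_iff v).2 rfl] at hv; cases hv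
  have hyx : y ≠ x := by rintro rfl; rw [(h.none_iff y).2 rfl] at hy; cases hy
  have hprop : Proper G (replace c v y W) := by
    refine h.proper.update_none.update fun u hu hyu => ?_
    by_cases huv : u = v
    · subst huv; simp at hu
    · rw [Function.update_of_ne huv] at hu
      exact huv (solo_unique hv hvy hy1 hu hyu)
  obtain ⟨d, hd, hnone, hout, hin, -, hcard⟩ := exists_shift hprop hZB hp
  have hdv : d v = none := by
    rw [hnone, replace, Function.update_of_ne hyv.symm, Function.update_self]
  have hWd : ∀ l ≠ Z, ∀ u, Function.update d v (some Z) u = some l ↔ d u = some l := by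
    intro l hl u
    rw [update_eq_some_of_ne]
    · rw [hdv]; simp
    · simpa using hl.symm
  refine ⟨Function.update d v (some Z), ⟨hd.update (hvZ.mono hin), fun u => ?_, fun l => ?_⟩,
    fun l hl hlW u => ?_, fun u => ?_, Function.update_self ..⟩
  · by_cases huv : u = v
    · subst huv; simp [hvx]
    · rw [Function.update_of_ne huv, hnone, replace, ← h.none_iff]
      by_cases huy : u = y
      · subst huy; simp [hy]
      · rw [Function.update_of_ne huy, Function.update_of_ne huv]
  · have h1 := card_cls_update (c := d) (v := v) (l := l) (some Z)
    have h2 := hcard l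
    have h3 := card_cls_update (c := Function.update c v none) (v := y) (l := l) (some W)
    have h4 := card_cls_update (c := c) (v := v) (l := l) none
    have h5 := h.card l
    rw [Function.update_of_ne hyv, hy] at h3
    rw [hdv] at h1
    rw [hv] at h4
    simp only [Option.some.injEq, eq_comm (a := Z), eq_comm (a := W), eq_comm (a := Y),
      reduceCtorEq, if_false] at h1 h3 h4
    rw [replace] at h2
    omega
  · rw [hWd l (fun hh => hl (hh ▸ hZB)), hout l hl, replace_class hv hy hlW, and_iff_left_iff_imp]
    rintro hu rfl
    rw [hu] at hy
    cases hy
    exact hl hYB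
  · rw [hWd W hZW.symm, hout W hWB, replace_class_self hyv]

/-- The class `W` stays accessible without using `v`. -/
def Swappable (G : SimpleGraph V) (c : V → Option (Fin r)) (o W : Fin r) (v : V) : Prop :=
  c v = some W ∧ Term G c o W ∧
    (W = o ∨ ∃ w ≠ v, c w = some W ∧ ∃ U ∈ acc G c o, U ≠ W ∧ Free G c w U)

theorem Ctx.no_swap (h : Ctx G r s x c o) {W Y Z : Fin r} {v y y' : V}
    (hv : Swappable G c o W v) (hyQ : y ∈ Q G c o W v) (hyQ' : y' ∈ Q G c o W v) (hne : y' ≠ y)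
    (hadj : ¬ G.Adj y y') (hy : c y = some Y) (hZB : Z ∈ bcc G c o)
    (hvZ : Free G (replace c v y W) v Z) :
    ¬ ReflTransGen (RelOn (arc G (replace c v y W)) (bcc G c o)) Z Y := by
  intro hp
  obtain ⟨hcv, ⟨hW, hterm⟩, hWo⟩ := hv
  obtain ⟨⟨Y₁, hYB, hy₁⟩, hvy, hy1⟩ := mem_Q.1 hyQ
  obtain ⟨⟨Y₂, hYB₂, hy₂⟩, hvy₂, hy2⟩ := mem_Q.1 hyQ'
  obtain rfl : Y = Y₁ := by rw [hy] at hy₁; exact Option.some.inj hy₁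
  have hWB : W ∉ bcc G c o := fun hh => mem_bcc.1 hh hW
  obtain ⟨d, hd, hout, hdW, -⟩ := h.ae.exists_swap hcv hWB hy hYB hvy hy1 hZB hvZ hp
  have hA : ∀ l ∈ acc G c o, l ≠ W → ∀ u, d u = some l ↔ c u = some l := fun l hl hlW =>
    hout l (fun hh => mem_bcc.1 hh hl) hlW
  obtain ⟨k, hk⟩ : ∃ k, d y' = some k := by
    refine Option.ne_none_iff_exists'.1 fun hh => h.color_ne hy₂ ((hd.none_iff _).1 hh)
  have hkB : k ∈ bcc G c o := by
    by_contra hkB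
    have hkA : k ∈ acc G c o := by simpa using hkB
    by_cases hkW : k = W
    · subst hkW
      rcases (hdW y').1 hk with hh | hh
      · exact hne hh
      · rw [hy₂] at hh
        exact ne_of_bcc hYB₂ hkA (Option.some.inj hh.2)
    · have := (hA k hkA hkW y').1 hk
      rw [hy₂] at this
      exact ne_of_bcc hYB₂ hkA (Option.some.inj this)
  have hkW : arc G d k W := by
    refine ⟨ne_of_bcc hkB hW, y', hk, fun u hu hyu => ?_⟩
    rcases (hdW u).1 hu with rfl | ⟨huv, hu⟩
    · exact hadj hyu.symm
    · exact huv (solo_unique hcv hvy₂ hy2 hu hyu)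
  have herase : ∀ j ∈ acc G c o, j ≠ W → j ∈ acc G d o := by
    intro j hj hjW
    refine mem_acc.2 (RelOn.reach_forget (RelOn.reach_imp (fun i hi j hj hij => ?_)
      (hterm j hj hjW)))
    rw [Finset.mem_erase] at hi hj
    exact arc_mono (fun u hu => (hA i hi.2 hi.1 u).2 hu) (fun u hu => (hA j hj.2 hj.1 u).1 hu) hij
  have hWd : W ∈ acc G d o := by
    rcases hWo with rfl | ⟨w, hwv, hw, U, hU, hUW, hwU⟩
    · exact self_mem_acc
    · refine mem_acc_of_arc ⟨hUW.symm, w, (hdW w).2 (Or.inr ⟨hwv, hw⟩), hwU.mono ?_⟩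
        (herase U hU hUW)
      exact fun u hu => (hA U hU hUW u).1 hu
  have hsub : insert k (acc G c o) ⊆ acc G d o := by
    intro j hj
    rcases Finset.mem_insert.1 hj with rfl | hj
    · exact mem_acc_of_arc hkW hWd
    · by_cases hjW : j = W
      · exact hjW ▸ hWd
      · exact herase j hj hjW
  have h1 := Finset.card_le_card hsub
  rw [Finset.card_insert_of_notMem (mem_bcc.1 hkB)] at h1
  have := h.max d o hd
  omega

theorem reach_replace {W Y Z Z' : Fin r} {v y : V} (hv : c v = some W) (hW : W ∈ acc G c o)
    (hy : c y = some Y) (hZ : Z ∈ bcc G c o)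
    (hp : ReflTransGen (fun a b => arc G c a b ∧ a ≠ Y) Z Z') :
    ReflTransGen (RelOn (arc G (replace c v y W)) (bcc G c o)) Z Z' := by
  have h1 := (RelOn.of_closed (K := bcc G c o)
    (fun i hi j (h : arc G c i j ∧ i ≠ Y) => mem_bcc_of_arc hi h.1) hZ hp).1
  refine RelOn.reach_imp (fun i hi j hj hij => ?_) h1
  refine arc_mono (fun u hu => (replace_class hv hy (ne_of_bcc hi hW) u).2 ⟨hu, ?_⟩)
    (fun u hu => ((replace_class hv hy (ne_of_bcc hj hW) u).1 hu).1) hij.1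
  rintro rfl
  rw [hu] at hy
  exact hij.2 (Option.some.inj hy)

theorem Ctx.not_reach (h : Ctx G r s x c o) {W Y Z : Fin r} {v y : V}
    (hv : Swappable G c o W v) (hyQ : y ∈ Q' G c o W v) (hy : c y = some Y)
    (hZB : Z ∈ bcc G c o) (hvZ : dg G v (cls c Z) = 0) : ¬ ReflTransGen (arc G c) Z Y := by
  intro hp
  obtain ⟨hyQ, y', hyQ', hne, hadj⟩ := mem_Q'.1 hyQ
  refine h.no_swap hv hyQ hyQ' hne hadj hy hZB ?_
    (reach_replace hv.1 hv.2.1.1 hy hZB (reach_source_ne hp))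
  exact (dg_cls_eq_zero.1 hvZ).mono fun u hu =>
    ((replace_class hv.1 hy (ne_of_bcc hZB hv.2.1.1) u).1 hu).1

theorem free_replace {W Y : Fin r} {v y z : V} (hv : c v = some W) (hYW : Y ≠ W)
    (hy : c y = some Y) (hzy : G.Adj z y) (h1 : dg G z (cls c Y) ≤ 1) :
    Free G (replace c v y W) z Y := by
  intro u hu hzu
  obtain ⟨hu, huy⟩ := (replace_class hv hy hYW u).1 hu
  have h2 := dg_pos (G := G) (mem_cls.2 hy) hzy
  exact huy ((dg_eq_one_iff (mem_cls.2 hy) hzy).1 (by omega) u (mem_cls.2 hu) hzu)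

theorem Ctx.two_le_dg (h : Ctx G r s x c o) {W Y : Fin r} {v y : V}
    (hv : Swappable G c o W v) (hyQ : y ∈ Q' G c o W v) (hy : c y = some Y) :
    2 ≤ dg G v (cls c Y) := by
  by_contra! hlt
  obtain ⟨hyQ, y', hyQ', hne, hadj⟩ := mem_Q'.1 hyQ
  obtain ⟨⟨Y₁, hYB, hy₁⟩, hvy, hy1⟩ := mem_Q.1 hyQ
  obtain rfl : Y = Y₁ := by rw [hy] at hy₁; exact Option.some.inj hy₁
  exact h.no_swap hv hyQ hyQ' hne hadj hy hYB
    (free_replace hv.1 (ne_of_bcc hYB hv.2.1.1) hy hvy (by omega)) .refl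

theorem Ctx.two_le_dg_of_reach (h : Ctx G r s x c o) {W Y Z Z' : Fin r} {v y z : V}
    (hv : Swappable G c o W v) (hyQ : y ∈ Q' G c o W v) (hy : c y = some Y)
    (hZB : Z ∈ bcc G c o) (hvZ : dg G v (cls c Z) = 0) (hZZ' : ReflTransGen (arc G c) Z Z')
    (hz : c z = some Z') (hZ'Y : Z' ≠ Y) (hzy : G.Adj z y) : 2 ≤ dg G z (cls c Y) := by
  by_contra! hlt
  have hnot := h.not_reach hv hyQ hy hZB hvZ
  obtain ⟨hyQ, y', hyQ', hne, hadj⟩ := mem_Q'.1 hyQ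
  obtain ⟨⟨Y₁, hYB, hy₁⟩, hvy, hy1⟩ := mem_Q.1 hyQ
  obtain rfl : Y = Y₁ := by rw [hy] at hy₁; exact Option.some.inj hy₁
  have hW := hv.2.1.1
  have hYW := ne_of_bcc hYB hW
  have hZ'B := (reach_bcc hZB hZZ').2
  have hp : ReflTransGen (fun a b => arc G c a b ∧ a ≠ Y) Z Z' := by
    clear hz hZ'B hZ'Y
    induction hZZ' with
    | refl => exact .refl
    | @tail b b' hb hbb' ih => exact ih.tail ⟨hbb', fun hh => hnot (hh ▸ hb)⟩
  refine h.no_swap hv hyQ hyQ' hne hadj hy hZB ?_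
    ((reach_replace hv.1 hW hy hZB hp).tail ⟨⟨hZ'Y, z, ?_, free_replace hv.1 hYW hy hzy (by omega)⟩,
      hZ'B, hYB⟩)
  · exact (dg_cls_eq_zero.1 hvZ).mono fun u hu =>
      ((replace_class hv.1 hy (ne_of_bcc hZB hW) u).1 hu).1
  · refine (replace_class hv.1 hy (ne_of_bcc hZ'B hW) z).2 ⟨hz, ?_⟩
    exact hzy.ne

end Extremal

section Cuts
open Relation
variable [Fintype V] {G : SimpleGraph V} {r s : ℕ} {x : V} {c : V → Option (Fin r)} {o : Fin r}
  {C D S T : Finset (Fin r)}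

/-- The number of edges between two unions of classes. -/
noncomputable def eC (G : SimpleGraph V) (c : V → Option (Fin r)) (C D : Finset (Fin r)) : ℕ :=
  ∑ u ∈ un c C, dg G u (un c D)

theorem eC_comm : eC G c C D = eC G c D C := sum_dg_comm _ _

theorem eC_eq_sum : eC G c C D = ∑ j ∈ D, ∑ u ∈ un c C, dg G u (cls c j) := by
  rw [eC, Finset.sum_comm]
  exact Finset.sum_congr rfl fun u _ => dg_un

theorem eC_union_right {E : Finset (Fin r)} (h : Disjoint D E) :
    eC G c C (D ∪ E) = eC G c C D + eC G c C E := by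
  rw [eC_eq_sum, eC_eq_sum, eC_eq_sum, Finset.sum_union h]

theorem eC_union_left {E : Finset (Fin r)} (h : Disjoint D E) :
    eC G c (D ∪ E) C = eC G c D C + eC G c E C := by
  rw [eC_comm, eC_union_right h, eC_comm (D := D), eC_comm (D := E)]

theorem Ctx.card_cls_bcc (h : Ctx G r s x c o) {j : Fin r} (hj : j ∈ bcc G c o) :
    (cls c j).card = s := by
  have := h.ae.card j
  rwa [if_neg (ne_of_bcc hj self_mem_acc)] at this

theorem Ctx.s_pos (h : Ctx G r s x c o) : 1 ≤ s := by
  have := h.ae.card o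
  rw [if_pos rfl] at this
  omega

theorem Ctx.card_un_add (h : Ctx G r s x c o) (C : Finset (Fin r)) :
    (un c C).card + (if o ∈ C then 1 else 0) = C.card * s := by
  have h1 : ∑ j ∈ C, ((cls c j).card + if j = o then 1 else 0) = C.card * s := by
    rw [Finset.sum_congr rfl fun j _ => h.ae.card j, Finset.sum_const, smul_eq_mul]
  rw [Finset.sum_add_distrib, ← card_un, Finset.sum_ite_eq'] at h1
  exact h1

theorem Ctx.card_un_bcc (h : Ctx G r s x c o) (hC : C ⊆ bcc G c o) :
    (un c C).card = C.card * s := by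
  have := h.card_un_add C
  rwa [if_neg fun hh => mem_bcc.1 (hC hh) self_mem_acc, add_zero] at this

theorem Ctx.eC_le (h : Ctx G r s x c o) (hCD : Disjoint C D) (h4 : 4 ≤ C.card + D.card) :
    eC G c C D + 4 + (if o ∈ C ∪ D then 2 else 0) ≤ 2 * ((C.card + D.card) * s) := by
  have h1 := h.card_un_add C
  have h2 := h.card_un_add D
  have hs := h.s_pos
  have h3 : C.card + D.card ≤ (C.card + D.card) * s := Nat.le_mul_of_pos_right _ hs
  have h5 : ¬ (o ∈ C ∧ o ∈ D) := fun hh => Finset.disjoint_left.1 hCD hh.1 hh.2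
  rw [add_mul] at h3
  have h6 : 3 ≤ (un c C).card + (un c D).card := by
    by_cases ha : o ∈ C <;> by_cases hb : o ∈ D <;>
      simp only [ha, hb, if_true, if_false, and_self, not_true_eq_false] at h1 h2 h5 <;> omega
  have h7 := h.bounds.cross _ _ (un_disjoint hCD) h6
  rw [eC, add_mul]
  by_cases ha : o ∈ C <;> by_cases hb : o ∈ D <;>
    simp only [ha, hb, if_true, if_false, and_self, not_true_eq_false, Finset.mem_union, or_true,
      true_or, or_self] at h1 h2 h5 ⊢ <;> omega

theorem eC_ge (hs : ∀ i ∈ C, ∀ j ∈ D, s ≤ ∑ u ∈ cls c i, dg G u (cls c j)) :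
    C.card * D.card * s ≤ eC G c C D := by
  have : ∀ i ∈ C, D.card * s ≤ ∑ u ∈ cls c i, dg G u (un c D) := by
    intro i hi
    rw [Finset.sum_congr rfl fun u _ => dg_un, Finset.sum_comm, ← smul_eq_mul]
    exact Finset.card_nsmul_le_sum _ _ _ (hs i hi)
  rw [eC, sum_un, mul_assoc, ← smul_eq_mul]
  exact Finset.card_nsmul_le_sum _ _ _ this

theorem Ctx.le_sum_dg (h : Ctx G r s x c o) {i j : Fin r} (hi : i ∈ bcc G c o)
    (hij : ∀ u, c u = some i → 1 ≤ dg G u (cls c j)) : s ≤ ∑ u ∈ cls c i, dg G u (cls c j) := by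
  have := Finset.card_nsmul_le_sum (cls c i) (fun u => dg G u (cls c j)) 1
    fun u hu => hij u (mem_cls.1 hu)
  rwa [h.card_cls_bcc hi, smul_eq_mul, mul_one] at this

theorem Ctx.eC_ge_of_acc (h : Ctx G r s x c o) (hC : C ⊆ bcc G c o) (hD : D ⊆ acc G c o) :
    C.card * D.card * s ≤ eC G c C D :=
  eC_ge fun _ hi _ hj => h.le_sum_dg (hC hi) fun _ hu => dg_acc_pos hu (hC hi) (hD hj)

/-- A set of inaccessible classes is closed if no class in it can exchange vertices in both
directions with an inaccessible class outside. -/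
def Closed (G : SimpleGraph V) (c : V → Option (Fin r)) (o : Fin r) (C : Finset (Fin r)) : Prop :=
  C ⊆ bcc G c o ∧ ∀ i ∈ C, ∀ j ∈ bcc G c o, j ∉ C → ¬ (arc G c i j ∧ arc G c j i)

theorem Closed.bcc : Closed G c o (bcc G c o) := ⟨subset_rfl, fun _ _ _ hj hj' => absurd hj hj'⟩

theorem Closed.sdiff (hC : Closed G c o C) (hD : Closed G c o D) : Closed G c o (C \ D) := by
  refine ⟨Finset.sdiff_subset.trans hC.1, fun i hi j hj hj' hij => ?_⟩
  rw [Finset.mem_sdiff] at hi hj'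
  by_cases hjC : j ∈ C
  · have hjD : j ∈ D := by by_contra hh; exact hj' ⟨hjC, hh⟩
    exact hD.2 j hjD i (hC.1 hi.1) hi.2 hij.symm
  · exact hC.2 i hi.1 j hj hjC hij

/-- A minimal nonempty closed set. -/
structure IsAtomic (G : SimpleGraph V) (c : V → Option (Fin r)) (o : Fin r)
    (S : Finset (Fin r)) : Prop where
  closed : Closed G c o S
  ne : S.Nonempty
  min : ∀ C ⊆ S, Closed G c o C → C.Nonempty → C = S

theorem IsAtomic.reach (hS : IsAtomic G c o S) {i j : Fin r} (hi : i ∈ S) (hj : j ∈ S) :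
    ReflTransGen (arc G c) i j := by
  let R : Fin r → Fin r → Prop := fun i j => arc G c i j ∧ arc G c j i
  let C := (bcc G c o).filter fun j => ReflTransGen (RelOn R (bcc G c o)) i j
  have hiC : i ∈ C := Finset.mem_filter.2 ⟨hS.closed.1 hi, .refl⟩
  have hCS : C ⊆ S := by
    intro k hk
    obtain ⟨-, hk'⟩ := Finset.mem_filter.1 hk
    clear hj hiC hk
    induction hk' with
    | refl => exact hi
    | tail _ hab ih =>
      by_contra hk
      exact hS.closed.2 _ ih _ hab.2.2 hk hab.1
  have hC : Closed G c o C := by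
    refine ⟨Finset.filter_subset _ _, fun a ha b hb hb' hab => hb' ?_⟩
    obtain ⟨haB, ha⟩ := Finset.mem_filter.1 ha
    exact Finset.mem_filter.2 ⟨hb, ha.tail ⟨hab, haB, hb⟩⟩
  have := hS.min C hCS hC ⟨i, hiC⟩
  rw [← this] at hj
  exact ReflTransGen.mono (fun _ _ h => h.1.1) _ _ (Finset.mem_filter.1 hj).2

theorem Ctx.eC_closed (h : Ctx G r s x c o) (hC : Closed G c o C) (hD : D ⊆ bcc G c o)
    (hCD : Disjoint C D) : C.card * D.card * s ≤ eC G c C D := by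
  refine eC_ge fun i hi j hj => ?_
  have hij : i ≠ j := fun hh => Finset.disjoint_left.1 hCD hi (hh ▸ hj)
  by_cases h1 : arc G c i j
  · have h2 : ¬ arc G c j i := fun h2 =>
      hC.2 i hi j (hD hj) (fun hh => Finset.disjoint_left.1 hCD hh hj) ⟨h1, h2⟩
    rw [sum_dg_comm]
    exact h.le_sum_dg (hD hj) fun u hu => dg_pos_of_not_arc hu hij.symm h2
  · exact h.le_sum_dg (hC.1 hi) fun u hu => dg_pos_of_not_arc hu hij h1

theorem Ctx.closed_cut (h : Ctx G r s x c o) (hC : Closed G c o C) {m : ℕ}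
    (hm : C.card + m = r) : C.card * m * s + 6 ≤ 2 * (r * s) := by
  have h1 := h.eC_closed hC (D := bcc G c o \ C) Finset.sdiff_subset Finset.disjoint_sdiff
  have h2 := h.eC_ge_of_acc hC.1 (D := acc G c o) subset_rfl
  have hd1 : Disjoint (bcc G c o \ C) (acc G c o) :=
    acc_disjoint_bcc.symm.mono_left Finset.sdiff_subset
  have hd2 : Disjoint C (bcc G c o \ C ∪ acc G c o) :=
    Finset.disjoint_union_right.2 ⟨Finset.disjoint_sdiff, acc_disjoint_bcc.symm.mono_left hC.1⟩
  have hcard : (bcc G c o \ C).card + (acc G c o).card = m := by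
    have := card_acc_add_card_bcc (G := G) (c := c) (o := o)
    have := Finset.card_sdiff_add_card_eq_card hC.1
    omega
  have h3 := h.eC_le hd2 (by
    rw [Finset.card_union_of_disjoint hd1, hcard, hm]; have := h.hr; omega)
  rw [if_pos (Finset.mem_union_right _ (Finset.mem_union_right _ self_mem_acc)),
    Finset.card_union_of_disjoint hd1, hcard, hm, eC_union_right hd1] at h3
  have h4 : C.card * m * s = C.card * (bcc G c o \ C).card * s +
      C.card * (acc G c o).card * s := by rw [← hcard]; ring
  omega

theorem Ctx.closed_card (h : Ctx G r s x c o) (hC : Closed G c o C) {m : ℕ}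
    (hm : C.card + m = r) : C.card * m < 2 * r := by
  have h1 := h.closed_cut hC hm
  by_contra! hh
  have := Nat.mul_le_mul_right s hh
  rw [mul_assoc] at this
  omega

theorem Ctx.closed_card_cases (h : Ctx G r s x c o) (hC : Closed G c o C) :
    C.card ≤ 2 ∨ r ≤ C.card + 2 ∨ r = 8 ∧ (C.card = 3 ∨ C.card = 5) := by
  have hle : C.card ≤ r := by simpa using Finset.card_le_univ C
  obtain ⟨m, hm⟩ := Nat.exists_eq_add_of_le hle
  have h1 := h.closed_card hC hm.symm
  have hr := h.hr
  by_contra! hcon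
  obtain ⟨h3, h4, h5⟩ := hcon
  have h6 : 3 ≤ m := by omega
  by_cases h8 : r = 8
  · have := h5 h8
    have h7 : C.card = 4 := by omega
    have h9 : m = 4 := by omega
    rw [h7, h9] at h1
    omega
  · have h9 : 9 ≤ C.card + m := by omega
    have h1 : C.card * m < 2 * (C.card + m) := hm ▸ h1
    obtain ⟨p, hp⟩ := Nat.exists_eq_add_of_le (show 3 ≤ C.card by omega)
    obtain ⟨q, rfl⟩ := Nat.exists_eq_add_of_le h6
    rw [hp] at h1 h9
    nlinarith

/-- A closed set with at least three classes such that smaller closed sets have at most two. -/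
theorem exists_minimal_closed (hb : 3 ≤ (bcc G c o).card) :
    ∃ C, Closed G c o C ∧ 3 ≤ C.card ∧
      ∀ D ⊆ C, Closed G c o D → D ≠ C → D.card ≤ 2 := by
  obtain ⟨C, hC⟩ := Finset.exists_minimal
    (s := (Finset.univ : Finset (Finset (Fin r))).filter fun C => Closed G c o C ∧ 3 ≤ C.card)
    ⟨bcc G c o, by simp [Closed.bcc, hb]⟩
  have h1 := hC.prop
  simp only [Finset.mem_filter, Finset.mem_univ, true_and] at h1
  refine ⟨C, h1.1, h1.2, fun D hD hDc hne => ?_⟩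
  by_contra! hlt
  have := hC.le_of_le (y := D) (by simp; exact ⟨hDc, hlt⟩) hD
  exact hne (subset_antisymm hD this)

theorem Closed.isAtomic (hC : Closed G c o C) (hne : C.Nonempty)
    (h : ∀ D, Closed G c o D → D.Nonempty → (C \ D).Nonempty → D.card + (C \ D).card = C.card →
      False) : IsAtomic G c o C := by
  refine ⟨hC, hne, fun D hD hDc hDne => ?_⟩
  by_contra hcon
  have h1 := Finset.card_sdiff_add_card_eq_card hD
  refine h D hDc hDne ?_ (by omega)
  rw [Finset.sdiff_nonempty]
  exact fun hh => hcon (subset_antisymm hD hh)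

end Cuts

section Counting
open Relation
variable [Fintype V] {G : SimpleGraph V} {r s : ℕ} {x : V} {c : V → Option (Fin r)} {o : Fin r}
  {C D S T : Finset (Fin r)} {W : Fin r} {v : V}

theorem card_Q_inter (X : Finset V) : (Q G c o W v ∩ X).card =
    dg G v (((un c (bcc G c o)).filter fun y => dg G y (cls c W) = 1) ∩ X) := by
  rw [dg, Q]
  congr 1
  ext y
  simp only [Finset.mem_inter, Finset.mem_filter]
  tauto

theorem sum_card_Q_inter (X : Finset V) : ∑ v ∈ cls c W, (Q G c o W v ∩ X).card =
    (((un c (bcc G c o)).filter fun y => dg G y (cls c W) = 1) ∩ X).card := by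
  rw [Finset.sum_congr rfl fun v _ => card_Q_inter X, sum_dg_comm, Finset.card_eq_sum_ones]
  refine Finset.sum_congr rfl fun y hy => ?_
  exact (Finset.mem_filter.1 (Finset.mem_inter.1 hy).1).2

theorem sum_card_Q_inter_le {P : Finset V} (hP : P ⊆ cls c W) (X : Finset V) :
    ∑ v ∈ P, (Q G c o W v ∩ X).card ≤ X.card :=
  (Finset.sum_le_sum_of_subset hP).trans
    ((sum_card_Q_inter X).trans_le (Finset.card_le_card Finset.inter_subset_right))

/-- Every vertex of an inaccessible class is a solo neighbor or has two neighbors in `W`. -/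
theorem Ctx.solo_count (h : Ctx G r s x c o) (hW : W ∈ acc G c o) (hC : C ⊆ bcc G c o) :
    2 * (C.card * s) ≤
      ∑ v ∈ cls c W, ((Q G c o W v ∩ un c C).card + dg G v (un c C)) := by
  rw [Finset.sum_add_distrib, sum_card_Q_inter, sum_dg_comm, ← h.card_un_bcc hC]
  have h1 : ((un c (bcc G c o)).filter fun y => dg G y (cls c W) = 1) ∩ un c C =
      (un c C).filter fun y => dg G y (cls c W) = 1 := by
    rw [Finset.filter_inter, Finset.inter_eq_right.2 (un_mono hC)]
  rw [h1, Finset.card_filter, ← Finset.sum_add_distrib, mul_comm, ← smul_eq_mul]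
  refine Finset.card_nsmul_le_sum _ _ _ fun y hy => ?_
  obtain ⟨Y, hY, hyY⟩ := mem_un.1 hy
  have := dg_acc_pos hyY (hC hY) hW
  split_ifs <;> omega

theorem Q_subset_un : Q G c o W v ⊆ un c (bcc G c o) := Finset.filter_subset _ _

theorem Q_subset_nbr (X : Finset V) : (Q G c o W v ∩ X).card ≤ dg G v X := by
  refine Finset.card_le_card fun y hy => ?_
  rw [Finset.mem_inter, mem_Q] at hy
  exact Finset.mem_filter.2 ⟨hy.2, hy.1.2.1⟩

theorem card_Q_le : (Q G c o W v).card ≤ dg G v (un c (bcc G c o)) := by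
  have := Q_subset_nbr (G := G) (c := c) (o := o) (W := W) (v := v) (un c (bcc G c o))
  rwa [Finset.inter_eq_left.2 Q_subset_un] at this

theorem Ctx.card_Q_le_Q' (h : Ctx G r s x c o) :
    (Q G c o W v).card ≤ 4 ∨ (Q G c o W v).card ≤ (Q' G c o W v).card + 1 := by
  by_contra! hcon
  obtain ⟨h5, h2⟩ := hcon
  have h3 := Finset.card_sdiff_add_card_eq_card (Q'_subset (G := G) (c := c) (o := o) (W := W)
    (v := v))
  obtain ⟨p, hp, q, hq, hpq⟩ := Finset.one_lt_card.1
    (show 1 < (Q G c o W v \ Q' G c o W v).card by omega)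
  have hadj : ∀ p ∈ Q G c o W v \ Q' G c o W v, ∀ y ∈ Q G c o W v, y ≠ p → G.Adj p y := by
    intro p hp y hy hyp
    rw [Finset.mem_sdiff, mem_Q'] at hp
    by_contra hh
    exact hp.2 ⟨hp.1, y, hy, hyp, hh⟩
  have hp' := (Finset.mem_sdiff.1 hp).1
  have hq' := (Finset.mem_sdiff.1 hq).1
  have hvp := (mem_Q.1 hp').2.1
  have hvq := (mem_Q.1 hq').2.1
  refine h.bounds.not_complete_bipartite (X := {p, q, v}) (Y := Q G c o W v \ {p, q}) ?_ ?_ ?_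
  · rw [Finset.card_eq_three.2 ⟨p, q, v, hpq, hvp.ne', hvq.ne', rfl⟩]
  · have := Finset.le_card_sdiff {p, q} (Q G c o W v)
    rw [Finset.card_pair hpq] at this
    omega
  · intro u hu w hw
    simp only [Finset.mem_insert, Finset.mem_singleton, Finset.mem_sdiff, not_or] at hu hw
    rcases hu with rfl | rfl | rfl
    · exact hadj _ hp _ hw.1 hw.2.1
    · exact hadj _ hq _ hw.1 hw.2.2
    · exact (mem_Q.1 hw.1).2.1

theorem Ctx.card_Q_le_three (h : Ctx G r s x c o) (h0 : Q' G c o W v = ∅) :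
    (Q G c o W v).card ≤ 3 := by
  have hv : v ∉ Q G c o W v := fun hh => (mem_Q.1 hh).2.1.ne rfl
  have h1 : (insert v (Q G c o W v)).card ≤ 4 := by
    refine h.bounds.clique_card_le fun u hu w hw huw => ?_
    rw [Finset.mem_insert] at hu hw
    rcases hu with rfl | hu <;> rcases hw with rfl | hw
    · exact absurd rfl huw
    · exact (mem_Q.1 hw).2.1
    · exact (mem_Q.1 hu).2.1.symm
    · by_contra hh
      have : u ∈ Q' G c o W v := mem_Q'.2 ⟨hu, w, hw, huw.symm, hh⟩
      rw [h0] at this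
      simp at this
  rw [Finset.card_insert_of_notMem hv] at h1
  omega

theorem Ctx.dg_pos_of_reach (h : Ctx G r s x c o) {Y Z : Fin r} {y : V}
    (hv : Swappable G c o W v) (hyQ : y ∈ Q' G c o W v) (hy : c y = some Y)
    (hZB : Z ∈ bcc G c o) (hp : ReflTransGen (arc G c) Z Y) : 1 ≤ dg G v (cls c Z) := by
  by_contra! hh
  exact h.not_reach hv hyQ hy hZB (by omega) hp

theorem inter_un_card (X : Finset V) : (X ∩ un c C).card = ∑ j ∈ C, (X ∩ cls c j).card := by
  rw [un_eq_biUnion, Finset.inter_biUnion, Finset.card_biUnion]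
  exact fun i _ j _ hij => (cls_disjoint hij).mono Finset.inter_subset_right
    Finset.inter_subset_right

theorem Q'_inter_le (X : Finset V) : (Q' G c o W v ∩ X).card ≤ dg G v X :=
  (Finset.card_le_card (Finset.inter_subset_inter_right Q'_subset)).trans (Q_subset_nbr X)

theorem Ctx.card_Q'_inter_cls (h : Ctx G r s x c o) {j : Fin r} (hv : Swappable G c o W v) :
    (Q' G c o W v ∩ cls c j).card = 0 ∨ 2 ≤ dg G v (cls c j) := by
  rcases Finset.eq_empty_or_nonempty (Q' G c o W v ∩ cls c j) with h0 | ⟨y, hy⟩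
  · exact Or.inl (by rw [h0]; rfl)
  · rw [Finset.mem_inter, mem_cls] at hy
    exact Or.inr (h.two_le_dg hv hy.1 hy.2)

theorem Ctx.hits_of_Q' (h : Ctx G r s x c o) (hS : IsAtomic G c o S) (hv : Swappable G c o W v)
    (hne : (Q' G c o W v ∩ un c S).Nonempty) {j : Fin r} (hj : j ∈ bcc G c o)
    (hjS : ∃ i ∈ S, ReflTransGen (arc G c) j i) : 1 ≤ dg G v (cls c j) := by
  obtain ⟨y, hy⟩ := hne
  rw [Finset.mem_inter, mem_un] at hy
  obtain ⟨hyQ, Y, hY, hyY⟩ := hy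
  obtain ⟨i, hi, hp⟩ := hjS
  exact h.dg_pos_of_reach hv hyQ hyY hj (hp.trans (hS.reach hi hY))

/-- The number of solo neighbors in an atomic set that are not adjacent to all others. -/
theorem Ctx.card_Q'_inter_atomic (h : Ctx G r s x c o) (hS : IsAtomic G c o S)
    (hv : Swappable G c o W v) : (Q' G c o W v ∩ un c S).card = 0 ∨
      (Q' G c o W v ∩ un c S).card + 2 * S.card ≤ 2 * dg G v (un c S) := by
  rcases Finset.eq_empty_or_nonempty (Q' G c o W v ∩ un c S) with h0 | hne
  · exact Or.inl (by rw [h0]; rfl)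
  right
  rw [inter_un_card, dg_un, Finset.mul_sum, Finset.card_eq_sum_ones, Finset.mul_sum,
    ← Finset.sum_add_distrib]
  refine Finset.sum_le_sum fun j hj => ?_
  have h1 := h.hits_of_Q' hS hv hne (hS.closed.1 hj) ⟨j, hj, .refl⟩
  have h2 := Q'_inter_le (G := G) (c := c) (o := o) (W := W) (v := v) (cls c j)
  rcases h.card_Q'_inter_cls (j := j) hv with h3 | h3 <;> omega

/-- Counting edges into a set of vertices whose neighbors always come in pairs. -/
theorem doubling {X : Finset V} (hX : X ⊆ un c S)
    (hpos : ∀ z ∈ un c T, ∀ j ∈ S, 1 ≤ dg G z (cls c j))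
    (htwo : ∀ y ∈ X, ∀ j, c y = some j → ∀ z ∈ un c T, G.Adj z y → 2 ≤ dg G z (cls c j)) :
    ∑ y ∈ X, dg G y (un c T) + 2 * ((un c T).card * S.card) ≤ 2 * eC G c S T := by
  rw [sum_dg_comm, eC_comm, eC, Finset.mul_sum, Finset.card_eq_sum_ones, Finset.sum_mul,
    Finset.mul_sum, ← Finset.sum_add_distrib]
  refine Finset.sum_le_sum fun z hz => ?_
  have h1 : dg G z X = ∑ j ∈ S, dg G z (X ∩ cls c j) := by
    rw [dg, ← Finset.inter_eq_left.2 (show X.filter (G.Adj z) ⊆ un c S from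
      (Finset.filter_subset _ _).trans hX), inter_un_card]
    refine Finset.sum_congr rfl fun j _ => ?_
    rw [dg, Finset.filter_inter]
  rw [h1, dg_un, one_mul, Finset.card_eq_sum_ones, Finset.mul_sum, Finset.mul_sum,
    ← Finset.sum_add_distrib]
  refine Finset.sum_le_sum fun j hj => ?_
  have h2 := hpos z hz j hj
  have h3 : dg G z (X ∩ cls c j) ≤ dg G z (cls c j) := dg_mono Finset.inter_subset_right
  by_cases h0 : dg G z (X ∩ cls c j) = 0
  · omega
  · obtain ⟨y, hy, hzy⟩ := exists_of_dg_pos (Nat.pos_of_ne_zero h0)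
    rw [Finset.mem_inter, mem_cls] at hy
    have := htwo y hy.1 j hy.2 z hz hzy
    omega

/-- The solo neighbors in `S` of vertices of `W` that miss a class of `T`. -/
noncomputable def star (G : SimpleGraph V) (c : V → Option (Fin r)) (o W : Fin r)
    (S T : Finset (Fin r)) : Finset V :=
  (un c S).filter fun y => ∃ v, Swappable G c o W v ∧ y ∈ Q' G c o W v ∧
    ∃ Z ∈ T, dg G v (cls c Z) = 0

theorem Ctx.star_doubling (h : Ctx G r s x c o) (hS : IsAtomic G c o S) (hT : T ⊆ bcc G c o)
    (hST : Disjoint S T) (hTr : ∀ i ∈ T, ∀ j ∈ T, ReflTransGen (arc G c) i j) :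
    ∑ y ∈ star G c o W S T, dg G y (un c T) + 2 * (S.card * T.card * s) ≤ 2 * eC G c S T := by
  have hcard : (un c T).card * S.card = S.card * T.card * s := by
    rw [h.card_un_bcc hT]; ring
  rw [← hcard]
  rcases Finset.eq_empty_or_nonempty (star G c o W S T) with h0 | ⟨y₀, hy₀⟩
  · have := h.eC_closed hS.closed hT hST
    rw [h0, Finset.sum_empty, hcard]
    omega
  obtain ⟨hyS₀, v₀, hv₀, hyQ₀, Z₀, hZ₀, hvZ₀⟩ := Finset.mem_filter.1 hy₀
  obtain ⟨Y₀, hY₀, hyY₀⟩ := mem_un.1 hyS₀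
  have hnr : ∀ Z ∈ T, ∀ Y ∈ S, ¬ ReflTransGen (arc G c) Z Y := fun Z hZ Y hY hp =>
    h.not_reach hv₀ hyQ₀ hyY₀ (hT hZ₀) hvZ₀ ((hTr Z₀ hZ₀ Z hZ).trans (hp.trans (hS.reach hY hY₀)))
  have hne : ∀ Z ∈ T, ∀ Y ∈ S, Z ≠ Y := fun Z hZ Y hY hh =>
    Finset.disjoint_left.1 hST hY (hh ▸ hZ)
  refine doubling (Finset.filter_subset _ _) (fun z hz j hj => ?_) (fun y hy j hyj z hz hzy => ?_)
  · obtain ⟨Z, hZ, hzZ⟩ := mem_un.1 hz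
    exact dg_pos_of_not_arc hzZ (hne Z hZ j hj) fun hh => hnr Z hZ j hj (.single hh)
  · obtain ⟨Z, hZ, hzZ⟩ := mem_un.1 hz
    obtain ⟨hyS, v, hv, hyQ, Z₁, hZ₁, hvZ₁⟩ := Finset.mem_filter.1 hy
    obtain ⟨Y, hY, hyY⟩ := mem_un.1 hyS
    obtain rfl : j = Y := by rw [hyj] at hyY; exact Option.some.inj hyY
    exact h.two_le_dg_of_reach hv hyQ hyj (hT hZ₁) hvZ₁ (hTr _ hZ₁ _ hZ) hzZ (hne Z hZ j hY) hzy

theorem Ctx.star_card (h : Ctx G r s x c o) (hS : IsAtomic G c o S) (hT : T ⊆ bcc G c o)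
    (hST : Disjoint S T) (hTr : ∀ i ∈ T, ∀ j ∈ T, ReflTransGen (arc G c) i j)
    (hno : ∀ i ∈ S, ∀ j ∈ T, ¬ ReflTransGen (arc G c) i j) :
    T.card * (star G c o W S T).card + 2 * (S.card * T.card * s) ≤ 2 * eC G c S T := by
  refine le_trans (Nat.add_le_add_right ?_ _) (h.star_doubling (W := W) hS hT hST hTr)
  rw [mul_comm, ← smul_eq_mul]
  refine Finset.card_nsmul_le_sum _ _ _ fun y hy => ?_
  obtain ⟨Y, hY, hyY⟩ := mem_un.1 (Finset.mem_filter.1 hy).1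
  exact card_le_dg_un fun j hj => dg_pos_of_not_arc hyY
    (fun hh => Finset.disjoint_left.1 hST hY (hh ▸ hj)) fun hh => hno Y hY j hj (.single hh)

/-- The contribution of `v` to `star`. -/
noncomputable def starWt (G : SimpleGraph V) (c : V → Option (Fin r)) (o W : Fin r)
    (S T : Finset (Fin r)) (v : V) : ℕ :=
  if Swappable G c o W v ∧ ∃ Z ∈ T, dg G v (cls c Z) = 0 then (Q' G c o W v ∩ un c S).card else 0

theorem sum_starWt : ∑ v ∈ cls c W, starWt G c o W S T v ≤ (star G c o W S T).card := by
  refine le_trans (Finset.sum_le_sum fun v hv => ?_)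
    (sum_card_Q_inter_le (G := G) (o := o) (subset_refl (cls c W)) (star G c o W S T))
  rw [starWt]
  split_ifs with hh
  · refine Finset.card_le_card fun y hy => ?_
    rw [Finset.mem_inter] at hy ⊢
    exact ⟨Q'_subset hy.1, Finset.mem_filter.2 ⟨hy.2, v, hh.1, hy.1, hh.2⟩⟩
  · exact Nat.zero_le _

theorem Ctx.dg_bcc_add_le (h : Ctx G r s x c o) (hA : D ⊆ acc G c o)
    (hv : ∀ j ∈ D, 1 ≤ dg G v (cls c j)) : dg G v (un c (bcc G c o)) + D.card ≤ r := by
  have h1 := card_le_dg_un hv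
  have h2 := dg_un_union (G := G) (c := c) (v := v) (acc_disjoint_bcc.symm.mono_right hA)
  have h3 : dg G v (un c (bcc G c o ∪ D)) ≤ r := (dg_mono (Finset.subset_univ _)).trans (h.deg v)
  omega

theorem Ctx.dg_bcc_le (h : Ctx G r s x c o) : dg G v (un c (bcc G c o)) ≤ r :=
  (dg_mono (Finset.subset_univ _)).trans (h.deg v)

theorem Term.arc (hW : Term G c o W) (hWo : W ≠ o) :
    ∃ w, Movable G c o W w := by
  rcases (reach_acc hW.1).cases_head with h | ⟨U, hU, -⟩
  · exact absurd h hWo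
  · obtain ⟨⟨hne, w, hw, hf⟩, -, hUA⟩ := hU
    exact ⟨w, hw, U, hUA, hne.symm, hf, hW.2 U hUA hne.symm⟩

theorem Term.swappable (hW : Term G c o W) (hWo : W ≠ o) (hv : c v = some W)
    (hnm : ¬ Movable G c o W v) : Swappable G c o W v := by
  obtain ⟨w, hw⟩ := hW.arc hWo
  obtain ⟨hcw, U, hU, hUW, hf, -⟩ := id hw
  exact ⟨hv, hW, Or.inr ⟨w, fun hh => hnm (hh ▸ hw), hcw, U, hU, hUW, hf⟩⟩

theorem Ctx.dg_of_not_movable (h : Ctx G r s x c o) (hW : Term G c o W) (hv : c v = some W)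
    (hnm : ¬ Movable G c o W v) :
    dg G v (un c (bcc G c o)) + (acc G c o).card ≤ r + 1 := by
  have h1 := h.dg_bcc_add_le (v := v) (Finset.erase_subset W (acc G c o)) fun j hj => by
    rw [Finset.mem_erase] at hj
    exact dg_cls_pos.2 fun hf => hnm ⟨hv, j, hj.2, hj.1, hf, hW.2 j hj.2 hj.1⟩
  rw [Finset.card_erase_of_mem hW.1] at h1
  omega

end Counting

section OneAccessible
open Relation
variable [Fintype V] {G : SimpleGraph V} {r s : ℕ} {x : V} {c : V → Option (Fin r)} {o : Fin r}
  {C D S T : Finset (Fin r)} {W : Fin r} {v : V}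

theorem Ctx.solo_count_bcc (h : Ctx G r s x c o) (hW : W ∈ acc G c o) :
    2 * ((bcc G c o).card * s) ≤
      ∑ v ∈ cls c W, ((Q G c o W v).card + dg G v (un c (bcc G c o))) := by
  refine (h.solo_count hW subset_rfl).trans_eq (Finset.sum_congr rfl fun v _ => ?_)
  rw [Finset.inter_eq_left.2 Q_subset_un]

theorem dg_split (hST : Disjoint S T) (hB : S ∪ T = bcc G c o) :
    dg G v (un c (bcc G c o)) = dg G v (un c S) + dg G v (un c T) := by
  rw [← hB, dg_un_union hST]

theorem card_Q'_split (hST : Disjoint S T) (hB : S ∪ T = bcc G c o) :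
    (Q' G c o W v).card = (Q' G c o W v ∩ un c S).card + (Q' G c o W v ∩ un c T).card := by
  conv_lhs => rw [← Finset.inter_eq_left.2 (Q'_subset.trans Q_subset_un : Q' G c o W v ⊆ _), ← hB]
  rw [inter_un_card, Finset.sum_union hST, ← inter_un_card, ← inter_un_card]

theorem sum_Q'_inter_le {X : Finset V} : ∑ v ∈ cls c W, (Q' G c o W v ∩ X).card ≤ X.card :=
  (Finset.sum_le_sum fun _ _ => Finset.card_le_card
    (Finset.inter_subset_inter_right Q'_subset)).trans
    (sum_card_Q_inter_le subset_rfl X)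

theorem acc_eq_singleton (ha : (acc G c o).card = 1) : acc G c o = {o} := by
  obtain ⟨j, hj⟩ := Finset.card_eq_one.1 ha
  have : o ∈ acc G c o := self_mem_acc
  rw [hj, Finset.mem_singleton] at this
  rw [hj, this]

theorem swappable_of_card_one (ha : (acc G c o).card = 1) (hv : c v = some o) :
    Swappable G c o o v := by
  refine ⟨hv, ⟨self_mem_acc, fun j hj hjo => ?_⟩, Or.inl rfl⟩
  rw [acc_eq_singleton ha, Finset.mem_singleton] at hj
  exact absurd hj hjo

theorem Ctx.card_cls_self (h : Ctx G r s x c o) : (cls c o).card + 1 = s := by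
  have := h.ae.card o
  rwa [if_pos rfl] at this

theorem Ctx.false_of_one_large (h : Ctx G r s x c o) (ha : (acc G c o).card = 1)
    (hS : IsAtomic G c o S) (hr : r ≤ S.card + 2) : False := by
  have hab := card_acc_add_card_bcc (G := G) (c := c) (o := o)
  have hST : Disjoint S (bcc G c o \ S) := Finset.disjoint_sdiff
  have hB : S ∪ bcc G c o \ S = bcc G c o := Finset.union_sdiff_of_subset hS.closed.1
  have hTc := Finset.card_sdiff_add_card_eq_card hS.closed.1
  generalize bcc G c o \ S = T at hST hB hTc
  have hTB : T ⊆ bcc G c o := hB ▸ Finset.subset_union_right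
  have hr8 := h.hr
  have key : ∀ v ∈ cls c o, (Q G c o o v).card + dg G v (un c (bcc G c o)) ≤
      (2 * r - 3) + (Q' G c o o v ∩ un c T).card := by
    intro v hv
    have hsw := swappable_of_card_one ha (mem_cls.1 hv)
    have h1 := h.card_Q_le_Q' (W := o) (v := v)
    have h2 := card_Q'_split (W := o) (v := v) hST hB
    have h3 := dg_split (v := v) hST hB
    have h4 := h.card_Q'_inter_atomic hS hsw
    have h5 := h.dg_bcc_le (v := v)
    have h6 : T.card = 0 → dg G v (un c T) = 0 := by
      intro hT
      rw [Finset.card_eq_zero] at hT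
      rw [hT, dg_un, Finset.sum_empty]
    omega
  have h1 := h.solo_count_bcc self_mem_acc
  have h2 := Finset.sum_le_sum key
  rw [Finset.sum_add_distrib (f := fun _ => 2 * r - 3), Finset.sum_const, smul_eq_mul] at h2
  have h3 := sum_Q'_inter_le (G := G) (c := c) (o := o) (W := o) (X := un c T)
  rw [h.card_un_bcc hTB] at h3
  have h4 : T.card * s ≤ 1 * s := Nat.mul_le_mul_right s (by omega)
  have h5 := h.card_cls_self
  obtain ⟨b, hb⟩ : ∃ b, r = b + 8 := ⟨r - 8, by omega⟩
  have h6 : (bcc G c o).card = b + 7 := by omega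
  have h7 : 2 * r - 3 = 2 * b + 13 := by omega
  rw [h6] at h1
  rw [h7] at h2
  generalize (cls c o).card = m at *
  subst h5
  nlinarith

end OneAccessible

section OneAccessibleEight
open Relation
variable [Fintype V] {G : SimpleGraph V} {s : ℕ} {x : V} {c : V → Option (Fin 8)} {o : Fin 8}
  {S : Finset (Fin 8)} {T₁ T₂ : Fin 8} {W : Fin 8} {v : V}

/-- The local constraints on a vertex when the inaccessible classes split as `S`, `T₁`, `T₂`. -/
theorem Ctx.local_five (h : Ctx G 8 s x c o) (hS : IsAtomic G c o S) (h5 : S.card = 5)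
    (hB : S ∪ {T₁, T₂} = bcc G c o) (hST : Disjoint S {T₁, T₂}) (hne : T₁ ≠ T₂)
    (hsw : Swappable G c o W v) :
    dg G v (un c (bcc G c o)) = dg G v (un c S) + dg G v (cls c T₁) + dg G v (cls c T₂) ∧
    dg G v (un c (bcc G c o)) ≤ 8 ∧ (Q G c o W v).card ≤ dg G v (un c (bcc G c o)) ∧
    ∃ q q₁ q₂, q₁ = (Q' G c o W v ∩ cls c T₁).card ∧ q₂ = (Q' G c o W v ∩ cls c T₂).card ∧
      ((Q G c o W v).card ≤ 4 ∨ (Q G c o W v).card ≤ q + q₁ + q₂ + 1) ∧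
      (q + q₁ + q₂ = 0 → (Q G c o W v).card ≤ 3) ∧
      (q = 0 ∨ q + 10 ≤ 2 * dg G v (un c S)) ∧ (q₁ = 0 ∨ 2 ≤ dg G v (cls c T₁)) ∧
      (q₂ = 0 ∨ 2 ≤ dg G v (cls c T₂)) ∧ q₁ ≤ dg G v (cls c T₁) ∧ q₂ ≤ dg G v (cls c T₂) ∧
      ((∃ i ∈ S, ReflTransGen (arc G c) i T₁) → q₁ = 0 ∨ 5 ≤ dg G v (un c S)) ∧
      ((∃ i ∈ S, ReflTransGen (arc G c) i T₂) → q₂ = 0 ∨ 5 ≤ dg G v (un c S)) ∧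
      (dg G v (cls c T₁) = 0 → starWt G c o W S {T₁} v = q) ∧
      (dg G v (cls c T₂) = 0 → starWt G c o W S {T₂} v = q) := by
  have hd := dg_split (v := v) hST hB
  have hq := card_Q'_split (W := W) (v := v) hST hB
  rw [dg_un (C := {T₁, T₂}), Finset.sum_pair hne] at hd
  rw [inter_un_card (C := {T₁, T₂}), Finset.sum_pair hne] at hq
  have hreach : ∀ T, (∃ i ∈ S, ReflTransGen (arc G c) i T) →
      (Q' G c o W v ∩ cls c T).card = 0 ∨ 5 ≤ dg G v (un c S) := by
    rintro T ⟨i, hi, hp⟩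
    rcases Finset.eq_empty_or_nonempty (Q' G c o W v ∩ cls c T) with h0 | ⟨y, hy⟩
    · exact Or.inl (by rw [h0]; rfl)
    · rw [Finset.mem_inter, mem_cls] at hy
      refine Or.inr (h5 ▸ card_le_dg_un fun j hj => ?_)
      exact h.dg_pos_of_reach hsw hy.1 hy.2 (hS.closed.1 hj) ((hS.reach hj hi).trans hp)
  refine ⟨by omega, h.dg_bcc_le, card_Q_le, _, _, _, rfl, rfl, ?_, ?_,
    h5 ▸ h.card_Q'_inter_atomic hS hsw, h.card_Q'_inter_cls hsw, h.card_Q'_inter_cls hsw,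
    Q'_inter_le _, Q'_inter_le _, hreach _, hreach _, ?_, ?_⟩
  · have := h.card_Q_le_Q' (W := W) (v := v)
    omega
  · intro h0
    exact h.card_Q_le_three (Finset.card_eq_zero.1 (by omega))
  · intro h0
    rw [starWt, if_pos ⟨hsw, T₁, by simp, h0⟩]
  · intro h0
    rw [starWt, if_pos ⟨hsw, T₂, by simp, h0⟩]

theorem Ctx.edges_five (h : Ctx G 8 s x c o) (h5 : S.card = 5)
    (hB : S ∪ {T₁, T₂} = bcc G c o) (hST : Disjoint S {T₁, T₂}) (hne : T₁ ≠ T₂) :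
    eC G c S {T₁} + eC G c S {T₂} + ∑ v ∈ cls c o, dg G v (un c S) + 6 ≤ 16 * s := by
  have hSB : S ⊆ bcc G c o := hB ▸ Finset.subset_union_left
  have hTB : {T₁, T₂} ⊆ bcc G c o := hB ▸ Finset.subset_union_right
  have ho : ∀ j ∈ bcc G c o, o ≠ j := fun j hj => (ne_of_bcc hj self_mem_acc).symm
  have hd : Disjoint ({T₁, T₂} : Finset (Fin 8)) {o} := by
    rw [Finset.disjoint_singleton_right]; exact fun hh => ho o (hTB hh) rfl
  have hd2 : Disjoint S ({T₁, T₂} ∪ {o}) := by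
    refine Finset.disjoint_union_right.2 ⟨hST, ?_⟩
    rw [Finset.disjoint_singleton_right]; exact fun hh => ho o (hSB hh) rfl
  have h1 := h.eC_le hd2 (by omega)
  have hd3 : Disjoint ({T₁} : Finset (Fin 8)) {T₂} := by simpa using hne
  rw [Finset.card_union_of_disjoint hd, Finset.card_pair hne, Finset.card_singleton, h5,
    if_pos (by simp), eC_union_right hd, Finset.insert_eq, eC_union_right hd3,
    eC_comm (D := {o})] at h1
  rw [show eC G c {o} S = ∑ v ∈ cls c o, dg G v (un c S) by rw [eC, un_singleton]] at h1
  omega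

theorem Ctx.five_mul_le (h : Ctx G 8 s x c o) (hS : IsAtomic G c o S) (h5 : S.card = 5)
    (hB : S ∪ {T₁, T₂} = bcc G c o) (hST : Disjoint S {T₁, T₂}) :
    5 * s ≤ eC G c S {T₁} ∧ 5 * s ≤ eC G c S {T₂} := by
  have hTB : {T₁, T₂} ⊆ bcc G c o := hB ▸ Finset.subset_union_right
  have : ∀ T ∈ ({T₁, T₂} : Finset (Fin 8)), 5 * s ≤ eC G c S {T} := by
    intro T hT
    have := h.eC_closed (D := {T}) hS.closed (by simpa using mem_bcc.1 (hTB hT))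
      (hST.mono_right (by simpa using hT))
    simpa [h5] using this
  exact ⟨this _ (by simp), this _ (by simp)⟩

theorem Ctx.sum_starWt_singleton (h : Ctx G 8 s x c o) (hS : IsAtomic G c o S) (h5 : S.card = 5)
    {T : Fin 8} (hT : T ∈ bcc G c o) (hTS : T ∉ S)
    (hno : ¬ ∃ i ∈ S, ReflTransGen (arc G c) i T) :
    ∑ v ∈ cls c W, starWt G c o W S {T} v + 10 * s ≤ 2 * eC G c S {T} := by
  have h1 := h.star_card (W := W) (T := {T}) hS (by simpa using mem_bcc.1 hT) (by simpa using hTS)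
    (by simp [ReflTransGen.refl]) fun i hi j hj hp => by
      rw [Finset.mem_singleton] at hj
      exact hno ⟨i, hi, hj ▸ hp⟩
  have h2 := sum_starWt (G := G) (c := c) (o := o) (W := W) (S := S) (T := {T})
  rw [Finset.card_singleton, h5] at h1
  omega

theorem Ctx.false_of_one_mixed (h : Ctx G 8 s x c o) (ha : (acc G c o).card = 1)
    (hS : IsAtomic G c o S) (h5 : S.card = 5)
    (hB : S ∪ {T₁, T₂} = bcc G c o) (hST : Disjoint S {T₁, T₂}) (hne : T₁ ≠ T₂)
    (hr₁ : ∃ i ∈ S, ReflTransGen (arc G c) i T₁)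
    (hr₂ : ¬ ∃ i ∈ S, ReflTransGen (arc G c) i T₂) : False := by
  have hTB : {T₁, T₂} ⊆ bcc G c o := hB ▸ Finset.subset_union_right
  have hT₂ : T₂ ∈ bcc G c o := hTB (by simp)
  have key : ∀ v ∈ cls c o, 6 * ((Q G c o o v).card + dg G v (un c (bcc G c o))) ≤
      68 + (4 * (Q' G c o o v ∩ cls c T₂).card + (starWt G c o o S {T₂} v +
        2 * dg G v (un c S))) := by
    intro v hv
    have hsw := swappable_of_card_one ha (mem_cls.1 hv)
    obtain ⟨h1, h2, h3, q, q₁, q₂, e1, e2, h4, h5, h6, h7, h8, h9, h10, h11, -, -, h14⟩ :=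
      h.local_five hS h5 hB hST hne hsw
    have := h11 hr₁
    rw [← e2]
    omega
  have h1 := h.solo_count_bcc self_mem_acc
  have h2 := Finset.sum_le_sum key
  simp only [Finset.sum_add_distrib, ← Finset.mul_sum, Finset.sum_const, smul_eq_mul] at h1 h2
  have h3 := sum_Q'_inter_le (G := G) (c := c) (o := o) (W := o) (X := cls c T₂)
  rw [h.card_cls_bcc hT₂] at h3
  have h4 := h.sum_starWt_singleton (W := o) hS h5 hT₂
    (fun hh => Finset.disjoint_left.1 hST hh (by simp)) hr₂
  have h6 := h.edges_five h5 hB hST hne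
  have h7 := h.five_mul_le hS h5 hB hST
  have h8 := h.card_cls_self
  have h9 := card_acc_add_card_bcc (G := G) (c := c) (o := o)
  rw [show (bcc G c o).card = 7 by omega] at h1
  omega

theorem Ctx.false_of_one_five (h : Ctx G 8 s x c o) (ha : (acc G c o).card = 1)
    (hS : IsAtomic G c o S) (h5 : S.card = 5) : False := by
  have h9 := card_acc_add_card_bcc (G := G) (c := c) (o := o)
  have hTc := Finset.card_sdiff_add_card_eq_card hS.closed.1
  have hB : S ∪ bcc G c o \ S = bcc G c o := Finset.union_sdiff_of_subset hS.closed.1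
  have hST : Disjoint S (bcc G c o \ S) := Finset.disjoint_sdiff
  obtain ⟨T₁, T₂, hne, hT⟩ := Finset.card_eq_two.1 (show (bcc G c o \ S).card = 2 by omega)
  rw [hT] at hB hST
  have hb : (bcc G c o).card = 7 := by omega
  clear hTc hT h9
  have hTB : {T₁, T₂} ⊆ bcc G c o := hB ▸ Finset.subset_union_right
  by_cases hr₁ : ∃ i ∈ S, ReflTransGen (arc G c) i T₁
  · by_cases hr₂ : ∃ i ∈ S, ReflTransGen (arc G c) i T₂
    · have key : ∀ v ∈ cls c o, 2 * ((Q G c o o v).card + dg G v (un c (bcc G c o))) +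
          dg G v (un c {T₁, T₂}) ≤ 30 := by
        intro v hv
        have hsw := swappable_of_card_one ha (mem_cls.1 hv)
        obtain ⟨h1, h2, h3, q, q₁, q₂, e1, e2, h4, h5, h6, h7, h8, h9, h10, h11, h12, -, -⟩ :=
          h.local_five hS h5 hB hST hne hsw
        have := h11 hr₁
        have := h12 hr₂
        rw [dg_un (C := {T₁, T₂}), Finset.sum_pair hne]
        omega
      have h1 := h.solo_count_bcc self_mem_acc
      have h2 := Finset.sum_le_sum key
      simp only [Finset.sum_add_distrib, ← Finset.mul_sum, Finset.sum_const, smul_eq_mul] at h1 h2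
      have h3 := h.eC_ge_of_acc hTB (D := {o}) (by simp [ReflTransGen.refl])
      rw [eC_comm, eC, un_singleton, Finset.card_pair hne, Finset.card_singleton] at h3
      have h8 := h.card_cls_self
      rw [hb] at h1
      omega
    · exact h.false_of_one_mixed ha hS h5 hB hST hne hr₁ hr₂
  · by_cases hr₂ : ∃ i ∈ S, ReflTransGen (arc G c) i T₂
    · rw [Finset.pair_comm] at hB hST
      exact h.false_of_one_mixed ha hS h5 hB hST hne.symm hr₂ hr₁
    · have key : ∀ v ∈ cls c o, 28 * (Q G c o o v).card ≤
          112 + (7 * (starWt G c o o S {T₁} v + starWt G c o o S {T₂} v) +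
          16 * ((Q' G c o o v ∩ cls c T₁).card + (Q' G c o o v ∩ cls c T₂).card)) := by
        intro v hv
        have hsw := swappable_of_card_one ha (mem_cls.1 hv)
        obtain ⟨h1, h2, h3, q, q₁, q₂, e1, e2, h4, h5, h6, h7, h8, h9, h10, -, -, h13, h14⟩ :=
          h.local_five hS h5 hB hST hne hsw
        rw [← e1, ← e2]
        omega
      have h1 := h.solo_count_bcc self_mem_acc
      have h2 := Finset.sum_le_sum key
      have hd : ∑ v ∈ cls c o, dg G v (un c (bcc G c o)) ≤ ∑ v ∈ cls c o, 8 :=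
        Finset.sum_le_sum fun v _ => h.dg_bcc_le
      simp only [Finset.sum_add_distrib, ← Finset.mul_sum, Finset.sum_const, smul_eq_mul]
        at h1 h2 hd
      have h3 := sum_Q'_inter_le (G := G) (c := c) (o := o) (W := o) (X := cls c T₁)
      have h3' := sum_Q'_inter_le (G := G) (c := c) (o := o) (W := o) (X := cls c T₂)
      rw [h.card_cls_bcc (hTB (by simp))] at h3 h3'
      have h4 := h.sum_starWt_singleton (W := o) hS h5 (hTB (by simp))
        (fun hh => Finset.disjoint_left.1 hST hh (by simp)) hr₁
      have h4' := h.sum_starWt_singleton (W := o) hS h5 (hTB (by simp))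
        (fun hh => Finset.disjoint_left.1 hST hh (by simp)) hr₂
      have h6 := h.edges_five h5 hB hST hne
      have h7 := h.five_mul_le hS h5 hB hST
      have h8 := h.card_cls_self
      have h9 := h.eC_ge_of_acc hS.closed.1 (D := {o}) (by simp [ReflTransGen.refl])
      rw [eC_comm, eC, un_singleton, Finset.card_singleton, h5] at h9
      rw [hb] at h1
      omega

end OneAccessibleEight

section TwoAccessible
open Relation
variable [Fintype V] {G : SimpleGraph V} {r s : ℕ} {x : V} {c : V → Option (Fin r)} {o : Fin r}
  {C D S T : Finset (Fin r)} {W : Fin r} {v : V}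

theorem isAtomic_of_minimal (hC : Closed G c o C) (h5 : 5 ≤ C.card)
    (hmin : ∀ D ⊆ C, Closed G c o D → D ≠ C → D.card ≤ 2) : IsAtomic G c o C := by
  refine ⟨hC, Finset.card_pos.1 (by omega), fun D hD hDc hDne => ?_⟩
  by_contra hcon
  have h1 := Finset.card_sdiff_add_card_eq_card hD
  have h2 := hmin D hD hDc hcon
  have h3 := hmin (C \ D) Finset.sdiff_subset (hC.sdiff hDc) fun hh => by
    rw [hh] at h1
    have := Finset.card_pos.2 hDne
    omega
  omega

theorem Ctx.card_acc_ne_one (h : Ctx G r s x c o) : (acc G c o).card ≠ 1 := by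
  intro ha
  have hab := card_acc_add_card_bcc (G := G) (c := c) (o := o)
  have hr := h.hr
  obtain ⟨C, hC, h3, hmin⟩ := exists_minimal_closed (G := G) (c := c) (o := o) (by omega)
  have h1 := h.closed_card_cases hC
  have h2 := h.closed_card_cases (Closed.bcc.sdiff hC)
  have h4 := Finset.card_sdiff_add_card_eq_card hC.1
  by_cases h5 : 5 ≤ C.card
  · have hS := isAtomic_of_minimal hC h5 hmin
    by_cases h6 : r ≤ C.card + 2
    · exact h.false_of_one_large ha hS h6
    · obtain ⟨rfl, h7⟩ : r = 8 ∧ C.card = 5 := by omega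
      exact h.false_of_one_five ha hS h7
  · omega

theorem Ctx.edges_acc (h : Ctx G r s x c o) (hST : Disjoint S T) (hB : S ∪ T = bcc G c o)
    (hW : W ∈ acc G c o) : eC G c S T + ∑ v ∈ cls c W, dg G v (un c S) +
      S.card * ((acc G c o).card - 1) * s + 6 ≤ 2 * (r * s) := by
  have hSB : S ⊆ bcc G c o := hB ▸ Finset.subset_union_left
  have hTB : T ⊆ bcc G c o := hB ▸ Finset.subset_union_right
  have hab := card_acc_add_card_bcc (G := G) (c := c) (o := o)
  have hd : Disjoint T (acc G c o) := acc_disjoint_bcc.symm.mono_left hTB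
  have hd2 : Disjoint S (T ∪ acc G c o) :=
    Finset.disjoint_union_right.2 ⟨hST, acc_disjoint_bcc.symm.mono_left hSB⟩
  have hcard := Finset.card_union_of_disjoint hST
  have h8 := h.hr
  rw [hB] at hcard
  have h1 := h.eC_le hd2 (by rw [Finset.card_union_of_disjoint hd]; omega)
  have hd3 : Disjoint {W} ((acc G c o).erase W) := by simp
  have h2 : S.card * ((acc G c o).erase W).card * s ≤ eC G c S ((acc G c o).erase W) :=
    h.eC_ge_of_acc hSB (Finset.erase_subset _ _)
  rw [if_pos (Finset.mem_union_right _ (Finset.mem_union_right _ self_mem_acc)),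
    Finset.card_union_of_disjoint hd, eC_union_right hd] at h1
  rw [Finset.card_erase_of_mem hW] at h2
  have h3 : eC G c S (acc G c o) = eC G c S {W} + eC G c S ((acc G c o).erase W) := by
    rw [← eC_union_right hd3, ← Finset.insert_eq, Finset.insert_erase hW]
  have h4 : eC G c S {W} = ∑ v ∈ cls c W, dg G v (un c S) := by
    rw [eC_comm, eC, un_singleton]
  have h5 : S.card + (T.card + (acc G c o).card) = r := by omega
  rw [h5] at h1
  omega

theorem term_of_card_two (ha : (acc G c o).card = 2) (hW : W ∈ acc G c o) (hWo : W ≠ o) :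
    Term G c o W := by
  refine ⟨hW, fun j hj hjW => ?_⟩
  by_contra hh
  have hjo : j ≠ o := by rintro rfl; exact hh .refl
  have : ({j, W, o} : Finset (Fin r)) ⊆ acc G c o := by
    intro i hi
    simp only [Finset.mem_insert, Finset.mem_singleton] at hi
    rcases hi with rfl | rfl | rfl
    exacts [hj, hW, self_mem_acc]
  have := Finset.card_le_card this
  rw [Finset.card_eq_three.2 ⟨j, W, o, hjW, hjo, hWo, rfl⟩] at this
  omega

theorem Movable.Q_eq_empty (h : Ctx G r s x c o) (hm : Movable G c o W v) (hW : W ∈ acc G c o)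
    (hcard : ∀ Y ∈ bcc G c o, ∃ S : Finset (Fin r), (acc G c o).card < S.card + 2 ∧
      ∀ Z ∈ S, Z ∈ bcc G c o ∧ ReflTransGen (arc G c) Z Y) : Q G c o W v = ∅ := by
  refine Finset.eq_empty_of_forall_notMem fun y hy => ?_
  obtain ⟨⟨Y, hY, hyY⟩, hvy, hy1⟩ := mem_Q.1 hy
  obtain ⟨S, hS, hS'⟩ := hcard Y hY
  have := h.card_of_movable hm hW hvy hy1 hyY hY hS'
  omega

theorem Movable.Q_eq_empty_of_card_two (h : Ctx G r s x c o) (ha : (acc G c o).card = 2)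
    (hm : Movable G c o W v) (hW : W ∈ acc G c o) : Q G c o W v = ∅ :=
  hm.Q_eq_empty h hW fun Y hY => ⟨{Y}, by simp [ha], fun Z hZ => by
    obtain rfl := Finset.mem_singleton.1 hZ
    exact ⟨hY, .refl⟩⟩

theorem exists_mem_acc_ne (ha : 2 ≤ (acc G c o).card) : ∃ W ∈ acc G c o, W ≠ o := by
  by_contra! hh
  have : acc G c o ⊆ {o} := fun j hj => Finset.mem_singleton.2 (hh j hj)
  have := Finset.card_le_card this
  rw [Finset.card_singleton] at this
  omega

theorem Ctx.card_cls_acc (h : Ctx G r s x c o) (hWo : W ≠ o) : (cls c W).card = s := by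
  have := h.ae.card W
  rwa [if_neg hWo] at this

theorem Ctx.false_of_two_atomic (h : Ctx G r s x c o) (ha : (acc G c o).card = 2)
    (hB : IsAtomic G c o (bcc G c o)) : False := by
  obtain ⟨W, hW, hWo⟩ := exists_mem_acc_ne (le_of_eq ha.symm)
  have hterm := term_of_card_two ha hW hWo
  have hab := card_acc_add_card_bcc (G := G) (c := c) (o := o)
  have hr := h.hr
  have key : ∀ v ∈ cls c W, (Q G c o W v).card + dg G v (un c (bcc G c o)) ≤ r + 3 := by
    intro v hv
    by_cases hm : Movable G c o W v
    · rw [hm.Q_eq_empty_of_card_two h ha hW]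
      have := h.dg_bcc_le (v := v)
      simp only [Finset.card_empty]
      omega
    · have h1 := h.dg_of_not_movable hterm (mem_cls.1 hv) hm
      have h2 := h.card_Q'_inter_atomic hB (hterm.swappable hWo (mem_cls.1 hv) hm)
      rw [Finset.inter_eq_left.2 (Q'_subset.trans Q_subset_un)] at h2
      have h3 := h.card_Q_le_Q' (W := W) (v := v)
      omega
  have h1 := h.solo_count_bcc hW
  have h2 := Finset.sum_le_sum key
  rw [Finset.sum_const, smul_eq_mul, h.card_cls_acc hWo] at h2
  obtain ⟨b, hb⟩ : ∃ b, r = b + 8 := ⟨r - 8, by omega⟩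
  rw [show (bcc G c o).card = b + 6 by omega] at h1
  have hs := h.s_pos
  subst hb
  nlinarith

end TwoAccessible

section TwoAccessibleEight
open Relation
variable [Fintype V] {G : SimpleGraph V} {s : ℕ} {x : V} {c : V → Option (Fin 8)} {o : Fin 8}
  {S T S₁ S₂ : Finset (Fin 8)} {Y : Fin 8} {W : Fin 8} {v : V}

theorem card_Q_split (hST : Disjoint S T) (hB : S ∪ T = bcc G c o) :
    (Q G c o W v).card = (Q G c o W v ∩ un c S).card + (Q G c o W v ∩ un c T).card := by
  conv_lhs => rw [← Finset.inter_eq_left.2 (Q_subset_un : Q G c o W v ⊆ _), ← hB]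
  rw [inter_un_card, Finset.sum_union hST, ← inter_un_card, ← inter_un_card]

theorem Ctx.card_Q_inter_cls (h : Ctx G 8 s x c o) : (Q' G c o W v ∩ cls c Y).card = 0 ∨
    (Q G c o W v ∩ cls c Y).card ≤ (Q' G c o W v ∩ cls c Y).card := by
  rcases Finset.eq_empty_or_nonempty (Q' G c o W v ∩ cls c Y) with h0 | ⟨y', hy'⟩
  · exact Or.inl (by rw [h0]; rfl)
  refine Or.inr (Finset.card_le_card fun y hy => ?_)
  rw [Finset.mem_inter, mem_cls] at hy hy' ⊢
  by_cases hyy : y' = y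
  · exact hyy ▸ hy'
  · exact ⟨mem_Q'.2 ⟨hy.1, y', Q'_subset hy'.1, hyy,
      fun hadj => h.ae.proper y y' Y hadj hy.2 hy'.2⟩, hy.2⟩

theorem Ctx.false_of_two_five (h : Ctx G 8 s x c o) (ha : (acc G c o).card = 2)
    (hS : IsAtomic G c o S) (h5 : S.card = 5) : False := by
  obtain ⟨W, hW, hWo⟩ := exists_mem_acc_ne (le_of_eq ha.symm)
  have hterm := term_of_card_two ha hW hWo
  have h9 := card_acc_add_card_bcc (G := G) (c := c) (o := o)
  have hTc := Finset.card_sdiff_add_card_eq_card hS.closed.1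
  have hB : S ∪ bcc G c o \ S = bcc G c o := Finset.union_sdiff_of_subset hS.closed.1
  have hST : Disjoint S (bcc G c o \ S) := Finset.disjoint_sdiff
  obtain ⟨Y, hT⟩ := Finset.card_eq_one.1 (show (bcc G c o \ S).card = 1 by omega)
  rw [hT] at hB hST
  have hb : (bcc G c o).card = 6 := by omega
  clear hTc hT h9
  have hYB : Y ∈ bcc G c o := hB ▸ Finset.mem_union_right _ (by simp)
  have hYS : Y ∉ S := fun hh => Finset.disjoint_left.1 hST hh (by simp)
  have hloc : ∀ v ∈ cls c W, dg G v (un c (bcc G c o)) = dg G v (un c S) + dg G v (cls c Y) ∧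
      (Movable G c o W v ∧ (Q G c o W v).card = 0 ∧ dg G v (un c (bcc G c o)) ≤ 8 ∨
      ¬ Movable G c o W v ∧ dg G v (un c (bcc G c o)) ≤ 7 ∧
      (Q G c o W v).card ≤ dg G v (un c (bcc G c o)) ∧
      ∃ q q₁, q₁ = (Q' G c o W v ∩ cls c Y).card ∧
      ((Q G c o W v).card ≤ 4 ∨ (Q G c o W v).card ≤ q + q₁ + 1) ∧
      (q + q₁ = 0 → (Q G c o W v).card ≤ 3) ∧
      (q₁ = 0 ∨ (Q G c o W v).card ≤ dg G v (un c S) + q₁) ∧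
      (q = 0 ∨ q + 10 ≤ 2 * dg G v (un c S)) ∧ (q₁ = 0 ∨ 2 ≤ dg G v (cls c Y)) ∧
      q₁ ≤ dg G v (cls c Y) ∧
      ((∃ i ∈ S, ReflTransGen (arc G c) i Y) → q₁ = 0 ∨ 5 ≤ dg G v (un c S)) ∧
      (dg G v (cls c Y) = 0 → starWt G c o W S {Y} v = q)) := by
    intro v hv
    have hd := dg_split (v := v) hST hB
    rw [un_singleton] at hd
    refine ⟨hd, ?_⟩
    by_cases hm : Movable G c o W v
    · exact Or.inl ⟨hm, by simp [hm.Q_eq_empty_of_card_two h ha hW], h.dg_bcc_le⟩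
    right
    have hsw := hterm.swappable hWo (mem_cls.1 hv) hm
    have hq := card_Q'_split (W := W) (v := v) hST hB
    rw [un_singleton] at hq
    have h1 := h.dg_of_not_movable hterm (mem_cls.1 hv) hm
    refine ⟨hm, by omega, card_Q_le, _, _, rfl, ?_, fun h0 =>
      h.card_Q_le_three (Finset.card_eq_zero.1 (by omega)), ?_, h5 ▸ h.card_Q'_inter_atomic hS hsw,
      h.card_Q'_inter_cls hsw, Q'_inter_le _, ?_, ?_⟩
    · have := h.card_Q_le_Q' (W := W) (v := v)
      omega
    · have h2 := Q_subset_nbr (G := G) (c := c) (o := o) (W := W) (v := v) (un c S)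
      have h3 := card_Q_split (W := W) (v := v) hST hB
      rw [un_singleton] at h3
      have h4 := h.card_Q_inter_cls (W := W) (v := v) (Y := Y)
      omega
    · rintro ⟨i, hi, hp⟩
      rcases Finset.eq_empty_or_nonempty (Q' G c o W v ∩ cls c Y) with h0 | ⟨y, hy⟩
      · exact Or.inl (by rw [h0]; rfl)
      · rw [Finset.mem_inter, mem_cls] at hy
        refine Or.inr (h5 ▸ card_le_dg_un fun j hj => ?_)
        exact h.dg_pos_of_reach hsw hy.1 hy.2 (hS.closed.1 hj) ((hS.reach hj hi).trans hp)
    · intro h0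
      rw [starWt, if_pos ⟨hsw, Y, by simp, h0⟩]
  have h1 := h.solo_count_bcc hW
  rw [hb] at h1
  have hs := h.card_cls_acc hWo
  by_cases hr : ∃ i ∈ S, ReflTransGen (arc G c) i Y
  · obtain ⟨w, hw⟩ := hterm.arc hWo
    have key : ∀ v ∈ cls c W,
        (Q G c o W v).card + dg G v (un c (bcc G c o)) + (if v = w then 1 else 0) ≤ 12 := by
      intro v hv
      obtain ⟨e, ⟨-, h2, h3⟩ | ⟨hm, h2, h3, q, q₁, -, h4, -, -, h5, h6, h7, h8, -⟩⟩ := hloc v hv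
      · split_ifs <;> omega
      · have h9 := h8 hr
        have : v ≠ w := fun hh => hm (hh ▸ hw)
        rw [if_neg this]
        omega
    have h2 := Finset.sum_le_sum key
    rw [Finset.sum_add_distrib, Finset.sum_ite_eq', if_pos (mem_cls.2 hw.1), Finset.sum_const,
      smul_eq_mul, hs] at h2
    omega
  · have key : ∀ v ∈ cls c W, 9 * ((Q G c o W v).card + dg G v (un c (bcc G c o))) ≤
        90 + (starWt G c o W S {Y} v + 2 * dg G v (un c S) +
          6 * (Q' G c o W v ∩ cls c Y).card) := by
      intro v hv
      obtain ⟨e, ⟨-, h2, h3⟩ |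
        ⟨-, h2, h3, q, q₁, e2, h4, h4', h4'', h5, h6, h7, -, h8⟩⟩ := hloc v hv
      · omega
      · rw [← e2]
        omega
    have h2 := Finset.sum_le_sum key
    simp only [Finset.sum_add_distrib, ← Finset.mul_sum, Finset.sum_const, smul_eq_mul] at h1 h2
    have h3 := sum_Q'_inter_le (G := G) (c := c) (o := o) (W := W) (X := cls c Y)
    rw [h.card_cls_bcc hYB] at h3
    have h4 := h.sum_starWt_singleton (W := W) hS h5 hYB hYS hr
    have h6 := h.edges_acc hST hB hW
    rw [ha, h5] at h6
    have := h.s_pos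
    omega

/-- The number of starred vertices of `S₁` is bounded by the excess of edges to `S₂`. -/
theorem Ctx.star_le (h : Ctx G 8 s x c o) (hS₁ : IsAtomic G c o S₁) (hS₂ : IsAtomic G c o S₂)
    (hd : Disjoint S₁ S₂) {m : ℕ} (hm : ∀ y ∈ un c S₁, dg G y (un c S₂) ≤ m) :
    m * (star G c o W S₁ S₂).card + 2 * (S₁.card * S₂.card * s) ≤
      eC G c S₁ S₂ + m * (S₁.card * s) := by
  have h1 := h.star_doubling (W := W) hS₁ hS₂.closed.1 hd fun i hi j hj => hS₂.reach hi hj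
  have hsub : star G c o W S₁ S₂ ⊆ un c S₁ := Finset.filter_subset _ _
  have h2 : eC G c S₁ S₂ ≤ ∑ y ∈ star G c o W S₁ S₂, dg G y (un c S₂) +
      m * (un c S₁ \ star G c o W S₁ S₂).card := by
    rw [eC, ← Finset.sum_sdiff hsub, add_comm]
    refine Nat.add_le_add_left ?_ _
    rw [mul_comm, ← smul_eq_mul]
    exact Finset.sum_le_card_nsmul _ _ _ fun y hy => hm y (Finset.mem_sdiff.1 hy).1
  have h3 := Finset.card_sdiff_add_card_eq_card hsub
  rw [h.card_un_bcc hS₁.closed.1] at h3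
  have h4 := congrArg (m * ·) h3
  simp only [mul_add] at h4
  omega

/-- If some vertex of `S₂` is starred, then `S₁` does not reach `S₂`. -/
theorem Ctx.not_reach_of_star (h : Ctx G 8 s x c o) (hS₁ : IsAtomic G c o S₁)
    (hS₂ : IsAtomic G c o S₂) (hne : star G c o W S₂ S₁ ≠ ∅) :
    ∀ i ∈ S₁, ∀ j ∈ S₂, ¬ ReflTransGen (arc G c) i j := by
  intro i hi j hj hp
  obtain ⟨y, hy⟩ := Finset.nonempty_iff_ne_empty.2 hne
  obtain ⟨hyS, v, hv, hyv, Z, hZ, h0⟩ := Finset.mem_filter.1 hy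
  have := h.hits_of_Q' hS₂ hv ⟨y, Finset.mem_inter.2 ⟨hyv, hyS⟩⟩ (hS₁.closed.1 hZ)
    ⟨j, hj, (hS₁.reach hZ hi).trans hp⟩
  omega

theorem Ctx.dg_bcc_acc (h : Ctx G 8 s x c o) {y : V} (hy : y ∈ un c (bcc G c o)) :
    dg G y (un c (bcc G c o)) + (acc G c o).card ≤ 8 := by
  obtain ⟨j, hj, hyj⟩ := mem_un.1 hy
  exact h.dg_bcc_add_le subset_rfl fun i hi => dg_acc_pos hyj hj hi

theorem Ctx.starWt_eq (hsw : Swappable G c o W v) (hS : ¬ S₂.card ≤ dg G v (un c S₂)) :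
    starWt G c o W S₁ S₂ v = (Q' G c o W v ∩ un c S₁).card := by
  rw [starWt, if_pos]
  refine ⟨hsw, ?_⟩
  by_contra! hh
  exact hS (card_le_dg_un fun j hj => Nat.pos_of_ne_zero (hh j hj))

theorem Ctx.false_of_two_three (h : Ctx G 8 s x c o) (ha : (acc G c o).card = 2)
    (hS₁ : IsAtomic G c o S₁) (h₁ : S₁.card = 3) (hS₂ : IsAtomic G c o S₂) (h₂ : S₂.card = 3)
    (hd : Disjoint S₁ S₂) (hB : S₁ ∪ S₂ = bcc G c o) : False := by
  obtain ⟨W, hW, hWo⟩ := exists_mem_acc_ne (le_of_eq ha.symm)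
  have hterm := term_of_card_two ha hW hWo
  have key : ∀ v ∈ cls c W, 2 * ((Q G c o W v).card + dg G v (un c (bcc G c o))) ≤
      22 + (starWt G c o W S₁ S₂ v + starWt G c o W S₂ S₁ v) := by
    intro v hv
    by_cases hm : Movable G c o W v
    · have h1 := h.dg_bcc_le (v := v)
      rw [hm.Q_eq_empty_of_card_two h ha hW, Finset.card_empty]
      omega
    have hsw := hterm.swappable hWo (mem_cls.1 hv) hm
    have e1 := dg_split (v := v) hd hB
    have e2 := card_Q'_split (W := W) (v := v) hd hB
    have h1 := h.dg_of_not_movable hterm (mem_cls.1 hv) hm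
    have h2 := h.card_Q_le_Q' (W := W) (v := v)
    have h3 := h.card_Q'_inter_atomic hS₁ hsw
    have h4 := h.card_Q'_inter_atomic hS₂ hsw
    have h5 : (Q' G c o W v).card = 0 → (Q G c o W v).card ≤ 3 := fun h0 =>
      h.card_Q_le_three (Finset.card_eq_zero.1 h0)
    have h6 := card_Q_le (G := G) (c := c) (o := o) (W := W) (v := v)
    have h7 := Ctx.starWt_eq (S₁ := S₁) (S₂ := S₂) hsw
    have h8 := Ctx.starWt_eq (S₁ := S₂) (S₂ := S₁) hsw
    rw [h₁] at h3 h8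
    rw [h₂] at h4 h7
    omega
  have h1 := h.solo_count_bcc hW
  have h2 := Finset.sum_le_sum key
  simp only [Finset.sum_add_distrib, ← Finset.mul_sum, Finset.sum_const, smul_eq_mul] at h1 h2
  rw [h.card_cls_acc hWo] at h2
  have h3 := sum_starWt (G := G) (c := c) (o := o) (W := W) (S := S₁) (T := S₂)
  have h4 := sum_starWt (G := G) (c := c) (o := o) (W := W) (S := S₂) (T := S₁)
  have h5 := h.edges_acc hd hB hW
  have hdeg : ∀ C ⊆ bcc G c o, ∀ D ⊆ bcc G c o, ∀ y ∈ un c C, dg G y (un c D) ≤ 6 := by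
    intro C hC D hD y hy
    have h6 := h.dg_bcc_acc (un_mono hC hy)
    have h7 := dg_mono (G := G) (v := y) (un_mono (c := c) hD)
    omega
  have h6 := h.star_le (W := W) hS₁ hS₂ hd (hdeg _ hS₁.closed.1 _ hS₂.closed.1)
  have h7 := h.star_le (W := W) hS₂ hS₁ hd.symm (hdeg _ hS₂.closed.1 _ hS₁.closed.1)
  have h8 : 3 * s ≤ ∑ v ∈ cls c W, dg G v (un c S₁) := by
    have := h.eC_ge_of_acc hS₁.closed.1 (D := {W}) (by simpa using mem_acc.1 hW)
    rw [eC_comm, eC, un_singleton, h₁, Finset.card_singleton] at this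
    omega
  have hb : (bcc G c o).card = 6 := by rw [← hB, Finset.card_union_of_disjoint hd, h₁, h₂]
  have hs := h.s_pos
  rw [hb] at h1
  rw [eC_comm (C := S₂)] at h7
  rw [h₁, ha] at h5
  rw [h₁, h₂] at h6 h7
  by_cases hE₁ : star G c o W S₁ S₂ = ∅
  · rw [hE₁, Finset.card_empty] at h3
    omega
  by_cases hE₂ : star G c o W S₂ S₁ = ∅
  · rw [hE₂, Finset.card_empty] at h4
    omega
  have h9 := h.star_card (W := W) hS₁ hS₂.closed.1 hd (fun i hi j hj => hS₂.reach hi hj)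
    (h.not_reach_of_star hS₁ hS₂ hE₂)
  have h10 := h.star_card (W := W) hS₂ hS₁.closed.1 hd.symm (fun i hi j hj => hS₁.reach hi hj)
    (h.not_reach_of_star hS₂ hS₁ hE₁)
  rw [eC_comm (C := S₂)] at h10
  rw [h₁, h₂] at h9 h10
  omega

end TwoAccessibleEight

section ThreeAccessible
open Relation
variable [Fintype V] {G : SimpleGraph V} {r s : ℕ} {x : V} {c : V → Option (Fin r)} {o : Fin r}
  {C D S T : Finset (Fin r)} {W : Fin r} {v : V}

theorem Ctx.card_acc_ne_two (h : Ctx G r s x c o) : (acc G c o).card ≠ 2 := by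
  intro ha
  have hab := card_acc_add_card_bcc (G := G) (c := c) (o := o)
  have hr := h.hr
  obtain ⟨C, hC, h3, hmin⟩ := exists_minimal_closed (G := G) (c := c) (o := o) (by omega)
  have h1 := h.closed_card_cases hC
  have h4 := Finset.card_sdiff_add_card_eq_card hC.1
  by_cases h5 : 5 ≤ C.card
  · have hS := isAtomic_of_minimal hC h5 hmin
    by_cases h6 : r ≤ C.card + 2
    · rw [Finset.eq_of_subset_of_card_le hC.1 (by omega)] at hS
      exact h.false_of_two_atomic ha hS
    · obtain ⟨rfl, h7⟩ : r = 8 ∧ C.card = 5 := by omega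
      exact h.false_of_two_five ha hS h7
  · obtain ⟨rfl, h7⟩ : r = 8 ∧ C.card = 3 := by omega
    have hatom : ∀ D, Closed G c o D → D.card = 3 → IsAtomic G c o D := by
      intro D hD hD3
      refine hD.isAtomic (Finset.card_pos.1 (by omega)) fun E hE hEne hDE hcard => ?_
      have e1 := Finset.card_pos.2 hEne
      have e2 := Finset.card_pos.2 hDE
      have e3 : ∀ F, Closed G c o F → F.card = 2 → False := by
        intro F hF hF2
        have e4 := h.closed_card_cases (Closed.bcc.sdiff hF)
        have e5 := Finset.card_sdiff_add_card_eq_card hF.1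
        omega
      by_cases e6 : E.card = 2
      · exact e3 E hE e6
      · exact e3 _ (hD.sdiff hE) (by omega)
    exact h.false_of_two_three ha (hatom C hC h7) h7
      (hatom _ (Closed.bcc.sdiff hC) (by omega)) (by omega) Finset.disjoint_sdiff
      (Finset.union_sdiff_of_subset hC.1)

theorem Ctx.edges_total (h : Ctx G r s x c o) :
    eC G c (acc G c o) (acc G c o) + 2 * eC G c (bcc G c o) (acc G c o) +
      eC G c (bcc G c o) (bcc G c o) + 18 ≤ 6 * (r * s) := by
  have h1 := h.card_un_add (acc G c o ∪ bcc G c o)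
  have hr := h.hr
  have hd := acc_disjoint_bcc (G := G) (c := c) (o := o)
  have hs := h.s_pos
  have hab := card_acc_add_card_bcc (G := G) (c := c) (o := o)
  rw [if_pos (Finset.mem_union_left _ self_mem_acc), Finset.card_union_of_disjoint hd, hab] at h1
  have h4 : r ≤ r * s := Nat.le_mul_of_pos_right _ hs
  have h2 := h.bounds.inner (un c (acc G c o ∪ bcc G c o)) (by omega)
  have h3 : eC G c (acc G c o ∪ bcc G c o) (acc G c o ∪ bcc G c o) = eC G c (acc G c o) (acc G c o)
      + 2 * eC G c (bcc G c o) (acc G c o) + eC G c (bcc G c o) (bcc G c o) := by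
    rw [eC_union_left hd, eC_union_right hd, eC_union_right hd, eC_comm (C := acc G c o)
      (D := bcc G c o)]
    ring
  rw [eC] at h3
  omega

theorem eC_singleton : eC G c {W} C = ∑ v ∈ cls c W, dg G v (un c C) := by
  rw [eC, un_singleton]

theorem IsAtomic.Q_eq_empty (h : Ctx G r s x c o) (hm : Movable G c o W v)
    (hW : W ∈ acc G c o) (hat : ∀ Y ∈ bcc G c o, ∃ S, IsAtomic G c o S ∧ Y ∈ S ∧
      (acc G c o).card < S.card + 2) : Q G c o W v = ∅ :=
  hm.Q_eq_empty h hW fun Y hY => by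
    obtain ⟨S, hS, hYS, hc⟩ := hat Y hY
    exact ⟨S, hc, fun Z hZ => ⟨hS.closed.1 hZ, hS.reach hZ hYS⟩⟩

/-- An accessible class of maximal distance from the small class. -/
theorem exists_term (ha : 2 ≤ (acc G c o).card) : ∃ W, Term G c o W ∧ W ≠ o := by
  obtain ⟨ρ, p, hρ⟩ := exists_rank G c o
  obtain ⟨W₀, hW₀, hW₀o⟩ := exists_mem_acc_ne ha
  obtain ⟨W, hW, hmax⟩ := Finset.exists_max_image ((acc G c o).erase o) ρ
    ⟨W₀, Finset.mem_erase.2 ⟨hW₀o, hW₀⟩⟩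
  rw [Finset.mem_erase] at hW
  refine ⟨W, ⟨hW.2, fun j hj hjW => ?_⟩, hW.1⟩
  by_cases hjo : j = o
  · rw [hjo]
  · refine rank_path hρ hj (Finset.mem_erase.2 ⟨hjW, hj⟩) fun k hk hlt => ?_
    refine Finset.mem_erase.2 ⟨?_, hk⟩
    rintro rfl
    exact absurd (hmax j (Finset.mem_erase.2 ⟨hjo, hj⟩)) (by omega)

end ThreeAccessible

section ThreeAccessibleEight
open Relation
variable [Fintype V] {G : SimpleGraph V} {s : ℕ} {x : V} {c : V → Option (Fin 8)} {o : Fin 8}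
  {S T S₁ S₂ : Finset (Fin 8)} {Y : Fin 8} {W W₁ W₂ : Fin 8} {v : V}

theorem Ctx.false_of_three_atomic (h : Ctx G 8 s x c o) (ha : (acc G c o).card = 3)
    (hB : IsAtomic G c o (bcc G c o)) : False := by
  obtain ⟨W, hterm, hWo⟩ := exists_term (G := G) (c := c) (o := o) (by omega)
  have hab := card_acc_add_card_bcc (G := G) (c := c) (o := o)
  have hQ : ∀ v, Movable G c o W v → Q G c o W v = ∅ := fun v hm =>
    IsAtomic.Q_eq_empty h hm hterm.1 fun Y hY => ⟨_, hB, hY, by omega⟩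
  obtain ⟨w, hw⟩ := hterm.arc hWo
  have key : ∀ v ∈ cls c W,
      (Q G c o W v).card + dg G v (un c (bcc G c o)) + (if v = w then 1 else 0) ≤ 10 := by
    intro v hv
    by_cases hm : Movable G c o W v
    · have h1 := h.dg_bcc_le (v := v)
      rw [hQ v hm, Finset.card_empty]
      split_ifs <;> omega
    · have h1 := h.dg_of_not_movable hterm (mem_cls.1 hv) hm
      have h2 := h.card_Q'_inter_atomic hB (hterm.swappable hWo (mem_cls.1 hv) hm)
      rw [Finset.inter_eq_left.2 (Q'_subset.trans Q_subset_un)] at h2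
      have h3 := h.card_Q_le_Q' (W := W) (v := v)
      rw [if_neg (show ¬ v = w from fun hh => hm (hh ▸ hw))]
      omega
  have h1 := h.solo_count_bcc hterm.1
  have h2 := Finset.sum_le_sum key
  rw [Finset.sum_add_distrib, Finset.sum_ite_eq', if_pos (mem_cls.2 hw.1), Finset.sum_const,
    smul_eq_mul, h.card_cls_acc hWo] at h2
  rw [show (bcc G c o).card = 5 by omega] at h1
  omega

/-- The number of vertices of `W` with a solo neighbor. -/
noncomputable def soloCount (G : SimpleGraph V) (c : V → Option (Fin 8)) (o W : Fin 8) : ℕ :=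
  ∑ v ∈ cls c W, if (Q G c o W v).card = 0 then 0 else 1

theorem Ctx.edges_three (h : Ctx G 8 s x c o) (hA : acc G c o = {o, W₁, W₂})
    (h₁ : W₁ ≠ o) (h₂ : W₂ ≠ o) (h₁₂ : W₁ ≠ W₂) (hB : S₁ ∪ S₂ = bcc G c o)
    (hd : Disjoint S₁ S₂) (hS₁ : S₁.card = 3) (hS₂ : S₂.card = 2)
    (hQ₁ : ∀ v ∈ cls c W₁, Free G c v o → Q G c o W₁ v = ∅)
    (hQ₂ : ∀ v ∈ cls c W₂, (Free G c v o ∨ Free G c v W₁) → Q G c o W₂ v = ∅) :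
    eC G c S₁ S₂ + 5 * s + ∑ v ∈ cls c W₁, dg G v (un c (bcc G c o)) +
      ∑ v ∈ cls c W₂, dg G v (un c (bcc G c o)) + soloCount G c o W₁ + 2 * soloCount G c o W₂ <
      24 * s := by
  have h1 := h.edges_total
  have hd1 : Disjoint ({o} : Finset (Fin 8)) {W₁, W₂} := by simp [h₁.symm, h₂.symm]
  have hd2 : Disjoint ({W₁} : Finset (Fin 8)) {W₂} := by simpa using h₁₂
  have hd3 : Disjoint ({o} : Finset (Fin 8)) {W₁} := by simpa using h₁.symm
  have e1 : eC G c (bcc G c o) (acc G c o) = eC G c (bcc G c o) {o} +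
      (∑ v ∈ cls c W₁, dg G v (un c (bcc G c o)) + ∑ v ∈ cls c W₂, dg G v (un c (bcc G c o))) := by
    rw [hA, Finset.insert_eq o, eC_union_right hd1, Finset.insert_eq W₁, eC_union_right hd2,
      eC_comm (D := {W₁}), eC_comm (D := {W₂}), eC_singleton, eC_singleton]
  have e2 : 5 * s ≤ eC G c (bcc G c o) {o} := by
    have := h.eC_ge_of_acc (C := bcc G c o) (D := {o}) subset_rfl (by simp [ReflTransGen.refl])
    rw [← hB, Finset.card_union_of_disjoint hd, hS₁, hS₂, Finset.card_singleton] at this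
    rw [← hB]
    omega
  have e3 : 2 * eC G c S₁ S₂ ≤ eC G c (bcc G c o) (bcc G c o) := by
    rw [← hB, eC_union_left hd, eC_union_right hd, eC_union_right hd, eC_comm (C := S₂) (D := S₁)]
    omega
  have e4 : 2 * (eC G c {W₁} {o} + eC G c {W₂} {o, W₁}) ≤ eC G c (acc G c o) (acc G c o) := by
    rw [hA, Finset.insert_eq o {W₁, W₂}, eC_union_left hd1, eC_union_right hd1, eC_union_right hd1,
      Finset.insert_eq W₁ {W₂}, eC_union_left hd2, eC_union_right hd2, eC_union_left hd2,
      eC_union_right hd2, eC_union_right hd2, Finset.insert_eq o {W₁}, eC_union_right hd3,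
      eC_comm (C := {o}) (D := {W₁}), eC_comm (C := {o}) (D := {W₂}),
      eC_comm (C := {W₁}) (D := {W₂})]
    omega
  have e5 : soloCount G c o W₁ ≤ eC G c {W₁} {o} := by
    rw [eC_singleton]
    refine Finset.sum_le_sum fun v hv => ?_
    rw [un_singleton]
    split_ifs with h0
    · omega
    · by_contra hh
      exact h0 (by rw [hQ₁ v hv (dg_cls_eq_zero.1 (by omega))]; rfl)
  have e6 : 2 * soloCount G c o W₂ ≤ eC G c {W₂} {o, W₁} := by
    rw [eC_singleton, soloCount, Finset.mul_sum]
    refine Finset.sum_le_sum fun v hv => ?_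
    rw [dg_un, Finset.sum_pair h₁.symm]
    split_ifs with h0
    · omega
    · have : ∀ j, (j = o ∨ j = W₁) → 1 ≤ dg G v (cls c j) := by
        intro j hj
        refine dg_cls_pos.2 fun hf => h0 ?_
        rw [hQ₂ v hv (by rcases hj with rfl | rfl <;> tauto)]
        rfl
      have ho := this o (Or.inl rfl)
      have hW := this W₁ (Or.inr rfl)
      omega
  omega

theorem Ctx.solo_gain_of_star (h : Ctx G 8 s x c o) (ha : (acc G c o).card = 3)
    (hterm : Term G c o W) (hWo : W ≠ o)
    (hQ : ∀ v, Movable G c o W v → Q G c o W v = ∅) (hv : v ∈ cls c W)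
    (hS₁ : IsAtomic G c o S₁) (hS₂ : IsAtomic G c o S₂) (h₁ : S₁.card = 3) (h₂ : S₂.card = 2)
    (hd : Disjoint S₁ S₂) (hB : S₁ ∪ S₂ = bcc G c o) :
    5 * (Q G c o W v).card ≤ 10 * (if (Q G c o W v).card = 0 then 0 else 1) + 10 +
      2 * (starWt G c o W S₁ S₂ v + starWt G c o W S₂ S₁ v) ∧
    (starWt G c o W S₂ S₁ v = 0 → 14 * (Q G c o W v).card + 3 ≤
      28 * (if (Q G c o W v).card = 0 then 0 else 1) + 28 +
      (dg G v (un c S₁) + 5 * starWt G c o W S₁ S₂ v)) := by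
  by_cases hm : Movable G c o W v
  · rw [hQ v hm, Finset.card_empty]
    omega
  have hsw := hterm.swappable hWo (mem_cls.1 hv) hm
  have e1 := dg_split (v := v) hd hB
  have e2 := card_Q'_split (W := W) (v := v) hd hB
  have h1 := h.dg_of_not_movable hterm (mem_cls.1 hv) hm
  have h2 := h.card_Q_le_Q' (W := W) (v := v)
  have h3 := h.card_Q'_inter_atomic hS₁ hsw
  have h4 := h.card_Q'_inter_atomic hS₂ hsw
  have h5 : (Q' G c o W v).card = 0 → (Q G c o W v).card ≤ 3 := fun h0 =>
    h.card_Q_le_three (Finset.card_eq_zero.1 h0)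
  have h6 := card_Q_le (G := G) (c := c) (o := o) (W := W) (v := v)
  have h7 := Ctx.starWt_eq (S₁ := S₁) (S₂ := S₂) hsw
  have h8 := Ctx.starWt_eq (S₁ := S₂) (S₂ := S₁) hsw
  rw [h₁] at h3 h8
  rw [h₂] at h4 h7
  split_ifs <;> omega

theorem Ctx.false_of_three_split (h : Ctx G 8 s x c o) (ha : (acc G c o).card = 3)
    (hS₁ : IsAtomic G c o S₁) (hS₂ : IsAtomic G c o S₂) (h₁ : S₁.card = 3) (h₂ : S₂.card = 2)
    (hd : Disjoint S₁ S₂) (hB : S₁ ∪ S₂ = bcc G c o) : False := by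
  obtain ⟨W₂, hterm, hWo₂⟩ := exists_term (G := G) (c := c) (o := o) (by omega)
  have hQ : ∀ W ∈ acc G c o, ∀ v, Movable G c o W v → Q G c o W v = ∅ := fun W hW v hm =>
    IsAtomic.Q_eq_empty h hm hW fun Y hY => by
      rw [← hB, Finset.mem_union] at hY
      rcases hY with hY | hY
      · exact ⟨_, hS₁, hY, by omega⟩
      · exact ⟨_, hS₂, hY, by omega⟩
  obtain ⟨W₁, hW₁⟩ := Finset.card_eq_one.1 (show (((acc G c o).erase o).erase W₂).card = 1 by
    rw [Finset.card_erase_of_mem (Finset.mem_erase.2 ⟨hWo₂, hterm.1⟩),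
      Finset.card_erase_of_mem self_mem_acc, ha])
  have hmem : W₁ ≠ W₂ ∧ W₁ ≠ o ∧ W₁ ∈ acc G c o := by
    have : W₁ ∈ ((acc G c o).erase o).erase W₂ := by rw [hW₁]; simp
    simpa only [Finset.mem_erase] using this
  obtain ⟨hne, hWo₁, hA₁⟩ := hmem
  have hA : acc G c o = {o, W₁, W₂} := by
    rw [Finset.pair_comm, ← hW₁, Finset.insert_erase (Finset.mem_erase.2 ⟨hWo₂, hterm.1⟩),
      Finset.insert_erase self_mem_acc]
  have hb : (bcc G c o).card = 5 := by rw [← hB, Finset.card_union_of_disjoint hd, h₁, h₂]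
  have hQ₁ : ∀ v ∈ cls c W₁, Free G c v o → Q G c o W₁ v = ∅ := fun v hv hf =>
    hQ W₁ hA₁ v ⟨mem_cls.1 hv, o, self_mem_acc, hWo₁.symm, hf, .refl⟩
  have hQ₂ : ∀ v ∈ cls c W₂, (Free G c v o ∨ Free G c v W₁) → Q G c o W₂ v = ∅ := by
    rintro v hv (hf | hf)
    · exact hQ W₂ hterm.1 v ⟨mem_cls.1 hv, o, self_mem_acc, hWo₂.symm, hf, .refl⟩
    · exact hQ W₂ hterm.1 v ⟨mem_cls.1 hv, W₁, hA₁, hne, hf, hterm.2 W₁ hA₁ hne⟩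
  have hE := h.edges_three hA hWo₁ hWo₂ hne hB hd h₁ h₂ hQ₁ hQ₂
  have hcount₁ : ∑ v ∈ cls c W₁, (Q G c o W₁ v).card ≤ 7 * soloCount G c o W₁ := by
    rw [soloCount, Finset.mul_sum]
    refine Finset.sum_le_sum fun v hv => ?_
    split_ifs with h0
    · omega
    · have h1 := card_Q_le (G := G) (c := c) (o := o) (W := W₁) (v := v)
      have h2 := h.dg_bcc_add_le (v := v) (D := {o}) (by simp [ReflTransGen.refl]) fun j hj => by
        rw [Finset.mem_singleton] at hj
        subst hj
        exact dg_cls_pos.2 fun hf => h0 (by rw [hQ₁ v hv hf]; rfl)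
      rw [Finset.card_singleton] at h2
      omega
  have hs₁ := h.solo_count_bcc hA₁
  have hs₂ := h.solo_count_bcc hterm.1
  rw [Finset.sum_add_distrib, hb] at hs₁ hs₂
  have hge₁ := h.eC_ge_of_acc (C := bcc G c o) (D := {W₁}) subset_rfl (by simpa using mem_acc.1 hA₁)
  rw [eC_comm, eC_singleton, hb, Finset.card_singleton] at hge₁
  have hgain := fun v (hv : v ∈ cls c W₂) =>
    h.solo_gain_of_star ha hterm hWo₂ (hQ W₂ hterm.1) hv hS₁ hS₂ h₁ h₂ hd hB
  have hc := h.card_cls_acc hWo₂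
  have h3 := sum_starWt (G := G) (c := c) (o := o) (W := W₂) (S := S₁) (T := S₂)
  have h4 := sum_starWt (G := G) (c := c) (o := o) (W := W₂) (S := S₂) (T := S₁)
  have hdeg : ∀ C ⊆ bcc G c o, ∀ D ⊆ bcc G c o, ∀ y ∈ un c C, dg G y (un c D) ≤ 5 := by
    intro C hC D hD y hy
    have h6 := h.dg_bcc_acc (un_mono hC hy)
    have h7 := dg_mono (G := G) (v := y) (un_mono (c := c) hD)
    omega
  have hs := h.s_pos
  have hge := h.eC_closed hS₁.closed hS₂.closed.1 hd
  rw [h₁, h₂] at hge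
  by_cases hE₂ : star G c o W₂ S₂ S₁ = ∅
  · rw [hE₂, Finset.card_empty] at h4
    have h5 : ∀ v ∈ cls c W₂, starWt G c o W₂ S₂ S₁ v = 0 :=
      Finset.sum_eq_zero_iff.1 (Nat.le_zero.1 h4)
    have h6 := Finset.sum_le_sum fun v hv => (hgain v hv).2 (h5 v hv)
    simp only [Finset.sum_add_distrib, ← Finset.mul_sum, Finset.sum_const, smul_eq_mul] at h6
    have h7 := h.star_doubling (W := W₂) hS₁ hS₂.closed.1 hd fun i hi j hj => hS₂.reach hi hj
    rw [h₁, h₂] at h7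
    have hsub : star G c o W₂ S₁ S₂ ⊆ un c S₁ := Finset.filter_subset _ _
    have h8 : ∀ y ∈ un c S₁, dg G y (un c S₂) + dg G y (cls c W₂) ≤ 6 := by
      intro y hy
      obtain ⟨j, hj, hyj⟩ := mem_un.1 hy
      have h9 := card_le_dg_un (G := G) (c := c) (C := {o, W₁}) (v := y) fun i hi =>
        dg_acc_pos hyj (hS₁.closed.1 hj) (by
          rw [hA]
          simp only [Finset.mem_insert, Finset.mem_singleton] at hi ⊢
          tauto)
      rw [Finset.card_pair hWo₁.symm] at h9
      have h10 := (dg_mono (Finset.subset_univ (un c (S₂ ∪ ({o, W₁} ∪ {W₂}))))).trans (h.deg y)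
      have hd1 : Disjoint ({o, W₁} : Finset (Fin 8)) {W₂} := by simp [hWo₂, hne.symm]
      have hd2 : Disjoint S₂ ({o, W₁} ∪ {W₂}) := by
        refine acc_disjoint_bcc.symm.mono hS₂.closed.1 ?_
        rw [hA]
        intro i
        simp only [Finset.mem_union, Finset.mem_insert, Finset.mem_singleton]
        tauto
      rw [dg_un_union hd2, dg_un_union hd1, un_singleton] at h10
      omega
    have h9 : ∀ y ∈ star G c o W₂ S₁ S₂, dg G y (cls c W₂) = 1 := by
      intro y hy
      obtain ⟨-, v, -, hyv, -⟩ := Finset.mem_filter.1 hy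
      exact (mem_Q.1 (Q'_subset hyv)).2.2
    have h10 : ∑ y ∈ un c S₁ \ star G c o W₂ S₁ S₂, (dg G y (un c S₂) + dg G y (cls c W₂)) ≤
        (un c S₁ \ star G c o W₂ S₁ S₂).card • 6 :=
      Finset.sum_le_card_nsmul _ _ _ fun y hy => h8 y (Finset.mem_sdiff.1 hy).1
    have h11 := Finset.sum_sdiff hsub (f := fun y => dg G y (un c S₂))
    have h12 := Finset.sum_sdiff hsub (f := fun y => dg G y (cls c W₂))
    rw [Finset.sum_congr (s₁ := star G c o W₂ S₁ S₂) rfl h9, ← Finset.card_eq_sum_ones,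
      sum_dg_comm (un c S₁)] at h12
    rw [Finset.sum_add_distrib, smul_eq_mul] at h10
    have h13 := Finset.card_sdiff_add_card_eq_card hsub
    rw [h.card_un_bcc hS₁.closed.1, h₁] at h13
    rw [eC] at h7 hE hge
    rw [← soloCount] at h6
    omega
  · have h6 := Finset.sum_le_sum fun v hv => (hgain v hv).1
    simp only [Finset.sum_add_distrib, ← Finset.mul_sum, Finset.sum_const, smul_eq_mul] at h6
    rw [← soloCount, hc] at h6
    by_cases hE₁ : star G c o W₂ S₁ S₂ = ∅
    · rw [hE₁, Finset.card_empty] at h3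
      have h7 := h.star_le (W := W₂) hS₂ hS₁ hd.symm (hdeg _ hS₂.closed.1 _ hS₁.closed.1)
      rw [eC_comm (C := S₂), h₁, h₂] at h7
      omega
    · have h9 := h.star_card (W := W₂) hS₁ hS₂.closed.1 hd (fun i hi j hj => hS₂.reach hi hj)
        (h.not_reach_of_star hS₁ hS₂ hE₂)
      have h10 := h.star_card (W := W₂) hS₂ hS₁.closed.1 hd.symm
        (fun i hi j hj => hS₁.reach hi hj) (h.not_reach_of_star hS₂ hS₁ hE₁)
      rw [eC_comm (C := S₂)] at h10
      rw [h₁, h₂] at h9 h10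
      omega

theorem Ctx.card_acc_ne_three (h : Ctx G 8 s x c o) : (acc G c o).card ≠ 3 := by
  intro ha
  have hab := card_acc_add_card_bcc (G := G) (c := c) (o := o)
  obtain ⟨C, hC, h3, hmin⟩ := exists_minimal_closed (G := G) (c := c) (o := o) (by omega)
  have h1 := h.closed_card_cases hC
  have h4 := Finset.card_sdiff_add_card_eq_card hC.1
  by_cases h5 : 5 ≤ C.card
  · have hS := isAtomic_of_minimal hC h5 hmin
    rw [Finset.eq_of_subset_of_card_le hC.1 (by omega)] at hS
    exact h.false_of_three_atomic ha hS
  · have hatom : ∀ D, Closed G c o D → D.card ≤ 3 → D.Nonempty → IsAtomic G c o D := by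
      intro D hD hD3 hDne
      refine hD.isAtomic hDne fun E hE hEne hDE hcard => ?_
      have e1 := Finset.card_pos.2 hEne
      have e2 := Finset.card_pos.2 hDE
      have e3 : ∀ F, Closed G c o F → F.card = 1 → False := by
        intro F hF hF2
        have e4 := h.closed_card_cases (Closed.bcc.sdiff hF)
        have e5 := Finset.card_sdiff_add_card_eq_card hF.1
        omega
      by_cases e6 : E.card = 1
      · exact e3 E hE e6
      · exact e3 _ (hD.sdiff hE) (by omega)
    exact h.false_of_three_split ha (hatom C hC (by omega) (Finset.card_pos.1 (by omega)))
      (hatom _ (Closed.bcc.sdiff hC) (by omega) (Finset.card_pos.1 (by omega))) (by omega)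
      (by omega) Finset.disjoint_sdiff (Finset.union_sdiff_of_subset hC.1)

end ThreeAccessibleEight

section FiveAccessible
open Relation
variable [Fintype V] {G : SimpleGraph V} {r s : ℕ} {x : V} {c : V → Option (Fin r)} {o : Fin r}
  {C D S T : Finset (Fin r)} {W : Fin r} {v : V}

/-- Extending a coloring that misses two vertices. -/
theorem Done.of_two {d : V → Option (Fin r)} {y : V} {Y : Fin r} {K : Finset (Fin r)}
    (hd : Proper G d) (hnone : ∀ u, d u = none ↔ u = x ∨ u = y) (hxy : x ≠ y)
    (hcard : ∀ l, (cls d l).card + (if l = o then 1 else 0) + (if l = Y then 1 else 0) = s)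
    (hYK : Y ∉ K) (hWK : W ∈ K) (hp : ReflTransGen (RelOn (arc G d) K) W o)
    (hyW : Free G d y W) (hxY : Free G d x Y) : Done G r s := by
  obtain ⟨e, he, hen, hout, hin, -, hec⟩ := exists_shift hd hWK hp
  have hYW : Y ≠ W := fun hh => hYK (hh ▸ hWK)
  have hey : e y = none := (hen y).2 ((hnone y).2 (Or.inr rfl))
  have hex : e x = none := (hen x).2 ((hnone x).2 (Or.inl rfl))
  have h1 := he.update (hyW.mono hin)
  have hfx : Free G (Function.update e y (some W)) x Y := by
    refine hxY.mono fun u hu => ?_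
    rw [update_eq_some_of_ne (by simp [hey]) (by simpa using hYW.symm)] at hu
    exact (hout Y hYK u).1 hu
  refine ⟨_, h1.update hfx, fun u => ?_, fun l => ?_⟩
  · by_cases hux : u = x
    · subst hux; simp
    · rw [Function.update_of_ne hux]
      by_cases huy : u = y
      · subst huy; simp
      · rw [Function.update_of_ne huy, ne_eq, hen, hnone]
        tauto
  · have h2 := card_cls_update (c := Function.update e y (some W)) (v := x) (l := l) (some Y)
    have h3 := card_cls_update (c := e) (v := y) (l := l) (some W)
    have h4 := hec l
    have h5 := hcard l
    rw [Function.update_of_ne hxy, hex] at h2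
    rw [hey] at h3
    simp only [Option.some.injEq, eq_comm (a := Y), eq_comm (a := W),
      reduceCtorEq, if_false] at h2 h3
    omega

theorem Ctx.dg_x (h : Ctx G r s x c o) (ha : (acc G c o).card = 5) :
    (∀ j ∈ acc G c o, dg G x (cls c j) = 1) ∧ ∀ j ∈ bcc G c o, Free G c x j := by
  have h1 : ∀ j ∈ acc G c o, 1 ≤ dg G x (cls c j) := fun j hj =>
    dg_cls_pos.2 (h.ae.not_free h.nd (mem_acc.1 hj))
  have h2 := dg_un_union (G := G) (c := c) (v := x) (acc_disjoint_bcc (G := G) (c := c) (o := o))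
  have h3 := (dg_mono (G := G) (v := x)
    (Finset.subset_univ (un c (acc G c o ∪ bcc G c o)))).trans h.degx
  have h4 : dg G x (un c (acc G c o)) = _ := dg_un
  have h5 : dg G x (un c (bcc G c o)) = _ := dg_un
  have h6 : ∑ j ∈ acc G c o, 1 ≤ ∑ j ∈ acc G c o, dg G x (cls c j) := Finset.sum_le_sum h1
  rw [Finset.sum_const, ha, smul_eq_mul, mul_one] at h6
  refine ⟨fun j hj => ?_, fun j hj => ?_⟩
  · by_contra hne
    have : ∑ j ∈ acc G c o, 1 < ∑ j ∈ acc G c o, dg G x (cls c j) :=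
      Finset.sum_lt_sum h1 ⟨j, hj, by have := h1 j hj; omega⟩
    rw [Finset.sum_const, ha, smul_eq_mul, mul_one] at this
    omega
  · have := Finset.single_le_sum (f := fun j => dg G x (cls c j)) (fun _ _ => Nat.zero_le _) hj
    exact dg_cls_eq_zero.1 (by omega)

theorem Ctx.no_solo_of_movable (h : Ctx G r s x c o) (ha : (acc G c o).card = 5) {y : V}
    (hW : W ∈ acc G c o) (hm : Movable G c o W v) : y ∉ Q G c o W v := by
  intro hy
  obtain ⟨hv, U, hU, hUW, hf, hp⟩ := hm
  obtain ⟨⟨Y, hYB, hyY⟩, hvy, hy1⟩ := mem_Q.1 hy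
  have hYW := ne_of_bcc hYB hW
  have hx := h.color_ne hv
  have hprop : Proper G (replace c v y W) := by
    refine h.ae.proper.update_none.update fun u hu hyu => ?_
    by_cases huv : u = v
    · subst huv; simp at hu
    · rw [Function.update_of_ne huv] at hu
      exact huv (solo_unique hv hvy hy1 hu hyu)
  have hcl : ∀ Z, Z ≠ W → ∀ u, replace c v y W u = some Z → c u = some Z := fun Z hZ u hu =>
    ((replace_class hv hyY hZ u).1 hu).1
  refine h.nd (Done.of_two (o := o) (x := x) (y := v) (Y := Y) (W := U)
    (K := (acc G c o).erase W) hprop (fun u => ?_) hx.symm (fun l => ?_) ?_ ?_ ?_ ?_ ?_)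
  · rw [replace]
    by_cases huy : u = y
    · subst huy; simp [h.color_ne hyY, hvy.ne']
    · rw [Function.update_of_ne huy]
      by_cases huv : u = v
      · subst huv; simp
      · rw [Function.update_of_ne huv, h.ae.none_iff]; simp [huv]
  · have h3 := card_cls_update (c := Function.update c v none) (v := y) (l := l) (some W)
    have h4 := card_cls_update (c := c) (v := v) (l := l) none
    have h5 := h.ae.card l
    rw [Function.update_of_ne hvy.ne', hyY] at h3
    rw [hv] at h4
    simp only [Option.some.injEq, eq_comm (a := W), eq_comm (a := Y),
      reduceCtorEq, if_false] at h3 h4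
    rw [replace]
    omega
  · exact fun hh => mem_bcc.1 hYB (Finset.mem_of_mem_erase hh)
  · exact Finset.mem_erase.2 ⟨hUW, hU⟩
  · refine RelOn.reach_imp (fun i hi j hj hij => ?_) hp
    rw [Finset.mem_erase] at hi hj
    refine arc_mono (fun u hu => (replace_class hv hyY hi.1 u).2 ⟨hu, ?_⟩) (hcl j hj.1) hij
    rintro rfl
    rw [hu] at hyY
    exact ne_of_bcc hYB hi.2 (Option.some.inj hyY).symm
  · exact hf.mono (hcl U hUW)
  · exact ((h.dg_x ha).2 Y hYB).mono (hcl Y hYW)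

/-- A coloring that agrees with `c` on the classes closer to the small class than `W` still
has a path from `W`. -/
theorem path_of_agree {ρ : Fin r → ℕ} {p : Fin r → Fin r}
    (hρ : ∀ j ∈ acc G c o, j ≠ o → p j ∈ acc G c o ∧ arc G c j (p j) ∧ ρ (p j) < ρ j)
    (hW : W ∈ acc G c o) {d : V → Option (Fin r)}
    (hd : ∀ l ∈ acc G c o, ρ l < ρ W → ∀ u, d u = some l ↔ c u = some l)
    (hstep : W ≠ o → arc G d W (p W)) :
    ReflTransGen (RelOn (arc G d) ((acc G c o).filter fun k => ρ k ≤ ρ W)) W o := by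
  by_cases hWo : W = o
  · rw [hWo]
  · obtain ⟨h1, -, h3⟩ := hρ W hW hWo
    refine .head ⟨hstep hWo, by simpa using mem_acc.1 hW,
      Finset.mem_filter.2 ⟨h1, h3.le⟩⟩ ?_
    have := rank_path hρ h1 (K := (acc G c o).filter fun k => ρ k < ρ W)
      (Finset.mem_filter.2 ⟨h1, h3⟩) fun k hk hlt => Finset.mem_filter.2 ⟨hk, hlt.trans h3⟩
    refine RelOn.reach_mono (K := (acc G c o).filter fun k => ρ k < ρ W) (fun k hk => ?_)
      (RelOn.reach_imp (fun i hi j hj hij => ?_) this)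
    · rw [Finset.mem_filter] at hk ⊢
      exact ⟨hk.1, hk.2.le⟩
    · rw [Finset.mem_filter] at hi hj
      exact arc_mono (fun u hu => (hd i hi.1 hi.2 u).2 hu) (fun u hu => (hd j hj.1 hj.2 u).1 hu) hij

/-- `y` is a solo neighbor of `v` and of its neighbors in the classes whose parent is `W`. -/
noncomputable def fineQ (G : SimpleGraph V) (c : V → Option (Fin r)) (o W : Fin r)
    (p : Fin r → Fin r) (v : V) : Finset V :=
  (Q G c o W v).filter fun y => ∀ X ∈ acc G c o, X ≠ o → p X = W → dg G y (cls c X) = 1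

theorem reach_parent {ρ : Fin r → ℕ} {p : Fin r → Fin r}
    (hρ : ∀ j ∈ acc G c o, j ≠ o → p j ∈ acc G c o ∧ arc G c j (p j) ∧ ρ (p j) < ρ j)
    {j : Fin r} (hj : j ∈ acc G c o) (hjW : j ≠ W) :
    ReflTransGen (RelOn (arc G c) ((acc G c o).erase W)) j o ∨
      ∃ X ∈ acc G c o, X ≠ o ∧ p X = W ∧
        ReflTransGen (RelOn (arc G c) ((acc G c o).filter fun k => ρ W < ρ k)) j X := by
  induction hn : ρ j using Nat.strong_induction_on generalizing j with
  | _ n ih =>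
    by_cases hjo : j = o
    · left; rw [hjo]
    · obtain ⟨h1, h2, h3⟩ := hρ j hj hjo
      by_cases hpW : p j = W
      · exact Or.inr ⟨j, hj, hjo, hpW, .refl⟩
      · rcases ih _ (hn ▸ h3) h1 hpW rfl with hp | ⟨X, hX, hXo, hpX, hp⟩
        · exact Or.inl (.head ⟨h2, Finset.mem_erase.2 ⟨hjW, hj⟩, Finset.mem_erase.2 ⟨hpW, h1⟩⟩ hp)
        · refine Or.inr ⟨X, hX, hXo, hpX, ?_⟩
          have hXK : X ∈ (acc G c o).filter fun k => ρ W < ρ k :=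
            Finset.mem_filter.2 ⟨hX, hpX ▸ (hρ X hX hXo).2.2⟩
          have hpj := RelOn.reach_mem hp hXK
          exact .head ⟨h2, Finset.mem_filter.2 ⟨hj, (Finset.mem_filter.1 hpj).2.trans h3⟩, hpj⟩ hp

theorem Ctx.no_fine_of_free (h : Ctx G r s x c o) (ha : (acc G c o).card = 5)
    {ρ : Fin r → ℕ} {p : Fin r → Fin r}
    (hρ : ∀ j ∈ acc G c o, j ≠ o → p j ∈ acc G c o ∧ arc G c j (p j) ∧ ρ (p j) < ρ j)
    (hW : W ∈ acc G c o) {y : V} (hv : c v = some W) (hy : y ∈ fineQ G c o W p v)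
    {U : Fin r} (hU : U ∈ acc G c o) (hUW : U ≠ W) : ¬ Free G c v U := by
  intro hfree
  obtain ⟨hyQ, hfine⟩ := Finset.mem_filter.1 hy
  have hnm : ¬ Movable G c o W v := fun hm => h.no_solo_of_movable ha hW hm hyQ
  rcases reach_parent hρ hU hUW with hp | ⟨X, hX, hXo, hpX, hp⟩
  · exact hnm ⟨hv, U, hU, hUW, hfree, hp⟩
  obtain ⟨⟨Y, hYB, hyY⟩, hvy, hy1⟩ := mem_Q.1 hyQ
  obtain ⟨-, hXW, hρX⟩ := hρ X hX hXo
  rw [hpX] at hXW hρX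
  have hXK : X ∈ (acc G c o).filter fun k => ρ W < ρ k := Finset.mem_filter.2 ⟨hX, hρX⟩
  have hUK := RelOn.reach_mem hp hXK
  obtain ⟨hXneW, u, hu, huW⟩ := hXW
  by_cases hyu : G.Adj u y
  · refine h.no_solo_of_movable ha hX (v := u) (y := y) ⟨hu, W, hW, hXneW.symm, huW, ?_⟩
      (mem_Q.2 ⟨⟨Y, hYB, hyY⟩, hyu, hfine X hX hXo hpX⟩)
    refine rank_path hρ hW (Finset.mem_erase.2 ⟨hXneW.symm, hW⟩) fun k hk hlt =>
      Finset.mem_erase.2 ⟨?_, hk⟩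
    rintro rfl
    omega
  have hWK : W ∉ (acc G c o).filter fun k => ρ W < ρ k := by simp
  have hBK : ∀ Z ∈ bcc G c o, Z ∉ (acc G c o).filter fun k => ρ W < ρ k := fun Z hZ hh =>
    mem_bcc.1 hZ (Finset.mem_filter.1 hh).1
  have hYW := ne_of_bcc hYB hW
  have hYX := ne_of_bcc hYB hX
  have hYU := ne_of_bcc hYB hU
  have huv : u ≠ v := by rintro rfl; rw [hv] at hu; exact hXneW (Option.some.inj hu).symm
  have huy : u ≠ y := by rintro rfl; rw [hyY] at hu; exact hYX (Option.some.inj hu)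
  have hvx := h.color_ne hv
  have hux := h.color_ne hu
  have hyx := h.color_ne hyY
  obtain ⟨d, hd, hdn, hout, hin, hkeep, hdc⟩ := exists_shift h.ae.proper hUK hp
  have hdv : d v = some W := (hout W hWK v).2 hv
  have hdu : d u = some X := hkeep u hu
  have hdy : d y = some Y := (hout Y (hBK Y hYB) y).2 hyY
  set d₂ := Function.update d v (some U) with hd₂
  set d₃ := Function.update d₂ u (some W) with hd₃
  set d₄ := Function.update d₃ y none with hd₄
  have h2v : d₂ v = some U := by simp [hd₂]
  have h2u : d₂ u = some X := by rw [hd₂, Function.update_of_ne huv, hdu]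
  have h3y : d₃ y = some Y := by
    rw [hd₃, Function.update_of_ne huy.symm, hd₂, Function.update_of_ne hvy.ne', hdy]
  have hp2 : Proper G d₂ := hd.update (hfree.mono hin)
  have h2W : ∀ a, d₂ a = some W → a ≠ v ∧ c a = some W := by
    intro a haW
    have hav : a ≠ v := by
      rintro rfl; rw [h2v] at haW; exact hUW (Option.some.inj haW)
    rw [hd₂, Function.update_of_ne hav] at haW
    exact ⟨hav, (hout W hWK a).1 haW⟩
  have hp3 : Proper G d₃ := hp2.update (huW.mono fun a ha => (h2W a ha).2)
  have hp4 : Proper G d₄ := hp3.update_none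
  have h4W : ∀ a, d₄ a = some W → a = u ∨ (a ≠ v ∧ c a = some W) := by
    intro a haW
    by_cases hau : a = u
    · exact Or.inl hau
    · have hay : a ≠ y := by rintro rfl; simp [hd₄] at haW
      rw [hd₄, Function.update_of_ne hay, hd₃, Function.update_of_ne hau] at haW
      exact Or.inr (h2W a haW)
  have h4ne : ∀ a, a ≠ y → a ≠ u → a ≠ v → d₄ a = d a := fun a h1 h2 h3 => by
    rw [hd₄, Function.update_of_ne h1, hd₃, Function.update_of_ne h2, hd₂,
      Function.update_of_ne h3]
  have h4cl : ∀ l, l ∉ ((acc G c o).filter fun k => ρ W < ρ k) → l ≠ W → ∀ a,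
      (d₄ a = some l ↔ c a = some l ∧ a ≠ y) := by
    intro l hl hlW a
    by_cases hay : a = y
    · subst hay; simp [hd₄]
    by_cases hau : a = u
    · subst hau
      have hXl : X ≠ l := fun hh => hl (hh ▸ hXK)
      rw [hd₄, Function.update_of_ne hay, hd₃, Function.update_self, hu]
      simp [hlW.symm, hXl]
    by_cases hav : a = v
    · subst hav
      have hUl : U ≠ l := fun hh => hl (hh ▸ hUK)
      rw [hd₄, Function.update_of_ne hay, hd₃, Function.update_of_ne hau, h2v, hv]
      simp [hlW.symm, hUl]
    · rw [h4ne a hay hau hav, hout l hl]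
      simp [hay]
  have h4A : ∀ l ∈ acc G c o, ρ l < ρ W → ∀ a, d₄ a = some l ↔ c a = some l := by
    intro l hl hlt a
    rw [h4cl l (by simp [hlt.le]) (by rintro rfl; omega), and_iff_left_iff_imp]
    rintro hal rfl
    rw [hal] at hyY
    exact ne_of_bcc hYB hl (Option.some.inj hyY).symm
  refine h.nd (Done.of_two (o := o) (x := x) (y := y) (Y := Y) (W := W) hp4 (fun a => ?_) hyx.symm
    (fun l => ?_) ?_ ?_ (path_of_agree hρ hW h4A fun hWo => ?_) ?_ ?_)
  · by_cases hay : a = y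
    · subst hay; simp [hd₄]
    by_cases hau : a = u
    · subst hau; simp [hd₄, hd₃, hay, hux]
    by_cases hav : a = v
    · subst hav; simp [hd₄, hd₃, hd₂, hay, hau, hvx]
    · rw [h4ne a hay hau hav, hdn, h.ae.none_iff]
      simp [hay]
  · have e1 := card_cls_update (c := d₃) (v := y) (l := l) none
    have e2 := card_cls_update (c := d₂) (v := u) (l := l) (some W)
    have e3 := card_cls_update (c := d) (v := v) (l := l) (some U)
    have e4 := hdc l
    have e5 := h.ae.card l
    rw [← hd₄, h3y] at e1
    rw [← hd₃, h2u] at e2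
    rw [← hd₂, hdv] at e3
    simp only [Option.some.injEq, eq_comm (a := W), eq_comm (a := Y), eq_comm (a := X),
      eq_comm (a := U), reduceCtorEq, if_false] at e1 e2 e3
    omega
  · exact fun hh => mem_bcc.1 hYB (Finset.mem_filter.1 hh).1
  · simpa using mem_acc.1 hW
  · obtain ⟨h1, ⟨h2, w, hw, hwf⟩, h3⟩ := hρ W hW hWo
    have hwv : w ≠ v := by
      rintro rfl
      refine hnm ⟨hv, p W, h1, h2.symm, hwf, rank_path hρ h1 (Finset.mem_erase.2 ⟨h2.symm, h1⟩)
        fun k hk hlt => Finset.mem_erase.2 ⟨?_, hk⟩⟩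
      rintro rfl
      omega
    have hwu : w ≠ u := by
      rintro rfl; rw [hu] at hw; exact hXneW (Option.some.inj hw)
    have hwy : w ≠ y := by
      rintro rfl; rw [hyY] at hw; exact hYW (Option.some.inj hw)
    exact ⟨h2, w, by rw [h4ne w hwy hwu hwv, hout W hWK, hw],
      hwf.mono fun a => (h4A _ h1 h3 a).1⟩
  · intro a haW hya
    rcases h4W a haW with rfl | ⟨hav, haW⟩
    · exact hyu hya.symm
    · exact hav (solo_unique hv hvy hy1 haW hya)
  · exact ((h.dg_x ha).2 Y hYB).mono fun a hal => ((h4cl Y (hBK Y hYB) hYW a).1 hal).1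

/-- `v` has neighbors in all other accessible classes. -/
def HitsAcc (G : SimpleGraph V) (c : V → Option (Fin r)) (o W : Fin r) (v : V) : Prop :=
  c v = some W ∧ W ∈ acc G c o ∧ ∀ U ∈ acc G c o, U ≠ W → ¬ Free G c v U

theorem Ctx.false_of_agree (h : Ctx G r s x c o) (hv : HitsAcc G c o W v) {y y' : V}
    {d : V → Option (Fin r)} {Y : Fin r} (hd : Proper G d)
    (hnone : ∀ u, d u = none ↔ u = x ∨ u = y') (hxy : x ≠ y')
    (hcard : ∀ l, (cls d l).card + (if l = o then 1 else 0) + (if l = Y then 1 else 0) = s)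
    (hYB : Y ∈ bcc G c o) (hdA : ∀ l ∈ acc G c o, l ≠ W → ∀ u, d u = some l ↔ c u = some l)
    (hdW : ∀ u, d u = some W ↔ u = y ∨ (u ≠ v ∧ c u = some W))
    (hyQ' : y' ∈ Q G c o W v) (hyy : ¬ G.Adj y y') (hxY : Free G d x Y) : False := by
  obtain ⟨hcv, hW, hhit⟩ := hv
  obtain ⟨-, hvy, hy1⟩ := mem_Q.1 hyQ'
  obtain ⟨ρ, p, hρ⟩ := exists_rank G c o
  refine h.nd (Done.of_two (o := o) hd hnone hxy hcard (W := W) ?_ ?_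
    (path_of_agree hρ hW (fun l hl hlt => hdA l hl ?_) fun hWo => ?_) ?_ hxY)
  · exact fun hh => mem_bcc.1 hYB (Finset.mem_filter.1 hh).1
  · simpa using mem_acc.1 hW
  · rintro rfl; omega
  · obtain ⟨h1, ⟨h2, w, hw, hwf⟩, h3⟩ := hρ W hW hWo
    refine ⟨h2, w, (hdW w).2 (Or.inr ⟨?_, hw⟩), hwf.mono fun u => (hdA _ h1 h2.symm u).1⟩
    rintro rfl
    exact hhit _ h1 h2.symm hwf
  · intro u hu hyu
    rcases (hdW u).1 hu with rfl | ⟨huv, hu⟩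
    · exact hyy hyu.symm
    · exact huv (solo_unique hcv hvy hy1 hu hyu)

theorem Ctx.no_swap_of_hits (h : Ctx G r s x c o) (ha : (acc G c o).card = 5)
    (hv : HitsAcc G c o W v) {y y' : V} {Y Z : Fin r}
    (hyQ : y ∈ Q G c o W v) (hyQ' : y' ∈ Q G c o W v) (hne : y' ≠ y)
    (hadj : ¬ G.Adj y y') (hy : c y = some Y) (hZB : Z ∈ bcc G c o)
    (hvZ : Free G (replace c v y W) v Z) :
    ¬ ReflTransGen (RelOn (arc G (replace c v y W)) (bcc G c o)) Z Y := by
  intro hp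
  have hv' := hv
  obtain ⟨hcv, hW, hhit⟩ := hv'
  obtain ⟨⟨Y₁, hYB, hy₁⟩, hvy, hy1⟩ := mem_Q.1 hyQ
  obtain ⟨⟨Y₂, hYB₂, hy₂⟩, hvy₂, hy2⟩ := mem_Q.1 hyQ'
  obtain rfl : Y = Y₁ := by rw [hy] at hy₁; exact Option.some.inj hy₁
  have hWB : W ∉ bcc G c o := fun hh => mem_bcc.1 hh hW
  obtain ⟨d, hd, hout, hdW, hdv⟩ := h.ae.exists_swap hcv hWB hy hYB hvy hy1 hZB hvZ hp
  have hA : ∀ l ∈ acc G c o, l ≠ W → ∀ u, d u = some l ↔ c u = some l := fun l hl hlW =>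
    hout l (fun hh => mem_bcc.1 hh hl) hlW
  obtain ⟨k, hk⟩ : ∃ k, d y' = some k := by
    refine Option.ne_none_iff_exists'.1 fun hh => h.color_ne hy₂ ((hd.none_iff _).1 hh)
  have hnotA : ∀ u Z, c u = some Z → Z ∈ bcc G c o → ∀ l ∈ acc G c o, d u = some l → u = y := by
    intro u Z hu hZ l hl hdu
    by_cases hlW : l = W
    · subst hlW
      rcases (hdW u).1 hdu with hh | hh
      · exact hh
      · rw [hu] at hh
        exact absurd (Option.some.inj hh.2) (ne_of_bcc hZ hl)
    · have := (hA l hl hlW u).1 hdu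
      rw [hu] at this
      exact absurd (Option.some.inj this) (ne_of_bcc hZ hl)
  have hkB : k ∈ bcc G c o := by
    by_contra hkB
    exact hne (hnotA y' Y₂ hy₂ hYB₂ k (by simpa using hkB) hk)
  have hkW := ne_of_bcc hkB hW
  have hx := h.dg_x ha
  by_cases hxv : G.Adj x v
  · obtain ⟨ρ, p, hρ⟩ := exists_rank G c o
    refine hd.not_free h.nd (RelOn.reach_forget (path_of_agree hρ hW
      (fun l hl hlt => hA l hl ?_) fun hWo => ?_)) (j := W) fun u hu hxu => ?_
    · rintro rfl; omega
    · obtain ⟨h1, ⟨h2, w, hw, hwf⟩, h3⟩ := hρ W hW hWo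
      refine ⟨h2, w, (hdW w).2 (Or.inr ⟨?_, hw⟩), hwf.mono fun u => (hA _ h1 h2.symm u).1⟩
      rintro rfl
      exact hhit _ h1 h2.symm hwf
    · rcases (hdW u).1 hu with rfl | ⟨huv, hu⟩
      · exact hx.2 Y hYB u hy hxu
      · exact huv ((dg_eq_one_iff (mem_cls.2 hcv) hxv).1 (hx.1 W hW) u (mem_cls.2 hu) hxu)
  · have hy'x := h.color_ne hy₂
    have hcl : ∀ l, l ≠ k → ∀ u, (Function.update d y' none u = some l ↔ d u = some l) :=
      fun l hl u => update_eq_some_of_ne (by rw [hk]; simpa using hl.symm) (by simp)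
    refine h.false_of_agree hv (y := y) (y' := y') (d := Function.update d y' none) (Y := k)
      hd.proper.update_none (fun u => ?_) hy'x.symm (fun l => ?_) hkB
      (fun l hl hlW u => ?_) (fun u => ?_) hyQ' hadj fun u hu hxu => ?_
    · by_cases huy : u = y'
      · subst huy; simp
      · rw [Function.update_of_ne huy, hd.none_iff]; simp [huy]
    · have h1 := card_cls_update (c := d) (v := y') (l := l) none
      have h2 := hd.card l
      rw [hk] at h1
      simp only [Option.some.injEq, eq_comm (a := k), reduceCtorEq, if_false] at h1
      omega
    · rw [hcl l (ne_of_bcc hkB hl).symm, hA l hl hlW]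
    · rw [hcl W hkW.symm, hdW]
    · have huy' : u ≠ y' := by rintro rfl; simp at hu
      rw [Function.update_of_ne huy'] at hu
      have huv : u ≠ v := by rintro rfl; exact hxv hxu
      obtain ⟨m, hm⟩ : ∃ m, c u = some m := by
        refine Option.ne_none_iff_exists'.1 fun hh => ?_
        rw [(h.ae.none_iff u).1 hh] at hxu
        exact hxu.ne rfl
      by_cases hmB : m ∈ bcc G c o
      · exact hx.2 m hmB u hm hxu
      · have hmA : m ∈ acc G c o := by simpa using hmB
        have hdm : d u = some m := by
          by_cases hmW : m = W
          · subst hmW; exact (hdW u).2 (Or.inr ⟨huv, hm⟩)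
          · exact (hA m hmA hmW u).2 hm
        rw [hu] at hdm
        exact ne_of_bcc hkB hmA (Option.some.inj hdm)

theorem Ctx.dg_bcc_le_four {c : V → Option (Fin 8)} {o W : Fin 8} (h : Ctx G 8 s x c o)
    (ha : (acc G c o).card = 5) (hv : HitsAcc G c o W v) :
    dg G v (un c (bcc G c o)) + (if G.Adj x v then 1 else 0) ≤ 4 := by
  obtain ⟨hcv, hW, hhit⟩ := hv
  have h1 : (((acc G c o).erase W)).card ≤ dg G v (un c ((acc G c o).erase W)) :=
    card_le_dg_un fun j hj => dg_cls_pos.2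
      (hhit j (Finset.mem_of_mem_erase hj) (Finset.ne_of_mem_erase hj))
  rw [Finset.card_erase_of_mem hW, ha] at h1
  have hdj : Disjoint ((acc G c o).erase W) (bcc G c o) :=
    acc_disjoint_bcc.mono_left (Finset.erase_subset _ _)
  have h2 := dg_un_union (G := G) (c := c) (v := v) hdj
  have h3 := h.deg v
  have hxn : x ∉ un c ((acc G c o).erase W ∪ bcc G c o) := fun hh => by
    obtain ⟨j, -, hj⟩ := mem_un.1 hh
    exact h.color_ne hj rfl
  split_ifs with hxv
  · have h4 : dg G v (insert x (un c ((acc G c o).erase W ∪ bcc G c o))) ≤ _ :=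
      dg_mono (Finset.subset_univ _)
    have h5 := dg_erase_of_adj (G := G) (v := v) (u := x)
      (X := insert x (un c ((acc G c o).erase W ∪ bcc G c o))) (by simp) hxv.symm
    rw [Finset.erase_insert hxn] at h5
    omega
  · have h4 : dg G v (un c ((acc G c o).erase W ∪ bcc G c o)) ≤ _ :=
      dg_mono (Finset.subset_univ _)
    omega

end FiveAccessible

section FiveAccessible
open Relation
variable [Fintype V] {G : SimpleGraph V} {s : ℕ} {x : V} {c : V → Option (Fin 8)} {o : Fin 8}
  {C D S T : Finset (Fin 8)} {W : Fin 8} {v : V}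

theorem Ctx.solo_adj (h : Ctx G 8 s x c o) (ha : (acc G c o).card = 5)
    (hat : IsAtomic G c o (bcc G c o)) (hv : HitsAcc G c o W v) {y y' : V}
    (hyQ : y ∈ Q G c o W v) (hyQ' : y' ∈ Q G c o W v) (hne : y' ≠ y) : G.Adj y y' := by
  by_contra hadj
  have hv' := hv
  obtain ⟨hcv, hW, hhit⟩ := hv'
  have hb := card_acc_add_card_bcc (G := G) (c := c) (o := o)
  obtain ⟨⟨Y, hYB, hy⟩, hvy, hy1⟩ := mem_Q.1 hyQ
  obtain ⟨⟨Y', hYB', hy'⟩, hvy', hy1'⟩ := mem_Q.1 hyQ'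
  have hpos : ∀ Z ∈ bcc G c o, 1 ≤ dg G v (cls c Z) := by
    intro Z hZ
    by_contra! h0
    refine h.no_swap_of_hits ha hv hyQ hyQ' hne hadj hy hZ ?_
      (reach_replace hcv hW hy hZ (reach_source_ne (hat.reach hZ hYB)))
    exact (dg_cls_eq_zero.1 (by omega)).mono fun u hu =>
      ((replace_class hcv hy (ne_of_bcc hZ hW) u).1 hu).1
  have htwo : 2 ≤ dg G v (cls c Y) := by
    by_contra! hlt
    exact h.no_swap_of_hits ha hv hyQ hyQ' hne hadj hy hYB
      (free_replace hcv (ne_of_bcc hYB hW) hy hvy (by omega)) .refl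
  have htwo' : 2 ≤ dg G v (cls c Y') := by
    by_contra! hlt
    exact h.no_swap_of_hits ha hv hyQ' hyQ hne.symm (fun hh => hadj hh.symm) hy' hYB'
      (free_replace hcv (ne_of_bcc hYB' hW) hy' hvy' (by omega)) .refl
  have h4 := h.dg_bcc_le_four ha hv
  rw [dg_un, ← Finset.add_sum_erase _ _ hYB] at h4
  have h5 : ∑ Z ∈ (bcc G c o).erase Y, 1 ≤ ∑ Z ∈ (bcc G c o).erase Y, dg G v (cls c Z) :=
    Finset.sum_le_sum fun Z hZ => hpos Z (Finset.mem_of_mem_erase hZ)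
  rw [Finset.sum_const, Finset.card_erase_of_mem hYB, smul_eq_mul, mul_one] at h5
  have hYY : Y' = Y := by
    by_contra hYY
    have : ∑ Z ∈ (bcc G c o).erase Y, 1 < ∑ Z ∈ (bcc G c o).erase Y, dg G v (cls c Z) :=
      Finset.sum_lt_sum (fun Z hZ => hpos Z (Finset.mem_of_mem_erase hZ))
        ⟨Y', Finset.mem_erase.2 ⟨hYY, hYB'⟩, by omega⟩
    rw [Finset.sum_const, Finset.card_erase_of_mem hYB, smul_eq_mul, mul_one] at this
    omega
  subst hYY
  have hxv : ¬ G.Adj x v := by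
    intro hxv
    rw [if_pos hxv] at h4
    omega
  have hd2 : dg G v (cls c Y') = 2 := by omega
  have hYW := ne_of_bcc hYB hW
  have honly : ∀ u, c u = some Y' → G.Adj v u → u = y ∨ u = y' := by
    intro u hu hvu
    by_contra! hcon
    have hsub : ({u, y, y'} : Finset V) ⊆ (cls c Y').filter (G.Adj v) := by
      intro a ha
      simp only [Finset.mem_insert, Finset.mem_singleton] at ha
      rw [Finset.mem_filter, mem_cls]
      rcases ha with rfl | rfl | rfl
      exacts [⟨hu, hvu⟩, ⟨hy, hvy⟩, ⟨hy', hvy'⟩]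
    have := Finset.card_le_card hsub
    rw [Finset.card_insert_of_notMem (by simp [hcon.1, hcon.2]), Finset.card_pair hne.symm] at this
    rw [dg] at hd2
    omega
  have hvx := h.color_ne hcv
  have hyx := h.color_ne hy
  have hy'x := h.color_ne hy'
  set e := Function.update (replace c v y W) y' none with he
  have hev : e v = none := by
    rw [he, Function.update_of_ne hvy'.ne, replace, Function.update_of_ne hvy.ne,
      Function.update_self]
  have hey' : replace c v y W y' = some Y' := by
    rw [replace, Function.update_of_ne hne, Function.update_of_ne hvy'.ne', hy']
  have hrep : Proper G (replace c v y W) := by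
    refine h.ae.proper.update_none.update fun u hu hyu => ?_
    by_cases huv : u = v
    · subst huv; simp at hu
    · rw [Function.update_of_ne huv] at hu
      exact huv (solo_unique hcv hvy hy1 hu hyu)
  have heY : ∀ u, e u = some Y' → c u = some Y' ∧ u ≠ y ∧ u ≠ y' := by
    intro u hu
    have huy' : u ≠ y' := by rintro rfl; simp [he] at hu
    rw [he, Function.update_of_ne huy', replace_class hcv hy hYW] at hu
    exact ⟨hu.1, hu.2, huy'⟩
  have hecl : ∀ l, l ≠ Y' → ∀ u, (e u = some l ↔ replace c v y W u = some l) := fun l hl u =>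
    update_eq_some_of_ne (by rw [hey']; simpa using hl.symm) (by simp)
  have hdcl : ∀ l, l ≠ Y' → ∀ u, (Function.update e v (some Y') u = some l ↔
      replace c v y W u = some l) := fun l hl u => by
    rw [update_eq_some_of_ne (by simp [hev]) (by simpa using hl.symm), hecl l hl]
  refine h.false_of_agree hv (y := y) (y' := y') (d := Function.update e v (some Y')) (Y := Y')
    (hrep.update_none.update fun u hu hvu => ?_) (fun u => ?_) hy'x.symm (fun l => ?_) hYB
    (fun l hl hlW u => ?_) (fun u => ?_) hyQ' hadj fun u hu hxu => ?_
  · obtain ⟨h1, h2, h3⟩ := heY u hu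
    rcases honly u h1 hvu with rfl | rfl
    exacts [h2 rfl, h3 rfl]
  · by_cases huv : u = v
    · subst huv; simp [hvx, hvy'.ne]
    by_cases huy' : u = y'
    · subst huy'; rw [Function.update_of_ne huv, he]; simp
    · rw [Function.update_of_ne huv, he, Function.update_of_ne huy', replace]
      by_cases huy : u = y
      · subst huy; simp [hyx, huy']
      · rw [Function.update_of_ne huy, Function.update_of_ne huv, h.ae.none_iff]
        simp [huy']
  · have e1 := card_cls_update (c := e) (v := v) (l := l) (some Y')
    have e2 := card_cls_update (c := replace c v y W) (v := y') (l := l) none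
    have e3 := card_cls_update (c := Function.update c v none) (v := y) (l := l) (some W)
    have e4 := card_cls_update (c := c) (v := v) (l := l) none
    have e5 := h.ae.card l
    rw [hev] at e1
    rw [← he, hey'] at e2
    rw [Function.update_of_ne hvy.ne', hy] at e3
    rw [hcv] at e4
    simp only [Option.some.injEq, eq_comm (a := W), eq_comm (a := Y'),
      reduceCtorEq, if_false] at e1 e2 e3 e4
    rw [replace] at e2
    omega
  · have hlY := (ne_of_bcc hYB hl).symm
    rw [hdcl l hlY, replace_class hcv hy hlW, and_iff_left_iff_imp]
    rintro hu rfl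
    rw [hy] at hu
    exact hlY (Option.some.inj hu).symm
  · rw [hdcl W hYW.symm, replace_class_self hvy.ne']
  · have huv : u ≠ v := by rintro rfl; exact hxv hxu
    rw [Function.update_of_ne huv] at hu
    exact (h.dg_x ha).2 Y' hYB u (heY u hu).1 hxu

theorem Ctx.card_Q_le_three_of_hits (h : Ctx G 8 s x c o) (ha : (acc G c o).card = 5)
    (hat : IsAtomic G c o (bcc G c o)) (hv : HitsAcc G c o W v) : (Q G c o W v).card ≤ 3 := by
  refine h.card_Q_le_three (Finset.eq_empty_of_forall_notMem fun y hy => ?_)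
  obtain ⟨hyQ, y', hyQ', hne, hadj⟩ := mem_Q'.1 hy
  exact hadj (h.solo_adj ha hat hv hyQ hyQ' hne)

theorem sum_card_fineQ (p : Fin 8 → Fin 8) :
    ∑ W ∈ acc G c o, ∑ v ∈ cls c W, (fineQ G c o W p v).card =
      ∑ y ∈ un c (bcc G c o), ((acc G c o).filter fun W => dg G y (cls c W) = 1 ∧
        ∀ X ∈ acc G c o, X ≠ o → p X = W → dg G y (cls c X) = 1).card := by
  have hf : ∀ y, ((acc G c o).filter fun W => dg G y (cls c W) = 1 ∧
        ∀ X ∈ acc G c o, X ≠ o → p X = W → dg G y (cls c X) = 1).card = _ := fun y =>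
    Finset.card_filter _ _
  rw [Finset.sum_congr rfl fun y _ => hf y, Finset.sum_comm]
  refine Finset.sum_congr rfl fun W hW => ?_
  have := sum_card_Q_inter (G := G) (c := c) (o := o) (W := W)
    (Finset.univ.filter fun y => ∀ X ∈ acc G c o, X ≠ o → p X = W → dg G y (cls c X) = 1)
  simp only [Finset.inter_filter, Finset.inter_univ] at this
  rw [Finset.filter_filter, Finset.card_filter] at this
  exact this

theorem card_fine_add (p : Fin 8 → Fin 8) {y : V} (hy : y ∈ un c (bcc G c o)) :
    (acc G c o).card ≤ ((acc G c o).filter fun W => dg G y (cls c W) = 1 ∧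
        ∀ X ∈ acc G c o, X ≠ o → p X = W → dg G y (cls c X) = 1).card +
      2 * ((acc G c o).filter fun W => 2 ≤ dg G y (cls c W)).card := by
  set N := (acc G c o).filter fun W => 2 ≤ dg G y (cls c W) with hN
  obtain ⟨j, hj, hyj⟩ := mem_un.1 hy
  have hmem : ∀ W ∈ acc G c o, dg G y (cls c W) ≠ 1 → W ∈ N := fun W hW h1 =>
    Finset.mem_filter.2 ⟨hW, by have := dg_acc_pos hyj hj hW; omega⟩
  have hsub : acc G c o ⊆ ((acc G c o).filter fun W => dg G y (cls c W) = 1 ∧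
        ∀ X ∈ acc G c o, X ≠ o → p X = W → dg G y (cls c X) = 1) ∪ (N ∪ N.image p) := by
    intro W hW
    by_contra hcon
    simp only [Finset.mem_union, not_or, Finset.mem_filter, not_and] at hcon
    obtain ⟨h1, h2, h3⟩ := hcon
    refine h1 hW (by_contra fun h4 => h2 (hmem W hW h4)) fun X hX _ hpX => ?_
    by_contra h4
    exact h3 (Finset.mem_image.2 ⟨X, hmem X hX h4, hpX⟩)
  have h1 := Finset.card_le_card hsub
  have h2 := Finset.card_union_le ((acc G c o).filter fun W => dg G y (cls c W) = 1 ∧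
        ∀ X ∈ acc G c o, X ≠ o → p X = W → dg G y (cls c X) = 1) (N ∪ N.image p)
  have h3 := Finset.card_union_le N (N.image p)
  have h4 := Finset.card_image_le (s := N) (f := p)
  omega

theorem dg_acc_ge {y : V} (hy : y ∈ un c (bcc G c o)) :
    (acc G c o).card + ((acc G c o).filter fun W => 2 ≤ dg G y (cls c W)).card ≤
      dg G y (un c (acc G c o)) := by
  obtain ⟨j, hj, hyj⟩ := mem_un.1 hy
  rw [dg_un, Finset.card_filter, Finset.card_eq_sum_ones, ← Finset.sum_add_distrib]
  refine Finset.sum_le_sum fun W hW => ?_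
  have := dg_acc_pos hyj hj hW
  split_ifs <;> omega

theorem Ctx.four_mul_fine_le (h : Ctx G 8 s x c o) (ha : (acc G c o).card = 5)
    {ρ : Fin 8 → ℕ} {p : Fin 8 → Fin 8}
    (hρ : ∀ j ∈ acc G c o, j ≠ o → p j ∈ acc G c o ∧ arc G c j (p j) ∧ ρ (p j) < ρ j) {k : ℕ}
    (hk : ∀ W v, HitsAcc G c o W v → (Q G c o W v).card ≤ k) :
    4 * ∑ W ∈ acc G c o, ∑ v ∈ cls c W, (fineQ G c o W p v).card ≤
      k * eC G c (acc G c o) (acc G c o) := by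
  rw [eC, sum_un, Finset.mul_sum, Finset.mul_sum]
  refine Finset.sum_le_sum fun W hW => ?_
  rw [Finset.mul_sum, Finset.mul_sum]
  refine Finset.sum_le_sum fun v hv => ?_
  rcases (fineQ G c o W p v).eq_empty_or_nonempty with h0 | ⟨y, hy⟩
  · simp [h0]
  · have hhit : HitsAcc G c o W v := ⟨mem_cls.1 hv, hW, fun U hU hUW =>
      h.no_fine_of_free ha hρ hW (mem_cls.1 hv) hy hU hUW⟩
    have h1 : (fineQ G c o W p v).card ≤ k :=
      (Finset.card_le_card (Finset.filter_subset _ _)).trans (hk W v hhit)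
    have h2 : (((acc G c o).erase W)).card ≤ dg G v (un c ((acc G c o).erase W)) :=
      card_le_dg_un fun j hj => dg_cls_pos.2
        (hhit.2.2 j (Finset.mem_of_mem_erase hj) (Finset.ne_of_mem_erase hj))
    rw [Finset.card_erase_of_mem hW, ha] at h2
    have h3 : dg G v (un c ((acc G c o).erase W)) ≤ dg G v (un c (acc G c o)) :=
      dg_mono (un_mono (Finset.erase_subset _ _))
    have h4 : 4 ≤ dg G v (un c (acc G c o)) := by omega
    calc 4 * _ ≤ 4 * k := by omega
      _ = k * 4 := mul_comm _ _
      _ ≤ _ := Nat.mul_le_mul_left _ h4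

theorem Ctx.eC_bcc_of_not_atomic (h : Ctx G 8 s x c o) (hb : (bcc G c o).card = 3)
    (hat : ¬ IsAtomic G c o (bcc G c o)) : 4 * s ≤ eC G c (bcc G c o) (bcc G c o) := by
  by_contra hlt
  refine hat (Closed.bcc.isAtomic (Finset.card_pos.1 (by omega)) fun D hD hne hne' hc => hlt ?_)
  have hdis : Disjoint D (bcc G c o \ D) := Finset.disjoint_sdiff
  have h1 := h.eC_closed hD (D := bcc G c o \ D) Finset.sdiff_subset hdis
  have h2 : eC G c (bcc G c o) (bcc G c o) = eC G c (D ∪ bcc G c o \ D) (D ∪ bcc G c o \ D) := by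
    rw [Finset.union_sdiff_of_subset hD.1]
  rw [eC_union_left hdis, eC_union_right hdis, eC_union_right hdis,
    eC_comm (C := bcc G c o \ D) (D := D)] at h2
  have h3 := Finset.card_pos.2 hne
  have h4 := Finset.card_pos.2 hne'
  have h5 : D.card * (bcc G c o \ D).card = 2 := by
    have : D.card = 1 ∨ D.card = 2 := by omega
    rcases this with h6 | h6
    · rw [h6]; omega
    · rw [h6]; omega
  rw [h5] at h1
  omega

theorem Ctx.card_acc_ne_five (h : Ctx G 8 s x c o) : (acc G c o).card ≠ 5 := by
  intro ha
  have hab := card_acc_add_card_bcc (G := G) (c := c) (o := o)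
  have hb : (bcc G c o).card = 3 := by omega
  obtain ⟨ρ, p, hρ⟩ := exists_rank G c o
  have hn := h.card_un_bcc subset_rfl
  rw [hb] at hn
  have h1 : ∑ y ∈ un c (bcc G c o), (acc G c o).card ≤ _ :=
    Finset.sum_le_sum fun y hy => card_fine_add p hy
  rw [Finset.sum_add_distrib, ← Finset.mul_sum, ← sum_card_fineQ] at h1
  have h2 : _ ≤ eC G c (bcc G c o) (acc G c o) :=
    Finset.sum_le_sum fun y hy => dg_acc_ge (G := G) (c := c) (o := o) hy
  rw [Finset.sum_add_distrib] at h2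
  rw [Finset.sum_const, smul_eq_mul, ha, hn] at h1 h2
  have h3 := h.edges_total
  by_cases hat : IsAtomic G c o (bcc G c o)
  · have h4 := h.four_mul_fine_le ha hρ fun W v hv => h.card_Q_le_three_of_hits ha hat hv
    have h5 := h.eC_le (C := bcc G c o) (D := acc G c o) acc_disjoint_bcc.symm (by omega)
    rw [ha, hb] at h5
    omega
  · have h4 := h.four_mul_fine_le ha hρ (k := 4) fun W v hv =>
      card_Q_le.trans (le_trans (Nat.le_add_right _ _) (h.dg_bcc_le_four ha hv))
    have h5 := h.eC_bcc_of_not_atomic hb hat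
    omega

end FiveAccessible

theorem Ctx.false [Fintype V] {G : SimpleGraph V} {r s : ℕ} {x : V} {c : V → Option (Fin r)}
    {o : Fin r} (h : Ctx G r s x c o) : False := by
  have hab := card_acc_add_card_bcc (G := G) (c := c) (o := o)
  have h1 := h.card_acc_le
  have h2 := h.card_acc_ne_one
  have h3 := h.card_acc_ne_two
  have h4 : 0 < (acc G c o).card := Finset.card_pos.2 ⟨o, self_mem_acc⟩
  have h5 := h.closed_card Closed.bcc (m := (acc G c o).card) (by omega)
  have hr := h.hr
  have h6 : r = 8 := by
    have : (bcc G c o).card = r - (acc G c o).card := by omega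
    rw [this] at h5
    obtain ⟨k, rfl⟩ : ∃ k, r = k + 8 := ⟨r - 8, by omega⟩
    generalize (acc G c o).card = a at *
    have : a = 3 ∨ a = 4 ∨ a = 5 := by omega
    rcases this with rfl | rfl | rfl <;> omega
  subst h6
  have h7 := h.card_acc_ne_three
  have h8 := h.card_acc_ne_five
  have h9 : (acc G c o).card = 4 := by omega
  rw [h9] at h5
  omega

section Reductions
variable {G H : SimpleGraph V} {r s p : ℕ} {X Y S : Finset V} {v : V}

theorem sum_dg_eq : ∑ u ∈ X, dg G u Y = ((X ×ˢ Y).filter fun e => G.Adj e.1 e.2).card := by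
  rw [Finset.card_filter, Finset.sum_product]
  exact Finset.sum_congr rfl fun u _ => Finset.card_filter _ _

theorem sum_dg_le_edgesBetween [Fintype V] (h : Disjoint X Y) :
    ∑ u ∈ X, dg G u Y ≤ edgesBetween G X Y := by
  rw [sum_dg_eq, edgesBetween]
  refine Finset.card_le_card_of_injOn (fun e => s(e.1, e.2)) ?_ ?_
  · rintro ⟨a, b⟩ he
    simp only [Finset.coe_filter, Finset.mem_product, Set.mem_ofPred_eq] at he ⊢
    exact ⟨by simpa using he.2, a, he.1.1, b, he.1.2, rfl⟩
  · rintro ⟨a, b⟩ he ⟨a', b'⟩ he' hee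
    simp only [Finset.coe_filter, Finset.mem_product, Set.mem_ofPred_eq] at he he'
    rcases Sym2.eq_iff.1 hee with ⟨rfl, rfl⟩ | ⟨rfl, rfl⟩
    · rfl
    · exact (Finset.disjoint_left.1 h he.1.1 he'.1.2).elim

theorem sum_dg_le_edgesWithin [Fintype V] : ∑ u ∈ S, dg G u S ≤ 2 * edgesWithin G S := by
  rw [sum_dg_eq, edgesWithin]
  refine (Finset.card_le_mul_card_image (f := fun e : V × V => s(e.1, e.2)) _ 2 ?_).trans
    (Nat.mul_le_mul_left _ (Finset.card_le_card ?_))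
  · intro e _
    induction e using Sym2.ind with
    | _ a b =>
      refine (Finset.card_le_card (t := {(a, b), (b, a)}) ?_).trans Finset.card_le_two
      rintro ⟨a', b'⟩ he
      rcases Sym2.eq_iff.1 (Finset.mem_filter.1 he).2 with ⟨rfl, rfl⟩ | ⟨rfl, rfl⟩ <;> simp
  · intro e he
    obtain ⟨⟨a, b⟩, hab, rfl⟩ := Finset.mem_image.1 he
    simp only [Finset.mem_filter, Finset.mem_product] at hab
    simp only [Finset.mem_filter, SimpleGraph.mem_edgeFinset, SimpleGraph.mem_edgeSet,
      Sym2.mem_iff, forall_eq_or_imp, forall_eq]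
    exact ⟨hab.2, hab.1⟩

theorem PlanarBounds.edgeBounds [Fintype V] (hG : PlanarBounds G) : EdgeBounds G where
  inner S hS := by
    have h1 := hG.1 S hS
    have h2 := sum_dg_le_edgesWithin (G := G) (S := S)
    omega
  cross X Y hXY h3 := by
    have h1 := hG.2 X Y hXY h3
    have h2 := sum_dg_le_edgesBetween (G := G) hXY
    omega

theorem dg_mono_graph (h : H ≤ G) : dg H v X ≤ dg G v X :=
  Finset.card_le_card fun u hu => by
    rw [Finset.mem_filter] at hu ⊢
    exact ⟨hu.1, h hu.2⟩

theorem EdgeBounds.mono (hG : EdgeBounds G) (h : H ≤ G) : EdgeBounds H where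
  inner S hS := by
    have h1 := hG.inner S hS
    have h2 : ∑ u ∈ S, dg H u S ≤ ∑ u ∈ S, dg G u S :=
      Finset.sum_le_sum fun _ _ => dg_mono_graph h
    omega
  cross X Y hXY h3 := by
    have h1 := hG.cross X Y hXY h3
    have h2 : ∑ u ∈ X, dg H u Y ≤ ∑ u ∈ X, dg G u Y :=
      Finset.sum_le_sum fun _ _ => dg_mono_graph h
    omega

theorem dg_lt_card (hv : v ∈ X) : dg G v X < X.card := by
  rw [← dg_erase_of_not_adj (G.irrefl (v := v))]
  exact (dg_le_card).trans_lt (Finset.card_erase_lt_of_mem hv)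

theorem EdgeBounds.exists_dg_le_five (hG : EdgeBounds G) (hX : X.Nonempty) :
    ∃ v ∈ X, dg G v X ≤ 5 := by
  by_contra! hcon
  obtain ⟨v, hv⟩ := hX
  have h1 := hcon v hv
  have h2 := dg_lt_card (G := G) hv
  have h3 := hG.inner X (by omega)
  have h4 : ∑ u ∈ X, 6 ≤ ∑ u ∈ X, dg G u X := Finset.sum_le_sum fun u hu => hcon u hu
  rw [Finset.sum_const, smul_eq_mul] at h4
  omega

/-- The graph in which all edges at `x` are deleted. -/
def isolate (G : SimpleGraph V) (x : V) : SimpleGraph V where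
  Adj a b := G.Adj a b ∧ a ≠ x ∧ b ≠ x
  symm := ⟨fun _ _ h => ⟨h.1.symm, h.2.2, h.2.1⟩⟩
  loopless := ⟨fun _ h => G.irrefl h.1⟩

theorem isolate_le (x : V) : isolate G x ≤ G := fun _ _ h => h.1

variable [Fintype V]

theorem done_of_no_edges (hG : ∀ a b, ¬ G.Adj a b) (hV : Fintype.card V = r * s) :
    Done G r s := by
  let e : V ≃ Fin r × Fin s := Fintype.equivOfCardEq (by simp [hV])
  refine ⟨fun v => some (e v).1, fun u v j h => (hG u v h).elim, by simp, fun j => ?_⟩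
  have h1 : (cls (fun v => some (e v).1) j).map e.toEmbedding =
      ({j} : Finset (Fin r)) ×ˢ (Finset.univ : Finset (Fin s)) := by
    ext ⟨a, b⟩
    simp [Finset.mem_map_equiv, eq_comm]
  have h2 := congrArg Finset.card h1
  rw [Finset.card_map, Finset.card_product] at h2
  simpa using h2

theorem AE.exists_ctx {x : V} {c : V → Option (Fin r)} {o : Fin r} (h : AE G x s c o)
    (hG : EdgeBounds G) (hdeg : ∀ v, dg G v Finset.univ ≤ r) (hr : 8 ≤ r)
    (hx : dg G x Finset.univ ≤ 5) (hnd : ¬ Done G r s) : ∃ c o, Ctx G r s x c o := by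
  obtain ⟨⟨c', o'⟩, hc, hmax⟩ := Finset.exists_max_image
    (Finset.univ.filter fun q : (V → Option (Fin r)) × Fin r => AE G x s q.1 q.2)
    (fun q => (acc G q.1 q.2).card) ⟨(c, o), by simpa using h⟩
  exact ⟨c', o', hG, hdeg, hr, hx, (Finset.mem_filter.1 hc).2, hnd, fun c'' o'' h'' =>
    hmax (c'', o'') (by simpa using h'')⟩

theorem EdgeBounds.done (hG : EdgeBounds G) (hr : 8 ≤ r) (hdeg : ∀ v, dg G v Finset.univ ≤ r)
    (hV : Fintype.card V = r * s) : Done G r s := by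
  induction hn : ∑ v, dg G v Finset.univ using Nat.strong_induction_on generalizing G with
  | _ n ih =>
    by_cases hE : ∀ a b, ¬ G.Adj a b
    · exact done_of_no_edges hE hV
    push Not at hE
    obtain ⟨a, b, hab⟩ := hE
    set S := Finset.univ.filter fun v => 0 < dg G v Finset.univ with hS
    have hmem : ∀ u w, G.Adj u w → w ∈ S := fun u w h =>
      Finset.mem_filter.2 ⟨Finset.mem_univ _, dg_pos (Finset.mem_univ u) h.symm⟩
    obtain ⟨x, hxS, hx⟩ := hG.exists_dg_le_five ⟨b, hmem a b hab⟩
    have hx5 : dg G x Finset.univ ≤ 5 := by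
      refine le_trans (Finset.card_le_card fun u hu => ?_) hx
      rw [Finset.mem_filter] at hu ⊢
      exact ⟨hmem x u hu.2, hu.2⟩
    have hlt : ∑ v, dg (isolate G x) v Finset.univ < n := by
      rw [← hn]
      refine Finset.sum_lt_sum (fun v _ => dg_mono_graph (isolate_le x)) ⟨x, Finset.mem_univ _, ?_⟩
      refine lt_of_eq_of_lt ?_ (Finset.mem_filter.1 hxS).2
      rw [dg, Finset.card_eq_zero, Finset.filter_eq_empty_iff]
      exact fun u _ h => h.2.1 rfl
    obtain ⟨d, hd, hdn, hdc⟩ := ih _ hlt (hG.mono (isolate_le x))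
      (fun v => (dg_mono_graph (isolate_le x)).trans (hdeg v)) rfl
    obtain ⟨o, ho⟩ := Option.ne_none_iff_exists'.1 (hdn x)
    by_contra hnd
    have hae : AE G x s (Function.update d x none) o := by
      refine ⟨fun u v j huv hu hv => ?_, fun v => ?_, fun j => ?_⟩
      · have hux : u ≠ x := by rintro rfl; simp at hu
        have hvx : v ≠ x := by rintro rfl; simp at hv
        rw [Function.update_of_ne hux] at hu
        rw [Function.update_of_ne hvx] at hv
        exact hd u v j ⟨huv, hux, hvx⟩ hu hv
      · by_cases hv : v = x
        · subst hv; simp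
        · rw [Function.update_of_ne hv]; simp [hdn v, hv]
      · have h1 := card_cls_update (c := d) (v := x) (l := j) none
        have h2 := hdc j
        rw [ho] at h1
        simp only [Option.some.injEq, eq_comm (a := o), reduceCtorEq, if_false] at h1
        omega
    obtain ⟨c, o, hctx⟩ := hae.exists_ctx hG hdeg hr hx5 hnd
    exact hctx.false

end Reductions

section Padding
open SimpleGraph
variable {α β : Type*} {G : SimpleGraph V} {K : SimpleGraph α} {L : SimpleGraph β} {r s p : ℕ}

theorem dg_comap (f : α ↪ V) (a : α) (X : Finset α) :
    dg (G.comap f) a X = dg G (f a) (X.map f) := by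
  rw [dg, dg, Finset.filter_map, Finset.card_map]
  rfl

theorem EdgeBounds.comap (hG : EdgeBounds G) (f : α ↪ V) : EdgeBounds (G.comap f) where
  inner S hS := by
    have h := hG.inner (S.map f) (by rwa [Finset.card_map])
    rw [Finset.card_map, Finset.sum_map] at h
    simpa only [dg_comap] using h
  cross X Y hXY h3 := by
    have h := hG.cross (X.map f) (Y.map f) ((Finset.disjoint_map f).2 hXY)
      (by rwa [Finset.card_map, Finset.card_map])
    rw [Finset.card_map, Finset.card_map, Finset.sum_map] at h
    simpa only [dg_comap] using h

theorem dg_sum_inl (a : α) (X : Finset (α ⊕ β)) : dg (K ⊕g L) (.inl a) X = dg K a X.toLeft := by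
  rw [dg, dg, ← Finset.card_map (s := X.toLeft.filter (K.Adj a)) Function.Embedding.inl]
  congr 1
  ext (b | b) <;> simp

theorem dg_sum_inr (a : β) (X : Finset (α ⊕ β)) : dg (K ⊕g L) (.inr a) X = dg L a X.toRight := by
  rw [dg, dg, ← Finset.card_map (s := X.toRight.filter (L.Adj a)) Function.Embedding.inr]
  congr 1
  ext (b | b) <;> simp

theorem sum_dg_sum (X Y : Finset (α ⊕ β)) : ∑ u ∈ X, dg (K ⊕g L) u Y =
    ∑ a ∈ X.toLeft, dg K a Y.toLeft + ∑ b ∈ X.toRight, dg L b Y.toRight := by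
  conv_lhs => rw [← Finset.toLeft_disjSum_toRight (u := X)]
  simp only [Finset.sum_disjSum, dg_sum_inl, dg_sum_inr]

theorem sum_dg_le_mul (X Y : Finset V) : ∑ u ∈ X, dg G u Y ≤ X.card * Y.card := by
  rw [← smul_eq_mul]
  exact Finset.sum_le_card_nsmul _ _ _ fun u _ => dg_le_card

theorem sum_dg_self_le (X : Finset V) : ∑ u ∈ X, dg G u X ≤ X.card * (X.card - 1) := by
  rw [← smul_eq_mul]
  exact Finset.sum_le_card_nsmul _ _ _ fun u hu => Nat.le_sub_one_of_lt (dg_lt_card hu)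

theorem EdgeBounds.sum [Fintype β] (hK : EdgeBounds K) (hβ : Fintype.card β ≤ 4) :
    EdgeBounds (K ⊕g L) where
  inner S hS := by
    rw [sum_dg_sum]
    rw [← Finset.card_toLeft_add_card_toRight] at hS ⊢
    have h1 := sum_dg_self_le (G := L) S.toRight
    have h2 := sum_dg_self_le (G := K) S.toLeft
    have h3 := hK.inner S.toLeft
    have h4 : S.toRight.card ≤ 4 := (Finset.card_le_univ _).trans hβ
    generalize S.toRight.card = k at *
    generalize S.toLeft.card = l at *
    by_cases hl : 3 ≤ l
    · have := h3 hl
      interval_cases k <;> omega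
    · clear h3
      interval_cases l <;> interval_cases k <;> omega
  cross X Y hXY hS := by
    rw [sum_dg_sum]
    have hXY₁ : Disjoint X.toLeft Y.toLeft := Finset.disjoint_left.2 fun a ha hb =>
      Finset.disjoint_left.1 hXY (Finset.mem_toLeft.1 ha) (Finset.mem_toLeft.1 hb)
    have hXY₂ : Disjoint X.toRight Y.toRight := Finset.disjoint_left.2 fun a ha hb =>
      Finset.disjoint_left.1 hXY (Finset.mem_toRight.1 ha) (Finset.mem_toRight.1 hb)
    rw [← Finset.card_toLeft_add_card_toRight (u := X),
      ← Finset.card_toLeft_add_card_toRight (u := Y)] at hS ⊢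
    have h1 := sum_dg_le_mul (G := L) X.toRight Y.toRight
    have h2 := sum_dg_le_mul (G := K) X.toLeft Y.toLeft
    have h3 := hK.cross X.toLeft Y.toLeft hXY₁
    have h4 : (X.toRight ∪ Y.toRight).card ≤ 4 := (Finset.card_le_univ _).trans hβ
    rw [Finset.card_union_of_disjoint hXY₂] at h4
    generalize X.toRight.card = k at *
    generalize Y.toRight.card = k' at *
    generalize X.toLeft.card = l at *
    generalize Y.toLeft.card = l' at *
    have hk : k ≤ 4 := by omega
    have hk' : k' ≤ 4 := by omega
    by_cases hl : 3 ≤ l + l'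
    · have := h3 hl
      interval_cases k <;> interval_cases k' <;> omega
    · clear h3
      have hl1 : l ≤ 2 := by omega
      have hl2 : l' ≤ 2 := by omega
      interval_cases l <;> interval_cases l' <;> interval_cases k <;> interval_cases k' <;> omega

variable [Fintype V]

/-- The subset `U` has a coloring whose class sizes are `s` or `s - 1`. -/
def PartDone (G : SimpleGraph V) (r s : ℕ) (U : Finset V) : Prop :=
  ∃ c : V → Option (Fin r), Proper G c ∧ (∀ v, c v = none ↔ v ∉ U) ∧
    ∀ j, (cls c j).card ≤ s ∧ s ≤ (cls c j).card + 1

theorem EdgeBounds.partDone_of_le_four (hG : EdgeBounds G) (hr : 8 ≤ r)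
    (hdeg : ∀ v, dg G v Finset.univ ≤ r) {U : Finset V} (hU : U.card + p = r * s) (hp : p ≤ 4) :
    PartDone G r s U := by
  have hH := (hG.comap (Function.Embedding.subtype (· ∈ U))).sum
    (L := (⊤ : SimpleGraph (Fin p))) (by simpa using hp)
  have hdegH : ∀ v, dg (G.comap (Function.Embedding.subtype (· ∈ U)) ⊕g (⊤ : SimpleGraph (Fin p))) v
      Finset.univ ≤ r := by
    intro v
    rcases v with a | i
    · rw [dg_sum_inl, dg_comap]
      exact (dg_mono (Finset.subset_univ _)).trans (hdeg _)
    · rw [dg_sum_inr]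
      have := (dg_le_card (G := (⊤ : SimpleGraph (Fin p))) (v := i)
        (X := Finset.toRight (Finset.univ : Finset ({v // v ∈ U} ⊕ Fin p)))).trans
          (Finset.card_le_univ _)
      rw [Fintype.card_fin] at this
      omega
  obtain ⟨d, hd, hdn, hdc⟩ := hH.done (s := s) hr hdegH (by simpa using hU)
  refine ⟨fun v => if h : v ∈ U then d (.inl ⟨v, h⟩) else none, fun u v j huv hu hv => ?_,
    fun v => ?_, fun j => ?_⟩
  · by_cases h1 : u ∈ U
    · by_cases h2 : v ∈ U
      · simp only [h1, h2, dite_true] at hu hv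
        exact hd (.inl ⟨u, h1⟩) (.inl ⟨v, h2⟩) j (by simpa using huv) hu hv
      · simp [h2] at hv
    · simp [h1] at hu
  · by_cases h1 : v ∈ U <;> simp [h1, hdn]
  · have h1 : cls (fun v => if h : v ∈ U then d (.inl ⟨v, h⟩) else none) j =
        (cls d j).toLeft.map (Function.Embedding.subtype (· ∈ U)) := by
      ext v
      by_cases h1 : v ∈ U <;> simp [h1]
    have h2 : (cls d j).toRight.card ≤ 1 := by
      refine Finset.card_le_one.2 fun a ha b hb => ?_
      by_contra hab
      exact hd (.inr a) (.inr b) j (by simpa using hab) (by simpa using ha) (by simpa using hb)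
    have h3 := Finset.card_toLeft_add_card_toRight (u := cls d j)
    rw [h1, Finset.card_map]
    rw [hdc] at h3
    omega
theorem card_un_univ (c : V → Option (Fin r)) {U : Finset V} (hc : ∀ v, c v = none ↔ v ∉ U) :
    ∑ j, (cls c j).card = U.card := by
  rw [← card_un]
  congr 1
  ext v
  have := hc v
  rw [mem_un]
  by_cases hv : v ∈ U
  · simpa [hv] using Option.ne_none_iff_exists'.1 (by simpa [hv] using this)
  · simp [hv, this.2 hv]

theorem EdgeBounds.partDone (hG : EdgeBounds G) (hr : 8 ≤ r)
    (hdeg : ∀ v, dg G v Finset.univ ≤ r) {U : Finset V} (hU : U.card + p = r * s) (hp : p < r) :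
    PartDone G r s U := by
  induction hn : U.card generalizing U p s with
  | zero =>
    have hp0 : p = 0 := by
      rw [hn, zero_add] at hU
      exact Nat.eq_zero_of_dvd_of_lt ⟨s, hU⟩ hp
    exact hG.partDone_of_le_four hr hdeg hU (by omega)
  | succ n ih =>
    by_cases hp4 : p ≤ 4
    · exact hG.partDone_of_le_four hr hdeg hU hp4
    obtain ⟨x, hxU, hx⟩ := hG.exists_dg_le_five (Finset.card_pos.1 (by omega : 0 < U.card))
    have hcard : (U.erase x).card = n := by rw [Finset.card_erase_of_mem hxU]; omega
    obtain ⟨c, hc, hcn, hcs⟩ : PartDone G r s (U.erase x) := by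
      by_cases hpr : p + 1 = r
      · obtain ⟨t, rfl⟩ : ∃ t, s = t + 1 := Nat.exists_eq_succ_of_ne_zero (by rintro rfl; omega)
        have hU' : (U.erase x).card + 0 = r * t := by rw [Nat.mul_succ] at hU; omega
        obtain ⟨c, hc, hcn, hcs⟩ := hG.partDone_of_le_four hr hdeg hU' (by omega)
        have h1 := card_un_univ c hcn
        have h2 : ∑ j : Fin r, (cls c j).card = ∑ j : Fin r, t := by
          rw [h1, Finset.sum_const, Finset.card_univ, Fintype.card_fin, smul_eq_mul]
          omega
        have h3 := (Finset.sum_eq_sum_iff_of_le fun j _ => (hcs j).1).1 h2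
        exact ⟨c, hc, hcn, fun j => by have := h3 j (Finset.mem_univ j); omega⟩
      · exact ih (p := p + 1) (s := s) (by omega) (by omega) hcard
    have hcx : c x = none := (hcn x).2 (by simp)
    have h1 := card_un_univ c hcn
    set M := Finset.univ.filter fun j => (cls c j).card < s with hM
    have h2 : ∑ j, ((cls c j).card + if (cls c j).card < s then 1 else 0) = r * s := by
      rw [Finset.sum_congr rfl fun j _ => show _ = s by have := hcs j; split_ifs <;> omega]
      simp
    rw [Finset.sum_add_distrib, h1, ← Finset.card_filter, ← hM] at h2
    obtain ⟨j, hjM, hfree⟩ : ∃ j ∈ M, Free G c x j := by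
      by_contra! hcon
      have h3 : M.card ≤ dg G x (un c M) := card_le_dg_un fun j hj => dg_cls_pos.2 (hcon j hj)
      have h4 : dg G x (un c M) ≤ dg G x U := dg_mono fun v hv => by
        obtain ⟨j, -, hj⟩ := mem_un.1 hv
        have := (hcn v).not.1 (by simp [hj])
        rw [not_not] at this
        exact Finset.mem_of_mem_erase this
      omega
    refine ⟨Function.update c x (some j), hc.update hfree, fun v => ?_, fun l => ?_⟩
    · by_cases hv : v = x
      · subst hv; simp [hxU]
      · rw [Function.update_of_ne hv, hcn]; simp [hv]
    · have h3 := card_cls_update (c := c) (v := x) (l := l) (some j)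
      have h4 := hcs l
      have h5 := (Finset.mem_filter.1 hjM).2
      rw [hcx] at h3
      simp only [Option.some.injEq, reduceCtorEq, if_false] at h3
      split_ifs at h3 with hjl
      · subst hjl; omega
      · omega

theorem EdgeBounds.exists_equitable (hG : EdgeBounds G) (hr : 8 ≤ r)
    (hdeg : ∀ v, dg G v Finset.univ ≤ r) : ∃ c : V → Fin r, IsEquitableColoring G r c := by
  obtain ⟨p, s, hp, hU⟩ : ∃ p s, p < r ∧ (Finset.univ : Finset V).card + p = r * s := by
    have h1 := Nat.div_add_mod (Finset.univ : Finset V).card r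
    have h2 := Nat.mod_lt (Finset.univ : Finset V).card (show r > 0 by omega)
    by_cases h0 : (Finset.univ : Finset V).card % r = 0
    · exact ⟨0, (Finset.univ : Finset V).card / r, by omega, by omega⟩
    · exact ⟨r - (Finset.univ : Finset V).card % r, (Finset.univ : Finset V).card / r + 1,
        by omega, by rw [Nat.mul_succ]; omega⟩
  obtain ⟨c, hc, hcn, hcs⟩ := hG.partDone hr hdeg hU hp
  have hsome : ∀ v, ∃ j, c v = some j := fun v =>
    Option.ne_none_iff_exists'.1 ((hcn v).not.2 (by simp))
  choose f hf using hsome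
  have hcls : ∀ j, cls c j = Finset.univ.filter fun v => f v = j := fun j => by
    ext v; simp [hf]
  refine ⟨f, fun u v huv hfe => hc u v (f u) huv (hf u) (by rw [hf v, hfe]), fun i j => ?_⟩
  rw [← hcls, ← hcls]
  exact (hcs i).1.trans (hcs j).2

end Padding

/-- **Theorem 1.4.** Every graph with maximum degree at most `r ≥ 8` satisfying the
planar edge bounds has an equitable `r`-coloring. -/
theorem planar_equitable_coloring (V : Type*) [Fintype V] (G : SimpleGraph V)
    (r : ℕ) (hr : 8 ≤ r) (hΔ : ∀ v : V, G.degree v ≤ r)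
    (hG : PlanarBounds G) :
    ∃ c : V → Fin r, IsEquitableColoring G r c := by
  refine hG.edgeBounds.exists_equitable hr fun v => (le_of_eq ?_).trans (hΔ v)
  rw [dg, ← SimpleGraph.card_neighborFinset_eq_degree, SimpleGraph.neighborFinset_eq_filter]

end Equitable
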